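/- Restrict to POMDPs with rational data, i.e., q(k, a) has rational probabilities for all (k, a), g takes values in ℚ ∩ [0,1], and the initial belief p₁ has rational coordinates; such an instance (Γ, p₁) together with a rational x can be encoded as a natural number. Then the set {(Γ, p₁, x) : Γ a POMDP with rational data, p₁ a rational initial belief, x ∈ ℚ, v_∞(p₁) > x} is recursively enumerable (i.e., Σ⁰₁): there is a partial computable function that halts on an encoded instance if and only if v_∞(p₁) > x. -/

import Mathlib

open MeasureTheory Filter

namespace PomdpPaper

/-- A belief (probability vector) on `Fin n`. -/
def IsBelief {n : ℕ} (p : Fin n → ℝ) : Prop :=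
  (∀ k, 0 ≤ p k) ∧ ∑ k, p k = 1

/-- The measure on a finite type associated with a probability vector. -/
noncomputable def vecMeasure {α : Type*} [Fintype α] [MeasurableSpace α] (p : α → ℝ) :
    Measure α :=
  ∑ x : α, ENNReal.ofReal (p x) • Measure.dirac x

/-- The Dirac belief at a point. -/
def diracBelief {n : ℕ} (k : Fin n) : Fin n → ℝ := fun k' => if k' = k then 1 else 0

/-- The `i`-th binary digit of a real number `x ∈ [0,1)` (as a real number `0` or `1`). -/
noncomputable def digitR (x : ℝ) (i : ℕ) : ℝ :=
  if ⌊x * 2 ^ (i + 1)⌋ % 2 = 1 then 1 else 0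

/-- From one uniform seed `x ∈ [0,1)`, a sequence `unif x 0, unif x 1, …` of
(independent, uniformly distributed on `[0,1]`) real numbers, obtained by splitting the
binary digits of `x` along the pairing function. -/
noncomputable def unif (x : ℝ) (m : ℕ) : ℝ :=
  ∑' j : ℕ, digitR x (Nat.pair m j) / 2 ^ (j + 1)

open Classical in
/-- Inverse-transform sampling from a probability vector on `Fin n` using a seed `u ∈ [0,1]`. -/
noncomputable def sampleFin {n : ℕ} (hn : 0 < n) (p : Fin n → ℝ) (u : ℝ) : Fin n :=
  let s : Finset (Fin n) :=
    Finset.univ.filter fun y : Fin n => u < ∑ z ∈ Finset.univ.filter fun z : Fin n => z ≤ y, p z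
  if hs : s.Nonempty then s.min' hs else ⟨0, hn⟩

/-- Inverse-transform sampling from a probability vector on a finite nonempty type. -/
noncomputable def sampleOn {β : Type*} [Fintype β] [Nonempty β] (p : β → ℝ) (u : ℝ) : β :=
  (Fintype.equivFin β).symm
    (sampleFin Fintype.card_pos (fun i => p ((Fintype.equivFin β).symm i)) u)

/-- A POMDP with states `Fin nK`, actions `Fin nA`, signals `Fin nS`, transition function `q`
and reward function `g` with values in `[0,1]`. -/
structure POMDP where
  nK : ℕ
  nA : ℕ
  nS : ℕ
  hK : 0 < nK
  hA : 0 < nA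
  hS : 0 < nS
  q : Fin nK → Fin nA → Fin nK × Fin nS → ℝ
  q_nonneg : ∀ k a y, 0 ≤ q k a y
  q_sum : ∀ k a, ∑ y, q k a y = 1
  g : Fin nK → Fin nA → ℝ
  g_nonneg : ∀ k a, 0 ≤ g k a
  g_le_one : ∀ k a, g k a ≤ 1

namespace POMDP

variable (Γ : POMDP)

/-- The state space. -/
abbrev K := Fin Γ.nK
/-- The action space. -/
abbrev A := Fin Γ.nA
/-- The signal space. -/
abbrev S := Fin Γ.nS

instance : Nonempty Γ.K := ⟨⟨0, Γ.hK⟩⟩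
instance : Nonempty Γ.A := ⟨⟨0, Γ.hA⟩⟩
instance : Nonempty Γ.S := ⟨⟨0, Γ.hS⟩⟩

/-- A history: the finite sequence of past actions and signals. -/
abbrev Hist := List (Γ.A × Γ.S)

/-- A (pure) strategy: a map from histories to actions. -/
abbrev Strategy := Γ.Hist → Γ.A

/-- The sample space carrying all the randomness: an initial state together with a
uniform seed in `[0,1)` used to draw all the transitions. -/
abbrev Env := Γ.K × ℝ

/-- The probability measure on the sample space induced by the initial belief `p1`:
the initial state is drawn according to `p1`, the seed uniformly on `[0,1)`. -/
noncomputable def envMeasure (p1 : Γ.K → ℝ) : Measure Γ.Env :=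
  (vecMeasure p1).prod (volume.restrict (Set.Ico (0 : ℝ) 1))

/-- The trajectory: `(Γ.traj σ ω m).1` is the state `k_{m+1}` at stage `m+1` and
`(Γ.traj σ ω m).2` is the history before stage `m+1` (of length `m`), when the
decision-maker uses strategy `σ` and the randomness is `ω`.  At each stage, the pair
(new state, signal) is drawn from `q` via inverse-transform sampling from a fresh
uniform variable. -/
noncomputable def traj (σ : Γ.Strategy) (ω : Γ.Env) : ℕ → Γ.K × Γ.Hist
  | 0 => (ω.1, [])
  | m + 1 =>
    let p := traj σ ω m
    let a := σ p.2
    let y := sampleOn (Γ.q p.1 a) (unif ω.2 m)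
    (y.1, p.2 ++ [(a, y.2)])

/-- The state `k_{m+1}` at stage `m+1` (`m` is 0-indexed). -/
noncomputable def state (σ : Γ.Strategy) (ω : Γ.Env) (m : ℕ) : Γ.K := (Γ.traj σ ω m).1

/-- The history before stage `m+1` (a list of length `m`). -/
noncomputable def hist (σ : Γ.Strategy) (ω : Γ.Env) (m : ℕ) : Γ.Hist := (Γ.traj σ ω m).2

/-- The action `a_{m+1}` played at stage `m+1`. -/
noncomputable def act (σ : Γ.Strategy) (ω : Γ.Env) (m : ℕ) : Γ.A := σ (Γ.hist σ ω m)

/-- The reward `g_{m+1}` obtained at stage `m+1`. -/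
noncomputable def rew (σ : Γ.Strategy) (ω : Γ.Env) (m : ℕ) : ℝ :=
  Γ.g (Γ.state σ ω m) (Γ.act σ ω m)

/-- The average reward over the first `n` stages. -/
noncomputable def avg (σ : Γ.Strategy) (ω : Γ.Env) (n : ℕ) : ℝ :=
  (1 / n : ℝ) * ∑ m ∈ Finset.range n, Γ.rew σ ω m

/-- The probability of an event under initial belief `p1` (the strategy `σ` is recorded for
readability; the underlying measure does not depend on it). -/
noncomputable def prob (p1 : Γ.K → ℝ) (_σ : Γ.Strategy) (E : Set Γ.Env) : ℝ :=
  (Γ.envMeasure p1 E).toReal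

/-- The long-run average payoff `γ^{p1}_∞(σ) = E[liminf (1/n) ∑ g_m]`. -/
noncomputable def pay (p1 : Γ.K → ℝ) (σ : Γ.Strategy) : ℝ :=
  ∫ ω, atTop.liminf (Γ.avg σ ω) ∂(Γ.envMeasure p1)

/-- The payoff starting from a deterministic state `k`, i.e. `γ^k_∞(σ)`. -/
noncomputable def payK (k : Γ.K) (σ : Γ.Strategy) : ℝ := Γ.pay (diracBelief k) σ

/-- The value `v_∞(p1)`. -/
noncomputable def val (p1 : Γ.K → ℝ) : ℝ := ⨆ σ : Γ.Strategy, Γ.pay p1 σ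

/-- A strategy has finite memory if it is implemented by a finite-state transducer. -/
def FiniteMemory (σ : Γ.Strategy) : Prop :=
  ∃ (n : ℕ) (m0 : Fin n) (σa : Fin n → Γ.A) (σu : Fin n → Γ.A × Γ.S → Fin n),
    ∀ h : Γ.Hist, σ h = σa (h.foldl σu m0)

/-- A blind MDP: the signal set is a singleton. -/
def Blind : Prop := Γ.nS = 1

/-- The strategy induced by a sequence of actions `a_1, a_2, …` (`as m` is the action played
at stage `m+1`, regardless of the observed history). -/
def blindStrat (as : ℕ → Γ.A) : Γ.Strategy := fun h => as h.length

end POMDP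

/-- A sequence is eventually periodic if it is periodic with some period `T ≥ 1` from
some stage `N` on. -/
def EventuallyPeriodic {α : Type*} (as : ℕ → α) : Prop :=
  ∃ T ≥ 1, ∃ N ≥ 1, ∀ m ≥ N, as (m + T) = as m


/-- The data of a POMDP with rational transition probabilities and rewards, a rational
initial belief, and a rational threshold `x`. -/
structure RatData where
  nK : ℕ
  nA : ℕ
  nS : ℕ
  q : Fin nK → Fin nA → Fin nK × Fin nS → ℚ
  g : Fin nK → Fin nA → ℚ
  p1 : Fin nK → ℚ
  x : ℚ

/-- Validity of the rational data: nonempty state, action and signal spaces, `q` a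
transition function, `g` with values in `[0,1]`, and `p1` a belief. -/
def RatData.Valid (d : RatData) : Prop :=
  0 < d.nK ∧ 0 < d.nA ∧ 0 < d.nS ∧
  (∀ k a y, 0 ≤ d.q k a y) ∧ (∀ k a, ∑ y, d.q k a y = 1) ∧
  (∀ k a, 0 ≤ d.g k a) ∧ (∀ k a, d.g k a ≤ 1) ∧
  (∀ k, 0 ≤ d.p1 k) ∧ (∑ k, d.p1 k = 1)

/-- The POMDP (with real data) associated with valid rational data. -/
noncomputable def RatData.toPOMDP (d : RatData) (hd : d.Valid) : POMDP where
  nK := d.nK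
  nA := d.nA
  nS := d.nS
  hK := hd.1
  hA := hd.2.1
  hS := hd.2.2.1
  q := fun k a y => (d.q k a y : ℝ)
  q_nonneg := fun k a y => by exact_mod_cast hd.2.2.2.1 k a y
  q_sum := fun k a => by exact_mod_cast hd.2.2.2.2.1 k a
  g := fun k a => (d.g k a : ℝ)
  g_nonneg := fun k a => by exact_mod_cast hd.2.2.2.2.2.1 k a
  g_le_one := fun k a => by exact_mod_cast hd.2.2.2.2.2.2.1 k a

/-- A flat encoding of `RatData` as a sigma type. -/
abbrev RatCode : Type :=
  Σ t : ℕ × ℕ × ℕ,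
    (Fin t.1 → Fin t.2.1 → Fin t.1 × Fin t.2.2 → ℚ) ×
      (Fin t.1 → Fin t.2.1 → ℚ) × (Fin t.1 → ℚ) × ℚ

/-- `RatData` is equivalent to its flat encoding. -/
def ratDataEquiv : RatData ≃ RatCode where
  toFun d := ⟨(d.nK, d.nA, d.nS), (d.q, d.g, d.p1, d.x)⟩
  invFun s := ⟨s.1.1, s.1.2.1, s.1.2.2, s.2.1, s.2.2.1, s.2.2.2.1, s.2.2.2.2⟩
  left_inv d := rfl
  right_inv s := rfl

instance : Encodable RatData := Encodable.ofEquiv RatCode ratDataEquiv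

/-- Lebesgue measure on the unit interval. -/
noncomputable def U01 : Measure ℝ := volume.restrict (Set.Ico (0 : ℝ) 1)

instance : IsProbabilityMeasure U01 := ⟨by simp [U01]⟩

/-- A fair coin. -/
noncomputable def coin : Measure ℝ :=
  (2⁻¹ : ENNReal) • Measure.dirac 0 + (2⁻¹ : ENNReal) • Measure.dirac 1

instance : IsProbabilityMeasure coin := ⟨by simp [coin, ENNReal.inv_two_add_inv_two]⟩

lemma measurable_digitR (i : ℕ) : Measurable (fun x => digitR x i) := by
  unfold digitR
  refine Measurable.ite ?_ measurable_const measurable_const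
  have h : Measurable (fun x : ℝ => ⌊x * 2 ^ (i + 1)⌋) :=
    Int.measurable_floor.comp (measurable_id.mul_const _)
  exact h (t := {z | z % 2 = 1}) trivial

lemma digitR_zero_lt {x : ℝ} (h0 : 0 ≤ x) (h1 : x < 1 / 2) : digitR x 0 = 0 := by
  have : ⌊x * 2 ^ (0 + 1)⌋ = 0 := by
    rw [Int.floor_eq_iff]; constructor <;> norm_num <;> linarith
  simp only [digitR, this]; norm_num

lemma digitR_zero_ge {x : ℝ} (h0 : 1 / 2 ≤ x) (h1 : x < 1) : digitR x 0 = 1 := by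
  have : ⌊x * 2 ^ (0 + 1)⌋ = 1 := by
    rw [Int.floor_eq_iff]; constructor <;> norm_num <;> linarith
  simp only [digitR, this]; norm_num

lemma digitR_succ (x : ℝ) (i : ℕ) : digitR x (i + 1) = digitR (2 * x) i := by
  simp only [digitR]
  have : x * 2 ^ (i + 1 + 1) = 2 * x * 2 ^ (i + 1) := by ring
  rw [this]

lemma digitR_sub_one (x : ℝ) (i : ℕ) : digitR (x - 1) i = digitR x i := by
  simp only [digitR]
  have : (x - 1) * 2 ^ (i + 1) = x * 2 ^ (i + 1) - ((2 ^ (i + 1) : ℤ) : ℝ) := by push_cast; ring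
  rw [this, Int.floor_sub_intCast]
  have h2 : (⌊x * 2 ^ (i + 1)⌋ - 2 ^ (i + 1)) % 2 = ⌊x * 2 ^ (i + 1)⌋ % 2 := by
    rw [pow_succ]; omega
  rw [h2]

lemma digit_cyl (n : ℕ) (t : ℕ → Set ℝ) (ht : ∀ i, MeasurableSet (t i)) :
    U01 {x | ∀ i < n, digitR x i ∈ t i} = ∏ i ∈ Finset.range n, coin (t i) := by
  classical
  induction n generalizing t with
  | zero => simp
  | succ n ih =>
    set E : Set ℝ := {x | ∀ i < n, digitR x i ∈ t (i + 1)} with hE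
    have hEU : volume (E ∩ Set.Ico 0 1) = ∏ i ∈ Finset.range n, coin (t (i + 1)) := by
      rw [← ih (fun i => t (i + 1)) (fun i => ht _), U01, Measure.restrict_apply' measurableSet_Ico]
    have key : {x | ∀ i < n + 1, digitR x i ∈ t i} ∩ Set.Ico 0 1 =
        (if (0:ℝ) ∈ t 0 then (fun x => (2:ℝ) * x) ⁻¹' (E ∩ Set.Ico 0 1) else ∅) ∪
        (if (1:ℝ) ∈ t 0 then (fun x => (2:ℝ) * x) ⁻¹' ((fun x => x - 1) ⁻¹' (E ∩ Set.Ico 0 1))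
          else ∅) := by
      ext x
      have hall : (∀ i < n + 1, digitR x i ∈ t i) ↔ digitR x 0 ∈ t 0 ∧ (2 * x) ∈ E := by
        constructor
        · intro h
          refine ⟨h 0 (by omega), fun i hi => ?_⟩
          rw [← digitR_succ]; exact h (i + 1) (by omega)
        · rintro ⟨h0, h1⟩ i hi
          rcases i with _ | i
          · exact h0
          · rw [digitR_succ]; exact h1 i (by omega)
      have hsub : (2 * x - 1) ∈ E ↔ (2 * x) ∈ E := by
        simp only [hE, Set.mem_ofPred_eq, digitR_sub_one]
      have m1 : ∀ (P : Prop) [Decidable P] (A : Set ℝ) (y : ℝ),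
          y ∈ (if P then A else ∅) ↔ P ∧ y ∈ A := by
        intro P _ A y; by_cases hP : P <;> simp [hP]
      rw [Set.mem_inter_iff, Set.mem_ofPred_eq, hall, Set.mem_union, m1, m1]
      simp only [Set.mem_preimage, Set.mem_inter_iff, Set.mem_Ico, hsub]
      constructor
      · rintro ⟨⟨h0, h1⟩, h2, h3⟩
        by_cases hx : x < 1 / 2
        · left; rw [digitR_zero_lt h2 hx] at h0
          exact ⟨h0, h1, by linarith, by linarith⟩
        · right; push Not at hx; rw [digitR_zero_ge hx h3] at h0
          exact ⟨h0, h1, by linarith, by linarith⟩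
      · rintro (⟨h0, h1, h2, h3⟩ | ⟨h0, h1, h2, h3⟩)
        · rw [digitR_zero_lt (by linarith) (by linarith)]
          exact ⟨⟨h0, h1⟩, by linarith, by linarith⟩
        · rw [digitR_zero_ge (by linarith) (by linarith)]
          exact ⟨⟨h0, h1⟩, by linarith, by linarith⟩
    have hdisj : Disjoint (if (0:ℝ) ∈ t 0 then (fun x => (2:ℝ) * x) ⁻¹' (E ∩ Set.Ico 0 1) else ∅)
        (if (1:ℝ) ∈ t 0 then (fun x => (2:ℝ) * x) ⁻¹' ((fun x => x - 1) ⁻¹' (E ∩ Set.Ico 0 1))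
          else ∅) := by
      rw [Set.disjoint_left]
      intro x h1 h2
      split_ifs at h1 h2
      · have := h1.2.2; have := h2.2.1
        simp only at *; linarith
      all_goals simp_all
    have v1 : volume ((fun x => (2:ℝ) * x) ⁻¹' (E ∩ Set.Ico 0 1)) =
        2⁻¹ * volume (E ∩ Set.Ico 0 1) := by
      rw [Real.volume_preimage_mul_left (by norm_num)]
      congr 1
      rw [abs_of_pos (by norm_num), ENNReal.ofReal_inv_of_pos (by norm_num)]; norm_num
    have v2 : volume ((fun x => (2:ℝ) * x) ⁻¹' ((fun x => x - 1) ⁻¹' (E ∩ Set.Ico 0 1))) =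
        2⁻¹ * volume (E ∩ Set.Ico 0 1) := by
      rw [Real.volume_preimage_mul_left (by norm_num)]
      congr 1
      · rw [abs_of_pos (by norm_num), ENNReal.ofReal_inv_of_pos (by norm_num)]; norm_num
      · simp only [sub_eq_add_neg]
        exact measure_preimage_add_right volume (-1 : ℝ) _
    have hcoin : coin (t 0) = (if (0:ℝ) ∈ t 0 then 2⁻¹ else 0) + (if (1:ℝ) ∈ t 0 then 2⁻¹ else 0) := by
      simp only [coin, Measure.add_apply, Measure.smul_apply, smul_eq_mul]
      by_cases h0 : (0:ℝ) ∈ t 0 <;> by_cases h1 : (1:ℝ) ∈ t 0 <;>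
        simp [h0, h1, Measure.dirac_apply]
    have hEm : MeasurableSet (E ∩ Set.Ico 0 1) := by
      refine MeasurableSet.inter ?_ measurableSet_Ico
      have : E = ⋂ i, ⋂ (_ : i < n), (fun x => digitR x i) ⁻¹' (t (i + 1)) := by
        ext x; simp [hE]
      rw [this]
      exact MeasurableSet.iInter fun i => MeasurableSet.iInter fun _ =>
        measurable_digitR i (ht _)
    have hm2 : MeasurableSet (if (1:ℝ) ∈ t 0 then (fun x => (2:ℝ) * x) ⁻¹'
        ((fun x => x - 1) ⁻¹' (E ∩ Set.Ico 0 1)) else ∅) := by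
      split_ifs
      · exact (measurable_const_mul (2:ℝ)) ((measurable_id.sub_const (1:ℝ)) hEm)
      · exact MeasurableSet.empty
    rw [U01, Measure.restrict_apply' measurableSet_Ico, key]
    rw [Finset.prod_range_succ', ← hEU, hcoin, measure_union hdisj hm2]
    by_cases h0 : (0:ℝ) ∈ t 0 <;> by_cases h1 : (1:ℝ) ∈ t 0 <;>
      simp only [h0, h1, if_true, if_false, measure_empty, v1, v2] <;> ring

lemma digit_law : U01.map (fun x i => digitR x i) = Measure.infinitePi (fun _ : ℕ => coin) := by
  refine Measure.eq_infinitePi _ ?_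
  intro s t ht
  classical
  rw [Measure.map_apply (measurable_pi_lambda _ fun i => measurable_digitR i)
    (MeasurableSet.pi s.countable_toSet fun i _ => ht i)]
  obtain ⟨n, hn⟩ : ∃ n, s ⊆ Finset.range n := ⟨s.sup id + 1, fun i hi => by
    have := Finset.le_sup (f := id) hi
    simp only [id] at this
    simp only [Finset.mem_range]; omega⟩
  have h := digit_cyl n (fun i => if i ∈ s then t i else Set.univ) (fun i => by
    by_cases hi : i ∈ s <;> simp [hi, ht i])
  have e1 : ((fun x i => digitR x i) ⁻¹' (s : Set ℕ).pi t) =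
      {x | ∀ i < n, digitR x i ∈ (if i ∈ s then t i else Set.univ)} := by
    ext x
    simp only [Set.mem_preimage, Set.mem_pi, Set.mem_ofPred_eq, Finset.mem_coe]
    constructor
    · intro h i _
      by_cases hi : i ∈ s <;> simp [hi, h]
    · intro h i hi
      have := h i (by simpa using hn hi)
      simpa [hi] using this
  rw [e1, h, ← Finset.prod_subset hn]
  · exact Finset.prod_congr rfl fun i hi => by simp [hi]
  · intro i _ hi; simp [hi]

lemma digitR_partial (x : ℝ) (h0 : 0 ≤ x) (h1 : x < 1) (n : ℕ) :
    ∑ j ∈ Finset.range n, digitR x j / 2 ^ (j + 1) = ⌊x * 2 ^ n⌋ / 2 ^ n := by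
  induction n with
  | zero =>
    have : ⌊x⌋ = 0 := by rw [Int.floor_eq_iff]; constructor <;> norm_num <;> linarith
    simp [this]
  | succ n ih =>
    rw [Finset.sum_range_succ, ih]
    have hf : ⌊x * 2 ^ n⌋ = ⌊x * 2 ^ (n + 1)⌋ / 2 := by
      have : x * 2 ^ n = (x * 2 ^ (n + 1)) / ((2 : ℕ) : ℝ) := by push_cast; ring
      rw [this, Int.floor_div_natCast]; rfl
    have hd : digitR x n = ((⌊x * 2 ^ (n + 1)⌋ % 2 : ℤ) : ℝ) := by
      unfold digitR
      rcases Int.emod_two_eq_zero_or_one ⌊x * 2 ^ (n + 1)⌋ with h | h <;> simp [h]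
    have h2 : (⌊x * 2 ^ (n + 1)⌋ : ℤ) = 2 * (⌊x * 2 ^ (n + 1)⌋ / 2) + ⌊x * 2 ^ (n + 1)⌋ % 2 :=
      (Int.mul_ediv_add_emod _ _).symm
    rw [hf, hd]
    have h3 : ((⌊x * 2 ^ (n + 1)⌋ : ℤ) : ℝ) = 2 * ((⌊x * 2 ^ (n + 1)⌋ / 2 : ℤ) : ℝ) +
      ((⌊x * 2 ^ (n + 1)⌋ % 2 : ℤ) : ℝ) := by exact_mod_cast h2
    rw [h3, pow_succ]
    field_simp

lemma digitR_nonneg (x : ℝ) (i : ℕ) : 0 ≤ digitR x i := by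
  unfold digitR; split_ifs <;> norm_num

lemma digitR_tsum (x : ℝ) (h0 : 0 ≤ x) (h1 : x < 1) :
    ∑' j, digitR x j / 2 ^ (j + 1) = x := by
  have : HasSum (fun j => digitR x j / 2 ^ (j + 1)) x := by
    rw [hasSum_iff_tendsto_nat_of_nonneg (fun i => div_nonneg (digitR_nonneg x i) (by positivity))]
    simp_rw [digitR_partial x h0 h1]
    have ht : Tendsto (fun n : ℕ => x - (1 / 2 : ℝ) ^ n) atTop (nhds (x - 0)) :=
      tendsto_const_nhds.sub (tendsto_pow_atTop_nhds_zero_of_lt_one (by norm_num) (by norm_num))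
    rw [sub_zero] at ht
    refine tendsto_of_tendsto_of_tendsto_of_le_of_le ht tendsto_const_nhds ?_ ?_
    · intro n
      have := Int.lt_floor_add_one (x * 2 ^ n)
      have h2 : (0:ℝ) < 2 ^ n := by positivity
      simp only [one_div, inv_pow]
      rw [le_div_iff₀ h2, sub_mul, inv_mul_cancel₀ h2.ne']
      linarith
    · intro n
      have := Int.floor_le (x * 2 ^ n)
      have h2 : (0:ℝ) < 2 ^ n := by positivity
      simp only
      rw [div_le_iff₀ h2]; exact this
  exact this.tsum_eq

/-- Binary expansion. -/
noncomputable def binR (b : ℕ → ℝ) : ℝ := ∑' j, b j / 2 ^ (j + 1)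

lemma measurable_binR : Measurable binR := by
  unfold binR
  fun_prop

lemma binR_law : (Measure.infinitePi (fun _ : ℕ => coin)).map binR = U01 := by
  rw [← digit_law, Measure.map_map measurable_binR
    (measurable_pi_lambda _ fun i => measurable_digitR i)]
  have : (binR ∘ fun x i => digitR x i) =ᵐ[U01] id := by
    have h : ∀ᵐ x ∂U01, x ∈ Set.Ico (0:ℝ) 1 := ae_restrict_mem measurableSet_Ico
    filter_upwards [h] with x hx
    exact digitR_tsum x hx.1 hx.2
  rw [Measure.map_congr this, Measure.map_id]

lemma measurable_unif (m : ℕ) : Measurable (fun x => unif x m) := by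
  have : (fun x => unif x m) = fun x => binR (fun j => digitR x (Nat.pair m j)) := rfl
  rw [this]
  exact measurable_binR.comp (measurable_pi_lambda _ fun i => measurable_digitR _)

lemma unif_law : U01.map (fun x m => unif x m) = Measure.infinitePi (fun _ : ℕ => U01) := by
  have h1 : (Measure.infinitePi (fun _ : ℕ => coin)).map
      (fun (b : ℕ → ℝ) (p : ℕ × ℕ) => b (Nat.pair p.1 p.2)) =
      Measure.infinitePi (fun _ : ℕ × ℕ => coin) :=
    Measure.map_infinitePi_infinitePi_of_inj (P := fun _ : ℕ => coin)
      (f := fun p : ℕ × ℕ => Nat.pair p.1 p.2)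
      (fun p p' h => by
        have := Nat.pair_eq_pair.1 h
        exact Prod.ext this.1 this.2)
  have h2 := Measure.infinitePi_map_curry (fun (_ : ℕ) (_ : ℕ) => coin)
  have h3 := Measure.infinitePi_map_pi
    (fun _ : ℕ => Measure.infinitePi (fun _ : ℕ => coin)) (f := fun _ => binR)
    (fun _ => measurable_binR)
  simp only [binR_law] at h3
  rw [← h3, ← h2, ← h1, ← digit_law]
  have m1 : Measurable (fun x i => digitR x i) :=
    measurable_pi_lambda _ fun i => measurable_digitR i
  have m2 : Measurable (fun (b : ℕ → ℝ) (p : ℕ × ℕ) => b (Nat.pair p.1 p.2)) := by fun_prop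
  have m3 : Measurable (fun (x : ℕ → ℕ → ℝ) i => binR (x i)) :=
    measurable_pi_lambda _ fun i => measurable_binR.comp (measurable_pi_apply i)
  rw [Measure.map_map m2 m1, Measure.map_map (MeasurableEquiv.measurable _) (m2.comp m1),
    Measure.map_map m3 ((MeasurableEquiv.measurable _).comp (m2.comp m1))]
  rfl

lemma unif_map (m : ℕ) : U01.map (fun x => unif x m) = U01 := by
  have h : (U01.map (fun x m => unif x m)).map (fun u : ℕ → ℝ => u m) = U01 := by
    rw [unif_law, Measure.infinitePi_map_eval]
  rwa [Measure.map_map (measurable_pi_apply m)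
    (measurable_pi_lambda _ fun i => measurable_unif i)] at h

lemma unif_indep : ProbabilityTheory.iIndepFun (fun m x => unif x m) U01 := by
  rw [ProbabilityTheory.iIndepFun_iff_map_fun_eq_infinitePi_map (fun m => measurable_unif m)]
  rw [unif_law]
  simp only [unif_map]

section sample

lemma measurable_sampleFin {n : ℕ} (hn : 0 < n) (p : Fin n → ℝ) :
    Measurable (sampleFin hn p) := by
  classical
  let F : ℝ → (Fin n → Bool) := fun u y =>
    decide (u < ∑ z ∈ Finset.univ.filter fun z : Fin n => z ≤ y, p z)
  let G : (Fin n → Bool) → Fin n := fun b =>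
    if hs : (Finset.univ.filter fun y : Fin n => b y = true).Nonempty then
      (Finset.univ.filter fun y : Fin n => b y = true).min' hs else ⟨0, hn⟩
  have hF : Measurable F := by
    refine measurable_pi_lambda _ fun y => ?_
    refine measurable_to_bool ?_
    have : (fun u => F u y) ⁻¹' {true} =
      Set.Iio (∑ z ∈ Finset.univ.filter fun z : Fin n => z ≤ y, p z) := by
      ext u; simp [F]
    rw [this]; exact measurableSet_Iio
  have hG : Measurable G := measurable_of_countable G
  have : sampleFin hn p = G ∘ F := by
    funext u
    simp only [sampleFin, G, F, Function.comp, decide_eq_true_eq]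
  rw [this]; exact hG.comp hF

lemma sampleFin_iff {n : ℕ} (hn : 0 < n) (p : Fin n → ℝ) (h0 : ∀ i, 0 ≤ p i)
    (h1 : ∑ i, p i = 1) (y : Fin n) {u : ℝ} (hu0 : 0 ≤ u) (hu1 : u < 1) :
    sampleFin hn p u = y ↔ ∑ z ∈ Finset.univ.filter (fun z => z < y), p z ≤ u ∧
      u < ∑ z ∈ Finset.univ.filter (fun z => z ≤ y), p z := by
  classical
  have hs : (Finset.univ.filter fun y : Fin n =>
      u < ∑ z ∈ Finset.univ.filter fun z : Fin n => z ≤ y, p z).Nonempty := by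
    refine ⟨⟨n - 1, by omega⟩, ?_⟩
    simp only [Finset.mem_filter, Finset.mem_univ, true_and]
    rw [Finset.filter_true_of_mem, h1]
    · exact hu1
    · intro z _; rw [Fin.le_def]; simp only; omega
  have e : sampleFin hn p u = (Finset.univ.filter fun y : Fin n =>
      u < ∑ z ∈ Finset.univ.filter fun z : Fin n => z ≤ y, p z).min' hs := by
    simp only [sampleFin]
    rw [dif_pos]
  rw [e]
  constructor
  · rintro rfl
    set y := (Finset.univ.filter fun y : Fin n =>
      u < ∑ z ∈ Finset.univ.filter fun z : Fin n => z ≤ y, p z).min' hs with hy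
    have hm := Finset.min'_mem _ hs
    rw [← hy] at hm
    refine ⟨?_, (Finset.mem_filter.1 hm).2⟩
    by_cases h : y.val = 0
    · rw [Finset.filter_false_of_mem]
      · simpa using hu0
      · intro z _; rw [Fin.lt_def]; omega
    · by_contra hc
      push Not at hc
      have h2 : (⟨y.val - 1, by omega⟩ : Fin n) ∈ (Finset.univ.filter fun y : Fin n =>
          u < ∑ z ∈ Finset.univ.filter fun z : Fin n => z ≤ y, p z) := by
        simp only [Finset.mem_filter, Finset.mem_univ, true_and]
        have e2 : (Finset.univ.filter fun z : Fin n => z ≤ ⟨y.val - 1, by omega⟩) =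
            Finset.univ.filter fun z : Fin n => z < y := by
          ext z
          simp only [Finset.mem_filter, Finset.mem_univ, true_and]
          rw [Fin.le_def, Fin.lt_def]; simp only; omega
        rw [e2]; exact hc
      have := Finset.min'_le _ _ h2
      rw [← hy, Fin.le_def] at this
      simp only at this; omega
  · rintro ⟨ha, hb⟩
    apply le_antisymm
    · exact Finset.min'_le _ _ (by simpa using hb)
    · refine Finset.le_min' _ _ _ fun z hz => ?_
      by_contra hc
      push Not at hc
      have hz2 := (Finset.mem_filter.1 hz).2
      have : ∑ w ∈ Finset.univ.filter (fun w => w ≤ z), p w ≤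
          ∑ w ∈ Finset.univ.filter (fun w => w < y), p w := by
        refine Finset.sum_le_sum_of_subset_of_nonneg ?_ fun i _ _ => h0 i
        intro w hw
        simp only [Finset.mem_filter, Finset.mem_univ, true_and] at hw ⊢
        exact lt_of_le_of_lt hw hc
      linarith

lemma sampleFin_law {n : ℕ} (hn : 0 < n) (p : Fin n → ℝ) (h0 : ∀ i, 0 ≤ p i)
    (h1 : ∑ i, p i = 1) (y : Fin n) : U01 {u | sampleFin hn p u = y} = ENNReal.ofReal (p y) := by
  rw [U01, Measure.restrict_apply' measurableSet_Ico]
  have hsplit : ∑ z ∈ Finset.univ.filter (fun z => z ≤ y), p z =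
      p y + ∑ z ∈ Finset.univ.filter (fun z => z < y), p z := by
    have : Finset.univ.filter (fun z => z ≤ y) =
      insert y (Finset.univ.filter (fun z => z < y)) := by
      ext z; simp [le_iff_eq_or_lt]
    rw [this, Finset.sum_insert (by simp)]
  have hle : ∑ z ∈ Finset.univ.filter (fun z => z ≤ y), p z ≤ 1 := by
    rw [← h1]; exact Finset.sum_le_sum_of_subset_of_nonneg (Finset.filter_subset _ _)
      fun i _ _ => h0 i
  have hge : 0 ≤ ∑ z ∈ Finset.univ.filter (fun z => z < y), p z :=
    Finset.sum_nonneg fun i _ => h0 i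
  have : {u | sampleFin hn p u = y} ∩ Set.Ico 0 1 =
      Set.Ico (∑ z ∈ Finset.univ.filter (fun z => z < y), p z)
        (∑ z ∈ Finset.univ.filter (fun z => z ≤ y), p z) := by
    ext u
    simp only [Set.mem_inter_iff, Set.mem_ofPred_eq, Set.mem_Ico]
    constructor
    · rintro ⟨h, ha, hb⟩; exact (sampleFin_iff hn p h0 h1 y ha hb).1 h
    · rintro ⟨ha, hb⟩
      have a1 : 0 ≤ u := by linarith
      have a2 : u < 1 := by linarith
      exact ⟨(sampleFin_iff hn p h0 h1 y a1 a2).2 ⟨ha, hb⟩, a1, a2⟩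
  rw [this, Real.volume_Ico, hsplit]; congr 1; ring

variable {β : Type*} [Fintype β] [Nonempty β]

lemma measurable_sampleOn [MeasurableSpace β] (p : β → ℝ) :
    Measurable (sampleOn p) := by
  unfold sampleOn
  exact (measurable_of_countable (Fintype.equivFin β).symm).comp (measurable_sampleFin _ _)

lemma sampleOn_law (p : β → ℝ) (h0 : ∀ i, 0 ≤ p i)
    (h1 : ∑ i, p i = 1) (y : β) : U01 {u | sampleOn p u = y} = ENNReal.ofReal (p y) := by
  have := sampleFin_law Fintype.card_pos (fun i => p ((Fintype.equivFin β).symm i))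
    (fun i => h0 _) (by rw [← h1]; exact Equiv.sum_comp (Fintype.equivFin β).symm p)
    (Fintype.equivFin β y)
  simp only [Equiv.symm_apply_apply] at this
  rw [← this]
  congr 1
  ext u
  simp only [Set.mem_ofPred_eq, sampleOn]
  rw [Equiv.symm_apply_eq]

lemma sampleOn_integral (p : β → ℝ) (h0 : ∀ i, 0 ≤ p i)
    (h1 : ∑ i, p i = 1) (f : β → ℝ) : ∫ u, f (sampleOn p u) ∂U01 = ∑ y, p y * f y := by
  classical
  let _ : MeasurableSpace β := ⊤
  have e : ∀ u, f (sampleOn p u) = ∑ y, Set.indicator {u | sampleOn p u = y} (fun _ => f y) u := by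
    intro u
    simp [Set.indicator_apply]
  have hm : ∀ y, MeasurableSet {u | sampleOn p u = y} := fun y =>
    measurable_sampleOn p (MeasurableSpace.measurableSet_top (s := {y}))
  simp_rw [e]
  rw [integral_finsetSum]
  · refine Finset.sum_congr rfl fun y _ => ?_
    rw [integral_indicator (hm y), setIntegral_const, measureReal_def, sampleOn_law p h0 h1 y,
      ENNReal.toReal_ofReal (h0 y), smul_eq_mul]
  · intro y _
    exact (integrable_const _).indicator (hm y)

end sample

section path

variable {Y : Type} [Fintype Y] [Nonempty Y]

/-- The list of outcomes (most recent first) generated by the kernel `p` from the seeds `u`. -/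
noncomputable def pth (p : List Y → Y → ℝ) (u : ℕ → ℝ) : ℕ → List Y
  | 0 => []
  | m + 1 => sampleOn (p (pth p u m)) (u m) :: pth p u m

lemma pth_length (p : List Y → Y → ℝ) (u : ℕ → ℝ) (m : ℕ) : (pth p u m).length = m := by
  induction m with
  | zero => rfl
  | succ m ih => simp [pth, ih]

lemma pth_congr (p : List Y → Y → ℝ) {u v : ℕ → ℝ} {m : ℕ} (h : ∀ i < m, u i = v i) :
    pth p u m = pth p v m := by
  induction m with
  | zero => rfl
  | succ m ih =>
    simp only [pth]
    rw [ih fun i hi => h i (by omega), h m (by omega)]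

lemma measurable_pth (p : List Y → Y → ℝ) (m : ℕ) :
    Measurable[_, ⊤] (fun u : ℕ → ℝ => pth p u m) := by
  let _ : MeasurableSpace (List Y) := ⊤
  let _ : MeasurableSpace Y := ⊤
  induction m with
  | zero => exact measurable_const
  | succ m ih =>
    have h1 : Measurable (fun z : List Y × ℝ => sampleOn (p z.1) z.2 :: z.1) := by
      refine measurable_from_prod_countable_right fun l => ?_
      exact (Measurable.of_discrete (f := fun y : Y => y :: l)).comp (measurable_sampleOn (p l))
    have h2 : Measurable (fun u : ℕ → ℝ => (pth p u m, u m)) := ih.prodMk (measurable_pi_apply m)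
    have h3 := h1.comp h2
    exact h3

lemma finite_pth_bound (f : List Y → ℝ) (m : ℕ) : ∃ C, ∀ l : List Y, l.length = m → |f l| ≤ C := by
  have : {l : List Y | l.length = m}.Finite := List.finite_length_eq Y m
  obtain ⟨C, hC⟩ := (this.image (fun l => |f l|)).bddAbove
  exact ⟨C, fun l hl => hC ⟨l, hl, rfl⟩⟩

/-- The path driven by the digits of `x`. -/
noncomputable def pthx (p : List Y → Y → ℝ) (x : ℝ) (m : ℕ) : List Y := pth p (unif x) m

lemma measurable_pthx (p : List Y → Y → ℝ) (m : ℕ) :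
    Measurable[_, ⊤] (fun x : ℝ => pthx p x m) :=
  (measurable_pth p m).comp (measurable_pi_lambda _ fun i => measurable_unif i)

lemma measurable_fpthx {γ : Type*} [MeasurableSpace γ] (p : List Y → Y → ℝ) (f : List Y → γ)
    (m : ℕ) : Measurable (fun x : ℝ => f (pthx p x m)) :=
  by
  let _ : MeasurableSpace (List Y) := ⊤
  exact (measurable_from_top (f := f)).comp (measurable_pthx p m)

lemma integrable_pthx (p : List Y → Y → ℝ) (f : List Y → ℝ) (m : ℕ) :
    Integrable (fun x => f (pthx p x m)) U01 := by
  obtain ⟨C, hC⟩ := finite_pth_bound f m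
  exact Integrable.of_bound (measurable_fpthx p f m).aestronglyMeasurable C
    (ae_of_all _ fun x => hC _ (pth_length _ _ _))

lemma pthx_step (p : List Y → Y → ℝ) (h0 : ∀ l y, 0 ≤ p l y) (h1 : ∀ l, ∑ y, p l y = 1)
    (f : List Y → ℝ) (m : ℕ) :
    ∫ x, f (pthx p x (m + 1)) ∂U01 =
      ∫ x, ∑ y, p (pthx p x m) y * f (y :: pthx p x m) ∂U01 := by
  let _ : MeasurableSpace (List Y) := ⊤
  let _ : MeasurableSpace Y := ⊤
  have hm := measurable_pthx p m
  have hind : ProbabilityTheory.IndepFun (fun x => pthx p x m) (fun x => unif x m) U01 := by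
    have := unif_indep.indepFun_finset (Finset.range m) {m} (by simp) (fun i => measurable_unif i)
    let G : ((i : Finset.range m) → ℝ) → List Y := fun v =>
      pth p (fun i => if h : i ∈ Finset.range m then v ⟨i, h⟩ else 0) m
    have hG : Measurable G := (measurable_pth p m).comp (measurable_pi_lambda _ fun i => by
      by_cases h : i ∈ Finset.range m
      · simp only [h, dif_pos]; fun_prop
      · simp only [h, dif_neg, not_false_eq_true]; fun_prop)
    have h2 := this.comp hG (measurable_pi_apply (⟨m, by simp⟩ : ({m} : Finset ℕ)))
    have e3 : (fun x => pthx p x m) = (G ∘ fun a (i : Finset.range m) => unif a i) := by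
      funext x
      exact pth_congr p fun i hi => by simp [hi]
    rw [e3]; exact h2
  have hprod := (ProbabilityTheory.indepFun_iff_map_prod_eq_prod_map_map hm.aemeasurable
    (measurable_unif m).aemeasurable).1 hind
  rw [unif_map] at hprod
  have hmF : Measurable (fun z : List Y × ℝ => f (sampleOn (p z.1) z.2 :: z.1)) := by
    refine measurable_from_prod_countable_right fun l => ?_
    exact (Measurable.of_discrete (f := fun y : Y => f (y :: l))).comp (measurable_sampleOn (p l))
  have e1 : ∫ x, f (pthx p x (m + 1)) ∂U01 =
      ∫ z, f (sampleOn (p z.1) z.2 :: z.1) ∂(U01.map fun x => (pthx p x m, unif x m)) := by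
    rw [integral_map (hm.prodMk (measurable_unif m)).aemeasurable hmF.aestronglyMeasurable]
    rfl
  have hint : Integrable (fun z : List Y × ℝ => f (sampleOn (p z.1) z.2 :: z.1))
      (U01.map fun x => (pthx p x m, unif x m)) := by
    rw [integrable_map_measure hmF.aestronglyMeasurable (hm.prodMk (measurable_unif m)).aemeasurable]
    exact integrable_pthx p f (m + 1)
  rw [hprod] at e1 hint
  have : IsProbabilityMeasure (U01.map fun x => pthx p x m) :=
    Measure.isProbabilityMeasure_map hm.aemeasurable
  rw [e1, integral_prod _ hint]
  rw [integral_map hm.aemeasurable (measurable_from_top.aestronglyMeasurable)]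
  refine integral_congr_ae (ae_of_all _ fun x => ?_)
  exact sampleOn_integral (p (pthx p x m)) (h0 _) (h1 _) (fun y => f (y :: pthx p x m))

end path

namespace POMDP
variable (Γ : POMDP)

/-- State and history after a list of outcomes (most recent first). -/
def TT (σ : Γ.Strategy) (k : Γ.K) : List (Γ.K × Γ.S) → Γ.K × Γ.Hist
  | [] => (k, [])
  | y :: l => (y.1, (TT σ k l).2 ++ [(σ (TT σ k l).2, y.2)])

/-- The outcome kernel. -/
def ker (σ : Γ.Strategy) (k : Γ.K) (l : List (Γ.K × Γ.S)) : Γ.K × Γ.S → ℝ :=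
  Γ.q (Γ.TT σ k l).1 (σ (Γ.TT σ k l).2)

lemma ker_nonneg (σ : Γ.Strategy) (k : Γ.K) (l y) : 0 ≤ Γ.ker σ k l y := Γ.q_nonneg _ _ _
lemma ker_sum (σ : Γ.Strategy) (k : Γ.K) (l) : ∑ y, Γ.ker σ k l y = 1 := Γ.q_sum _ _

lemma traj_eq (σ : Γ.Strategy) (k : Γ.K) (x : ℝ) (m : ℕ) :
    Γ.traj σ (k, x) m = Γ.TT σ k (pthx (Γ.ker σ k) x m) := by
  induction m with
  | zero => rfl
  | succ m ih =>
    simp only [traj, pthx, pth, TT]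
    rw [ih]
    rfl

lemma rew_eq (σ : Γ.Strategy) (k : Γ.K) (x : ℝ) (m : ℕ) :
    Γ.rew σ (k, x) m = Γ.g (Γ.TT σ k (pthx (Γ.ker σ k) x m)).1
      (σ (Γ.TT σ k (pthx (Γ.ker σ k) x m)).2) := by
  simp only [rew, state, act, hist, traj_eq]

lemma rew_nonneg (σ : Γ.Strategy) (ω) (m : ℕ) : 0 ≤ Γ.rew σ ω m := Γ.g_nonneg _ _
lemma rew_le_one (σ : Γ.Strategy) (ω) (m : ℕ) : Γ.rew σ ω m ≤ 1 := Γ.g_le_one _ _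

lemma avg_nonneg (σ : Γ.Strategy) (ω) (n : ℕ) : 0 ≤ Γ.avg σ ω n :=
  mul_nonneg (by positivity) (Finset.sum_nonneg fun m _ => Γ.rew_nonneg σ ω m)

lemma avg_le_one (σ : Γ.Strategy) (ω) (n : ℕ) : Γ.avg σ ω n ≤ 1 := by
  unfold avg
  have h : ∑ m ∈ Finset.range n, Γ.rew σ ω m ≤ n := by
    calc _ ≤ ∑ m ∈ Finset.range n, (1:ℝ) := Finset.sum_le_sum fun m _ => Γ.rew_le_one σ ω m
      _ = n := by simp
  rcases Nat.eq_zero_or_pos n with rfl | hn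
  · simp
  · have : (0:ℝ) < n := by exact_mod_cast hn
    rw [one_div, inv_mul_le_iff₀ this]; linarith

lemma bdd_ge (σ : Γ.Strategy) (ω) : IsBoundedUnder (· ≥ ·) atTop (Γ.avg σ ω) :=
  isBoundedUnder_of ⟨0, fun n => Γ.avg_nonneg σ ω n⟩
lemma bdd_le (σ : Γ.Strategy) (ω) : IsBoundedUnder (· ≤ ·) atTop (Γ.avg σ ω) :=
  isBoundedUnder_of ⟨1, fun n => Γ.avg_le_one σ ω n⟩

lemma liminf_nonneg (σ : Γ.Strategy) (ω) : 0 ≤ atTop.liminf (Γ.avg σ ω) :=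
  le_liminf_of_le (Γ.bdd_le σ ω).isCoboundedUnder_ge
    (Eventually.of_forall fun n => Γ.avg_nonneg σ ω n)

lemma liminf_le_one (σ : Γ.Strategy) (ω) : atTop.liminf (Γ.avg σ ω) ≤ 1 :=
  liminf_le_of_le (Γ.bdd_ge σ ω) (fun b hb => by
    obtain ⟨n, hn⟩ := hb.exists
    exact hn.trans (Γ.avg_le_one σ ω n))

lemma measurable_avg (σ : Γ.Strategy) (k : Γ.K) (n : ℕ) :
    Measurable (fun x => Γ.avg σ (k, x) n) := by
  unfold avg
  refine Measurable.const_mul (Finset.measurable_sum _ fun m _ => ?_) _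
  simp_rw [rew_eq]
  exact measurable_fpthx (Γ.ker σ k) (fun l => Γ.g (Γ.TT σ k l).1 (σ (Γ.TT σ k l).2)) m

lemma measurable_liminf (σ : Γ.Strategy) (k : Γ.K) :
    Measurable (fun x => atTop.liminf (Γ.avg σ (k, x))) :=
  Measurable.liminf fun n => Γ.measurable_avg σ k n

lemma integrable_liminf (σ : Γ.Strategy) (k : Γ.K) :
    Integrable (fun x => atTop.liminf (Γ.avg σ (k, x))) U01 :=
  Integrable.of_bound (Γ.measurable_liminf σ k).aestronglyMeasurable 1
    (ae_of_all _ fun x => by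
      rw [Real.norm_eq_abs, abs_of_nonneg (Γ.liminf_nonneg _ _)]; exact Γ.liminf_le_one _ _)

lemma pay_eq (p1 : Γ.K → ℝ) (hp : IsBelief p1) (σ : Γ.Strategy) :
    Γ.pay p1 σ = ∑ k, p1 k * ∫ x, atTop.liminf (Γ.avg σ (k, x)) ∂U01 := by
  unfold pay envMeasure
  have hfin : IsFiniteMeasure (vecMeasure p1) := by
    unfold vecMeasure
    constructor
    simp only [Measure.coe_finsetSum, Finset.sum_apply, Measure.smul_apply, measure_univ,
      smul_eq_mul, mul_one]
    exact ENNReal.sum_lt_top.2 fun _ _ => ENNReal.ofReal_lt_top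
  have hU : (volume.restrict (Set.Ico (0:ℝ) 1)) = U01 := rfl
  rw [hU, integral_prod]
  · unfold vecMeasure
    rw [integral_finsetSum_measure]
    · refine Finset.sum_congr rfl fun k _ => ?_
      rw [integral_smul_measure, integral_dirac, ENNReal.toReal_ofReal (hp.1 k), smul_eq_mul]
    · intro k _
      exact Integrable.of_finite.smul_measure ENNReal.ofReal_ne_top
  · refine Integrable.of_bound (C := 1) ?_ (ae_of_all _ fun ω => ?_)
    · refine Measurable.aestronglyMeasurable ?_
      exact measurable_from_prod_countable_right fun k => Γ.measurable_liminf σ k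
    · rw [Real.norm_eq_abs, abs_of_nonneg (Γ.liminf_nonneg _ _)]; exact Γ.liminf_le_one _ _

lemma pay_nonneg (p1 : Γ.K → ℝ) (hp : IsBelief p1) (σ : Γ.Strategy) : 0 ≤ Γ.pay p1 σ := by
  rw [pay_eq Γ p1 hp]
  exact Finset.sum_nonneg fun k _ => mul_nonneg (hp.1 k)
    (integral_nonneg fun x => Γ.liminf_nonneg _ _)

lemma pay_le_one (p1 : Γ.K → ℝ) (hp : IsBelief p1) (σ : Γ.Strategy) : Γ.pay p1 σ ≤ 1 := by
  rw [pay_eq Γ p1 hp, ← hp.2]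
  refine Finset.sum_le_sum fun k _ => ?_
  have : ∫ x, atTop.liminf (Γ.avg σ (k, x)) ∂U01 ≤ ∫ x, (1:ℝ) ∂U01 :=
    integral_mono (Γ.integrable_liminf σ k) (integrable_const _) fun x => Γ.liminf_le_one _ _
  simp at this
  nlinarith [hp.1 k]

lemma pay_le_val (p1 : Γ.K → ℝ) (hp : IsBelief p1) (σ : Γ.Strategy) : Γ.pay p1 σ ≤ Γ.val p1 :=
  le_ciSup (f := fun σ => Γ.pay p1 σ) ⟨1, by rintro _ ⟨σ, rfl⟩; exact Γ.pay_le_one p1 hp σ⟩ σ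

end POMDP

lemma exp_quad {y : ℝ} (hy : |y| ≤ 1) : Real.exp (-y) ≤ 1 - y + y ^ 2 := by
  have := (abs_le.1 (Real.abs_exp_sub_one_sub_id_le (x := -y) (by rwa [abs_neg]))).2
  nlinarith

lemma path_lln {Y : Type} [Fintype Y] [Nonempty Y] (p : List Y → Y → ℝ)
    (h0 : ∀ l y, 0 ≤ p l y) (h1 : ∀ l, ∑ y, p l y = 1)
    (Dv SS : List Y → ℝ) (hS0 : SS [] = 0) (hS : ∀ y l, SS (y :: l) = SS l + Dv (y :: l))
    (C : ℝ) (hC : 0 < C) (hb : ∀ l, |Dv l| ≤ C)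
    (hmean : ∀ l, 0 ≤ ∑ y, p l y * Dv (y :: l)) (ε : ℝ) (hε : 0 < ε) :
    ∀ᵐ x ∂U01, ∀ᶠ n : ℕ in atTop, -ε * n ≤ SS (pthx p x n) := by
  obtain ⟨t, ht0, ht1, ht2⟩ : ∃ t : ℝ, 0 < t ∧ t * C ≤ 1 ∧ t * C ^ 2 ≤ ε / 2 := by
    refine ⟨min (1 / C) (ε / (2 * C ^ 2)), by positivity, ?_, ?_⟩
    · calc _ ≤ 1 / C * C := by gcongr; exact min_le_left _ _
        _ = 1 := by field_simp
    · calc _ ≤ ε / (2 * C ^ 2) * C ^ 2 := by gcongr; exact min_le_right _ _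
        _ = ε / 2 := by field_simp
  set E : ℕ → ℝ := fun n => ∫ x, Real.exp (-(t * SS (pthx p x n))) ∂U01 with hE
  have hstep : ∀ n, E (n + 1) ≤ (1 + t ^ 2 * C ^ 2) * E n := by
    intro n
    simp only [hE]
    rw [pthx_step p h0 h1 (fun l => Real.exp (-(t * SS l))), ← integral_const_mul]
    refine integral_mono
      (integrable_pthx p (fun l => ∑ y, p l y * Real.exp (-(t * SS (y :: l)))) n)
      (integrable_pthx p (fun l => (1 + t ^ 2 * C ^ 2) * Real.exp (-(t * SS l))) n) ?_
    intro x
    simp only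
    generalize pthx p x n = l
    have e : ∀ y, p l y * Real.exp (-(t * SS (y :: l))) ≤
        Real.exp (-(t * SS l)) * (p l y * (1 + t ^ 2 * C ^ 2) - t * (p l y * Dv (y :: l))) := by
      intro y
      have hq : Real.exp (-(t * Dv (y :: l))) ≤ 1 - t * Dv (y :: l) + t ^ 2 * C ^ 2 := by
        have hab : |t * Dv (y :: l)| ≤ 1 := by
          rw [abs_mul, abs_of_pos ht0]
          exact (mul_le_mul_of_nonneg_left (hb _) ht0.le).trans ht1
        refine (exp_quad hab).trans ?_
        have : (Dv (y :: l)) ^ 2 ≤ C ^ 2 := sq_le_sq' (by linarith [(abs_le.1 (hb (y :: l))).1])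
          (abs_le.1 (hb (y :: l))).2
        have h2 := mul_le_mul_of_nonneg_left this (sq_nonneg t)
        nlinarith
      rw [hS, mul_add, neg_add, Real.exp_add]
      have := mul_le_mul_of_nonneg_left hq (mul_nonneg (Real.exp_pos (-(t * SS l))).le (h0 l y))
      nlinarith
    refine (Finset.sum_le_sum fun y _ => e y).trans ?_
    rw [← Finset.mul_sum, Finset.sum_sub_distrib, ← Finset.sum_mul, h1, ← Finset.mul_sum]
    have := mul_nonneg ht0.le (hmean l)
    have := Real.exp_pos (-(t * SS l))
    nlinarith
  have hEn : ∀ n, E n ≤ (1 + t ^ 2 * C ^ 2) ^ n := by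
    intro n
    induction n with
    | zero => simp [hE, pthx, pth, hS0]
    | succ n ih =>
      rw [pow_succ, mul_comm]
      exact (hstep n).trans (mul_le_mul_of_nonneg_left ih (by positivity))
  set r : ℝ := Real.exp (-(t * ε / 2)) with hr
  have hr1 : r < 1 := by
    rw [hr, Real.exp_lt_one_iff]; have := mul_pos ht0 hε; linarith
  have hr0 : 0 ≤ r := (Real.exp_pos _).le
  have hprob : ∀ n : ℕ, U01 {x | SS (pthx p x n) < -ε * n} ≤ ENNReal.ofReal (r ^ n) := by
    intro n
    have hsub : {x | SS (pthx p x n) < -ε * n} ⊆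
        {x | Real.exp (t * ε * n) ≤ Real.exp (-(t * SS (pthx p x n)))} := by
      intro x hx
      simp only [Set.mem_ofPred_eq, Real.exp_le_exp] at hx ⊢
      nlinarith
    refine (measure_mono hsub).trans ?_
    have hmk := mul_meas_ge_le_integral_of_nonneg (μ := U01)
      (f := fun x => Real.exp (-(t * SS (pthx p x n))))
      (ae_of_all _ fun x => (Real.exp_pos _).le)
      (integrable_pthx p (fun l => Real.exp (-(t * SS l))) n) (Real.exp (t * ε * n))
    have h2 : U01.real {x | Real.exp (t * ε * n) ≤ Real.exp (-(t * SS (pthx p x n)))} ≤ r ^ n := by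
      have h3 := hmk.trans (hEn n)
      have h4 : (1 + t ^ 2 * C ^ 2) ^ n ≤ Real.exp (t * ε * n) * r ^ n := by
        have : 1 + t ^ 2 * C ^ 2 ≤ Real.exp (t * ε) * r := by
          rw [hr, ← Real.exp_add]
          refine le_trans ?_ (Real.add_one_le_exp _)
          nlinarith
        calc _ ≤ (Real.exp (t * ε) * r) ^ n := by gcongr
          _ = _ := by rw [mul_pow, ← Real.exp_nat_mul]; ring_nf
      have h5 := h3.trans h4
      exact le_of_mul_le_mul_left h5 (Real.exp_pos _)
    rw [← ENNReal.ofReal_toReal (measure_ne_top U01 _)]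
    exact ENNReal.ofReal_le_ofReal h2
  have hsum : ∑' n : ℕ, U01 {x | SS (pthx p x n) < -ε * n} ≠ ⊤ := by
    refine ne_top_of_le_ne_top ?_ (ENNReal.tsum_le_tsum hprob)
    rw [← ENNReal.ofReal_tsum_of_nonneg (fun n => by positivity)
      (summable_geometric_of_lt_one hr0 hr1)]
    exact ENNReal.ofReal_ne_top
  filter_upwards [ae_eventually_notMem hsum] with x hx
  filter_upwards [hx] with n hn
  simpa using hn

lemma path_pos {Y : Type} [Fintype Y] [Nonempty Y] (p : List Y → Y → ℝ)
    (h0 : ∀ l y, 0 ≤ p l y) (h1 : ∀ l, ∑ y, p l y = 1) :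
    ∀ᵐ x ∂U01, ∀ m, ∃ y, pthx p x (m + 1) = y :: pthx p x m ∧ 0 < p (pthx p x m) y := by
  classical
  rw [ae_all_iff]
  intro m
  let f : List Y → ℝ := fun l => match l with
    | [] => 0
    | y :: l => if p l y = 0 then 1 else 0
  have hf : ∀ l, 0 ≤ f l := by
    intro l; cases l <;> simp only [f]
    · exact le_rfl
    · split_ifs <;> norm_num
  have hi : ∫ x, f (pthx p x (m + 1)) ∂U01 = 0 := by
    rw [pthx_step p h0 h1]
    have : ∀ x, ∑ y, p (pthx p x m) y * f (y :: pthx p x m) = 0 := fun x =>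
      Finset.sum_eq_zero fun y _ => by
        simp only [f]; split_ifs with h <;> simp [h]
    simp [this]
  rw [integral_eq_zero_iff_of_nonneg (fun x => hf _) (integrable_pthx p f (m + 1))] at hi
  filter_upwards [hi] with x hx
  refine ⟨_, rfl, ?_⟩
  refine lt_of_le_of_ne (h0 _ _) fun h => ?_
  have : f (pthx p x (m + 1)) = 1 := by
    simp only [pthx, pth, f]
    exact if_pos h.symm
  rw [this] at hx; simp at hx

namespace POMDP
variable (Γ : POMDP)

/-- Node reached in an automaton after a list of outcomes (most recent first). -/
def nd {K S : Type} (next : ℕ → S → ℕ) (i0 : ℕ) : List (K × S) → ℕ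
  | [] => i0
  | y :: l => next (nd next i0 l) y.2

/-- State after a list of outcomes. -/
def st {K S : Type} (k : K) : List (K × S) → K
  | [] => k
  | y :: _ => y.1

/-- The strategy of an automaton. -/
def autStrat (act : ℕ → Γ.A) (next : ℕ → Γ.S → ℕ) (i0 : ℕ) : Γ.Strategy :=
  fun h => act (h.foldl (fun i as => next i as.2) i0)

lemma TT_aut (act : ℕ → Γ.A) (next : ℕ → Γ.S → ℕ) (i0 : ℕ) (k : Γ.K) (l : List (Γ.K × Γ.S)) :
    (Γ.TT (Γ.autStrat act next i0) k l).1 = st k l ∧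
    (Γ.TT (Γ.autStrat act next i0) k l).2.foldl (fun i as => next i as.2) i0 = nd next i0 l := by
  induction l with
  | nil => exact ⟨rfl, rfl⟩
  | cons y l ih =>
    refine ⟨rfl, ?_⟩
    simp only [TT, List.foldl_append, List.foldl_cons, List.foldl_nil, nd]
    rw [ih.2]

lemma sound (p1 : Γ.K → ℝ) (hp : IsBelief p1) (M0 M i0 : ℕ) (hM : M0 ≤ M) (hi0 : i0 < M)
    (act : ℕ → Γ.A) (next : ℕ → Γ.S → ℕ) (hnext : ∀ i < M, ∀ s, next i s < max i M0)
    (w h : ℕ → Γ.K → ℝ) (η : ℝ)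
    (c1 : ∀ i < M, ∀ k, w i k ≤ ∑ y, Γ.q k (act i) y * w (next i y.2) y.1)
    (c1' : ∀ i < M0, ∀ k y, 0 < Γ.q k (act i) y → w i k ≤ w (next i y.2) y.1)
    (c2 : ∀ i < M, ∀ k, w i k + h i k ≤ Γ.g k (act i) + η +
      ∑ y, Γ.q k (act i) y * h (next i y.2) y.1) :
    ∑ k, p1 k * w i0 k - η ≤ Γ.val p1 := by
  classical
  refine le_trans ?_ (Γ.pay_le_val p1 hp (Γ.autStrat act next i0))
  rw [Γ.pay_eq p1 hp]
  have hsum : ∑ k, p1 k * w i0 k - η = ∑ k, p1 k * (w i0 k - η) := by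
    simp only [mul_sub, Finset.sum_sub_distrib]
    rw [← Finset.sum_mul, hp.2, one_mul]
  rw [hsum]
  refine Finset.sum_le_sum fun k _ => mul_le_mul_of_nonneg_left ?_ (hp.1 k)
  -- fixed initial state
  set σ := Γ.autStrat act next i0 with hσ
  set p := Γ.ker σ k with hpdef
  have hp0 : ∀ l y, 0 ≤ p l y := Γ.ker_nonneg σ k
  have hp1 : ∀ l, ∑ y, p l y = 1 := Γ.ker_sum σ k
  have hpl : ∀ l y, p l y = Γ.q (st k l) (act (nd next i0 l)) y := by
    intro l y
    have := Γ.TT_aut act next i0 k l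
    simp only [hpdef, ker]
    rw [← this.1, ← this.2]; rfl
  have hrew : ∀ x m, Γ.rew σ (k, x) m = Γ.g (st k (pthx p x m)) (act (nd next i0 (pthx p x m))) := by
    intro x m
    have := Γ.TT_aut act next i0 k (pthx p x m)
    rw [rew_eq, ← this.1, ← this.2]; rfl
  have hnd : ∀ l : List (Γ.K × Γ.S), nd next i0 l < M0 ∨ nd next i0 l + l.length < M := by
    intro l
    induction l with
    | nil => right; simpa [nd] using hi0
    | cons y l ih =>
      have hlt : nd next i0 l < M := by omega
      have := hnext _ hlt y.2
      simp only [nd, List.length_cons]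
      rcases lt_max_iff.1 this with h | h <;> omega
  have hndM : ∀ l : List (Γ.K × Γ.S), nd next i0 l < M := fun l => by
    have := hnd l; omega
  -- bounds
  obtain ⟨C, hC, hCw, hCh⟩ : ∃ C : ℝ, 0 < C ∧ (∀ i < M, ∀ k, |w i k| ≤ C) ∧
      (∀ i < M, ∀ k, |h i k| ≤ C) := by
    obtain ⟨C1, h1⟩ := ((Set.finite_univ (α := Fin M × Γ.K)).image
      (fun z => |w z.1 z.2| + |h z.1 z.2|)).bddAbove
    refine ⟨|C1| + 1, by positivity, fun i hi k => ?_, fun i hi k => ?_⟩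
    · have := h1 ⟨(⟨i, hi⟩, k), trivial, rfl⟩
      simp only at this
      have := le_abs_self C1
      have := abs_nonneg (h i k)
      linarith
    · have := h1 ⟨(⟨i, hi⟩, k), trivial, rfl⟩
      simp only at this
      have := le_abs_self C1
      have := abs_nonneg (w i k)
      linarith
  set wl : List (Γ.K × Γ.S) → ℝ := fun l => w (nd next i0 l) (st k l) with hwl
  set hl : List (Γ.K × Γ.S) → ℝ := fun l => h (nd next i0 l) (st k l) with hhl
  set gl : List (Γ.K × Γ.S) → ℝ := fun l => Γ.g (st k l) (act (nd next i0 l)) with hgl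
  have bw : ∀ l, |wl l| ≤ C := fun l => hCw _ (hndM l) _
  have bh : ∀ l, |hl l| ≤ C := fun l => hCh _ (hndM l) _
  have bg : ∀ l, |gl l| ≤ 1 := fun l => by
    rw [abs_of_nonneg (Γ.g_nonneg _ _)]; exact Γ.g_le_one _ _
  have mw : ∀ l, wl l ≤ ∑ y, p l y * wl (y :: l) := by
    intro l
    simp only [hpl]
    exact c1 _ (hndM l) _
  -- expectations
  have hEw : ∀ m, w i0 k ≤ ∫ x, wl (pthx p x m) ∂U01 := by
    intro m
    induction m with
    | zero => simp [pthx, pth, hwl, nd, st]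
    | succ m ih =>
      rw [pthx_step p hp0 hp1]
      refine ih.trans (integral_mono (integrable_pthx p wl m)
        (integrable_pthx p (fun l => ∑ y, p l y * wl (y :: l)) m) fun x => mw _)
  let Dv : List (Γ.K × Γ.S) → ℝ := fun l => match l with
    | [] => 0
    | y :: l => gl l - wl l + η + hl (y :: l) - hl l
  let SS : List (Γ.K × Γ.S) → ℝ := fun l => List.rec 0 (fun y l r => r + Dv (y :: l)) l
  have hDb : ∀ l, |Dv l| ≤ 1 + 3 * C + |η| := by
    intro l
    cases l with
    | nil => simp only [Dv, abs_zero]; positivity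
    | cons y l =>
      simp only [Dv]
      have a1 := abs_le.1 (bg l)
      have a2 := abs_le.1 (bw l)
      have a3 := abs_le.1 (bh l)
      have a4 := abs_le.1 (bh (y :: l))
      have a5 := abs_le.1 (le_refl |η|)
      rw [abs_le]; constructor <;> linarith
  have hDm : ∀ l, 0 ≤ ∑ y, p l y * Dv (y :: l) := by
    intro l
    have hc := c2 _ (hndM l) (st k l)
    have : ∑ y, p l y * Dv (y :: l) = (gl l - wl l + η - hl l) + ∑ y, p l y * hl (y :: l) := by
      have : ∀ y, p l y * Dv (y :: l) = p l y * (gl l - wl l + η - hl l) + p l y * hl (y :: l) := by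
        intro y; simp only [Dv]; ring
      simp only [this, Finset.sum_add_distrib]
      rw [← Finset.sum_mul, hp1, one_mul]
    rw [this]
    have e : ∑ y, p l y * hl (y :: l) =
        ∑ y, Γ.q (st k l) (act (nd next i0 l)) y * h (next (nd next i0 l) y.2) y.1 := by
      simp only [hpl]; rfl
    rw [e]
    simp only [hgl, hwl, hhl]
    linarith
  have hSS : ∀ l : List (Γ.K × Γ.S), ∀ y, SS (y :: l) = SS l + Dv (y :: l) := fun l y => rfl
  have hrec : ∀ x n, SS (pthx p x n) = ∑ m ∈ Finset.range n, gl (pthx p x m) -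
      ∑ m ∈ Finset.range n, wl (pthx p x m) + n * η + hl (pthx p x n) - hl [] := by
    intro x n
    induction n with
    | zero => simp [pthx, pth, SS]
    | succ n ih =>
      rw [Finset.sum_range_succ, Finset.sum_range_succ]
      have : pthx p x (n + 1) = sampleOn (p (pthx p x n)) (unif x n) :: pthx p x n := rfl
      rw [this, hSS, ih]
      simp only [Dv]
      push_cast; ring
  have hlln : ∀ᵐ x ∂U01, ∀ j : ℕ, ∀ᶠ n : ℕ in atTop, -(1 / ((j:ℝ) + 1)) * n ≤ SS (pthx p x n) := by
    rw [ae_all_iff]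
    intro j
    exact path_lln p hp0 hp1 Dv SS rfl (fun y l => hSS l y) (1 + 3 * C + |η|) (by positivity)
      hDb hDm _ (by positivity)
  have hmain : ∀ᵐ x ∂U01, wl (pthx p x M) - η ≤ atTop.liminf (Γ.avg σ (k, x)) := by
    filter_upwards [hlln, path_pos p hp0 hp1] with x hx hpos
    have hmono : ∀ m, wl (pthx p x M) ≤ wl (pthx p x (M + m)) := by
      intro m
      induction m with
      | zero => exact le_rfl
      | succ m ih =>
        obtain ⟨y, hy, hq⟩ := hpos (M + m)
        refine ih.trans ?_
        rw [← add_assoc, hy]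
        have hlt : nd next i0 (pthx p x (M + m)) < M0 := by
          have := hnd (pthx p x (M + m))
          have hl' : (pthx p x (M + m)).length = M + m := pth_length _ _ _
          omega
        rw [hpl] at hq
        exact c1' _ hlt _ y hq
    have hw2 : ∀ n : ℕ, n * wl (pthx p x M) - 2 * C * M ≤ ∑ m ∈ Finset.range n, wl (pthx p x m) := by
      intro n
      have e1 : ∑ m ∈ Finset.range n, (wl (pthx p x M) - if m < M then 2 * C else 0) ≤
          ∑ m ∈ Finset.range n, wl (pthx p x m) := by
        refine Finset.sum_le_sum fun m _ => ?_
        split_ifs with hm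
        · have := abs_le.1 (bw (pthx p x M)); have := abs_le.1 (bw (pthx p x m)); linarith
        · have := hmono (m - M)
          rw [show M + (m - M) = m by omega] at this; linarith
      refine le_trans ?_ e1
      rw [Finset.sum_sub_distrib]
      have e2 : ∑ m ∈ Finset.range n, (if m < M then 2 * C else 0) ≤ 2 * C * M := by
        rw [← Finset.sum_filter, Finset.sum_const, nsmul_eq_mul]
        have : ((Finset.range n).filter (fun m => m < M)).card ≤ M := by
          calc _ ≤ (Finset.range M).card := Finset.card_le_card fun m hm => by
                simp only [Finset.mem_filter, Finset.mem_range] at hm ⊢; exact hm.2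
            _ = M := Finset.card_range M
        have : (((Finset.range n).filter (fun m => m < M)).card : ℝ) ≤ M := by exact_mod_cast this
        nlinarith
      simp only [Finset.sum_const, Finset.card_range, nsmul_eq_mul]
      linarith
    refine le_of_forall_pos_le_add fun ε hε => ?_
    obtain ⟨j, hj⟩ := exists_nat_one_div_lt (half_pos hε)
    have : wl (pthx p x M) - η - ε ≤ atTop.liminf (Γ.avg σ (k, x)) := by
      refine le_liminf_of_le (Γ.bdd_le σ _).isCoboundedUnder_ge ?_
      obtain ⟨N, hN⟩ := exists_nat_gt ((2 * C * M + 2 * C) / (ε / 2))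
      filter_upwards [hx j, eventually_ge_atTop (max N 1)] with n hn hn2
      have hn0 : (0:ℝ) < n := by exact_mod_cast (lt_of_lt_of_le Nat.one_pos ((le_max_right _ _).trans hn2))
      have hnN : (N:ℝ) ≤ n := by exact_mod_cast (le_max_left _ _).trans hn2
      have hbig : 2 * C * M + 2 * C ≤ ε / 2 * n := by
        rw [div_lt_iff₀ (by positivity)] at hN
        nlinarith
      rw [hrec] at hn
      have hww := hw2 n
      have b1 := abs_le.1 (bh (pthx p x n))
      have b2 := abs_le.1 (bh [])
      have hsm : 1 / ((j:ℝ) + 1) * n ≤ ε / 2 * n := mul_le_mul_of_nonneg_right hj.le hn0.le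
      have hav : Γ.avg σ (k, x) n = (1 / (n:ℝ)) * ∑ m ∈ Finset.range n, gl (pthx p x m) := by
        simp only [avg, hrew]; rfl
      rw [hav, one_div, le_inv_mul_iff₀ hn0]
      nlinarith
    linarith
  calc w i0 k - η ≤ ∫ x, wl (pthx p x M) ∂U01 - η := by linarith [hEw M]
    _ = ∫ x, (wl (pthx p x M) - η) ∂U01 := by
        rw [integral_sub (integrable_pthx p wl M) (integrable_const _)]; simp
    _ ≤ _ := integral_mono_ae ((integrable_pthx p wl M).sub (integrable_const _))
        (Γ.integrable_liminf σ k) hmain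

end POMDP

namespace POMDP
variable (Γ : POMDP)

/-- Reduced strategies. -/
abbrev Sg := List Γ.S → Γ.A
/-- State and continuation strategy. -/
abbrev YY := Γ.K × Γ.Sg
/-- Outcomes. -/
abbrev ZZ := Γ.K × Γ.S

variable {Γ}

/-- Continuation strategy. -/
def sh (σ : Γ.Sg) (hs : List Γ.S) : Γ.Sg := fun l => σ (hs ++ l)
/-- Transition probability. -/
def qq (y : Γ.YY) (z : Γ.ZZ) : ℝ := Γ.q y.1 (y.2 []) z
/-- Successor. -/
def sc (y : Γ.YY) (z : Γ.ZZ) : Γ.YY := (z.1, sh y.2 [z.2])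
/-- Markov operator. -/
def PP (f : Γ.YY → ℝ) (y : Γ.YY) : ℝ := ∑ z, qq y z * f (sc y z)
/-- Reward. -/
def gg (y : Γ.YY) : ℝ := Γ.g y.1 (y.2 [])

lemma qq_nonneg (y : Γ.YY) (z : Γ.ZZ) : 0 ≤ qq y z := Γ.q_nonneg _ _ _
lemma qq_sum (y : Γ.YY) : ∑ z, qq y z = 1 := Γ.q_sum _ _
lemma sh_nil (σ : Γ.Sg) : sh σ [] = σ := rfl
lemma sh_sh (σ : Γ.Sg) (a b : List Γ.S) : sh (sh σ a) b = sh σ (a ++ b) := by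
  funext l; simp [sh]

lemma continuous_sh (hs : List Γ.S) : Continuous (fun σ : Γ.Sg => sh σ hs) :=
  continuous_pi fun l => continuous_apply (hs ++ l)

lemma continuous_sc (z : Γ.ZZ) : Continuous (fun y : Γ.YY => sc y z) :=
  continuous_const.prodMk ((continuous_sh [z.2]).comp continuous_snd)

lemma continuous_disc {f : Γ.K → Γ.A → ℝ} : Continuous (fun y : Γ.YY => f y.1 (y.2 [])) := by
  have h : Continuous (fun p : Γ.K × Γ.A => f p.1 p.2) := continuous_of_discreteTopology
  exact h.comp (continuous_fst.prodMk ((continuous_apply []).comp continuous_snd))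

lemma continuous_qq (z : Γ.ZZ) : Continuous (fun y : Γ.YY => qq y z) :=
  continuous_disc (f := fun k a => Γ.q k a z)
lemma continuous_gg : Continuous (gg : Γ.YY → ℝ) := continuous_disc (f := Γ.g)

lemma continuous_PP {f : Γ.YY → ℝ} (hf : Continuous f) : Continuous (PP f) := by
  unfold PP
  exact continuous_finsetSum _ fun z _ => (continuous_qq z).mul (hf.comp (continuous_sc z))

/-- Signals of a list of outcomes, in chronological order. -/
def sg (l : List Γ.ZZ) : List Γ.S := (l.map Prod.snd).reverse
/-- Position after a list of outcomes. -/
def pos (σ : Γ.Sg) (k : Γ.K) (l : List Γ.ZZ) : Γ.YY := (st k l, sh σ (sg l))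

lemma pos_cons (σ : Γ.Sg) (k : Γ.K) (z : Γ.ZZ) (l : List Γ.ZZ) :
    pos σ k (z :: l) = sc (pos σ k l) z := by
  simp only [pos, sc, st, sh_sh, sg, List.map_cons, List.reverse_cons]

/-- History from the signals. -/
def histOf (σ : Γ.Strategy) (l : List Γ.S) : Γ.Hist := l.foldl (fun h s => h ++ [(σ h, s)]) []
/-- Reduced strategy. -/
def red (σ : Γ.Strategy) : Γ.Sg := fun l => σ (histOf σ l)

lemma TT_red (σ : Γ.Strategy) (k : Γ.K) (l : List Γ.ZZ) :
    Γ.TT σ k l = (st k l, histOf σ (sg l)) := by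
  induction l with
  | nil => rfl
  | cons z l ih =>
    simp only [TT, ih, st, sg, List.map_cons, List.reverse_cons, histOf, List.foldl_append,
      List.foldl_cons, List.foldl_nil]

/-- The kernel. -/
def kr (σ : Γ.Sg) (k : Γ.K) (l : List Γ.ZZ) : Γ.ZZ → ℝ := qq (pos σ k l)

lemma ker_red (σ : Γ.Strategy) (k : Γ.K) : Γ.ker σ k = kr (red σ) k := by
  funext l z
  simp only [ker, kr, qq, pos, TT_red, red, sh, List.append_nil]

lemma rew_red (σ : Γ.Strategy) (k : Γ.K) (x : ℝ) (m : ℕ) :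
    Γ.rew σ (k, x) m = gg (pos (red σ) k (pthx (kr (red σ) k) x m)) := by
  rw [rew_eq, ker_red]
  simp only [gg, pos, TT_red, red, sh, List.append_nil]

lemma int_pos (σ : Γ.Sg) (k : Γ.K) (m : ℕ) (f : Γ.YY → ℝ) :
    ∫ x, f (pos σ k (pthx (kr σ k) x m)) ∂U01 = (PP^[m] f) (k, σ) := by
  induction m generalizing f with
  | zero => simp [pthx, pth, pos, st, sg, sh_nil]
  | succ m ih =>
    rw [pthx_step (kr σ k) (fun l y => qq_nonneg _ _) (fun l => qq_sum _)
      (fun l => f (pos σ k l)), Function.iterate_succ_apply, ← ih]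
    simp only [pos_cons]
    rfl

/-- Expected value at time `m`. -/
noncomputable def occ (p1 : Γ.K → ℝ) (σ : Γ.Sg) (m : ℕ) (f : Γ.YY → ℝ) : ℝ :=
  ∑ k, p1 k * (PP^[m] f) (k, σ)

/-- Law at time `m`. -/
noncomputable def lawm (p1 : Γ.K → ℝ) (σ : Γ.Sg) (m : ℕ) : Measure Γ.YY :=
  ∑ k, ENNReal.ofReal (p1 k) • U01.map (fun x => pos σ k (pthx (kr σ k) x m))

lemma lawm_univ (p1 : Γ.K → ℝ) (hp : IsBelief p1) (σ : Γ.Sg) (m : ℕ) :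
    lawm p1 σ m Set.univ = 1 := by
  unfold lawm
  simp only [Measure.coe_finsetSum, Finset.sum_apply, Measure.smul_apply, smul_eq_mul]
  have : ∀ k, U01.map (fun x => pos σ k (pthx (kr σ k) x m)) Set.univ = 1 := by
    intro k
    rw [Measure.map_apply (measurable_fpthx (kr σ k) (pos σ k) m) MeasurableSet.univ]
    simp
  simp only [this, mul_one]
  rw [← ENNReal.ofReal_sum_of_nonneg (fun k _ => hp.1 k), hp.2, ENNReal.ofReal_one]

lemma int_lawm (p1 : Γ.K → ℝ) (hp : IsBelief p1) (σ : Γ.Sg) (m : ℕ) (f : Γ.YY → ℝ)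
    (hf : Measurable f) : Integrable f (lawm p1 σ m) ∧ ∫ y, f y ∂(lawm p1 σ m) = occ p1 σ m f := by
  have hm : ∀ k, Measurable (fun x => pos σ k (pthx (kr σ k) x m)) := fun k =>
    measurable_fpthx (kr σ k) (pos σ k) m
  have hi : ∀ k, Integrable f (U01.map (fun x => pos σ k (pthx (kr σ k) x m))) := by
    intro k
    rw [integrable_map_measure hf.aestronglyMeasurable (hm k).aemeasurable]
    exact integrable_pthx (kr σ k) (fun l => f (pos σ k l)) m
  have hi2 : ∀ k ∈ Finset.univ, Integrable f (ENNReal.ofReal (p1 k) •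
      U01.map (fun x => pos σ k (pthx (kr σ k) x m))) := fun k _ =>
    (hi k).smul_measure ENNReal.ofReal_ne_top
  refine ⟨integrable_finsetSum_measure.2 hi2, ?_⟩
  unfold lawm occ
  rw [integral_finsetSum_measure hi2]
  refine Finset.sum_congr rfl fun k _ => ?_
  rw [integral_smul_measure, ENNReal.toReal_ofReal (hp.1 k), smul_eq_mul,
    integral_map (hm k).aemeasurable hf.aestronglyMeasurable, int_pos]

/-- Occupation measure. -/
noncomputable def occM (p1 : Γ.K → ℝ) (σ : Γ.Sg) (n : ℕ) : Measure Γ.YY :=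
  ENNReal.ofReal (1 / ((n : ℝ) + 1)) • ∑ m ∈ Finset.range (n + 1), lawm p1 σ m

lemma occM_prob (p1 : Γ.K → ℝ) (hp : IsBelief p1) (σ : Γ.Sg) (n : ℕ) :
    IsProbabilityMeasure (occM p1 σ n) := by
  constructor
  unfold occM
  simp only [Measure.smul_apply, Measure.coe_finsetSum, Finset.sum_apply, lawm_univ p1 hp,
    Finset.sum_const, Finset.card_range, smul_eq_mul, nsmul_eq_mul, mul_one]
  rw [← ENNReal.ofReal_natCast, ← ENNReal.ofReal_mul (by positivity)]
  push_cast
  rw [one_div, inv_mul_cancel₀ (by positivity), ENNReal.ofReal_one]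

lemma int_occM (p1 : Γ.K → ℝ) (hp : IsBelief p1) (σ : Γ.Sg) (n : ℕ) (f : Γ.YY → ℝ)
    (hf : Measurable f) : ∫ y, f y ∂(occM p1 σ n) =
      (1 / ((n : ℝ) + 1)) * ∑ m ∈ Finset.range (n + 1), occ p1 σ m f := by
  unfold occM
  rw [integral_smul_measure, integral_finsetSum_measure fun m _ => (int_lawm p1 hp σ m f hf).1,
    ENNReal.toReal_ofReal (by positivity), smul_eq_mul]
  simp only [(int_lawm p1 hp σ _ f hf).2]

lemma pay_le_occ (p1 : Γ.K → ℝ) (hp : IsBelief p1) (σ : Γ.Strategy) (L : Filter ℕ) [L.NeBot]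
    (hL : L ≤ atTop) (c : ℝ)
    (hc : Tendsto (fun n => ∫ y, gg y ∂(occM p1 (red σ) n)) L (nhds c)) : Γ.pay p1 σ ≤ c := by
  have h1 : ∀ k, Tendsto (fun n => ∫ x, min (atTop.liminf (Γ.avg σ (k, x))) (Γ.avg σ (k, x) n) ∂U01)
      atTop (nhds (∫ x, atTop.liminf (Γ.avg σ (k, x)) ∂U01)) := by
    intro k
    refine tendsto_integral_of_dominated_convergence (fun _ => 1) ?_ (integrable_const _) ?_ ?_
    · intro n
      exact ((Γ.measurable_liminf σ k).min (Γ.measurable_avg σ k n)).aestronglyMeasurable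
    · intro n
      refine ae_of_all _ fun x => ?_
      rw [Real.norm_eq_abs, abs_of_nonneg (le_min (Γ.liminf_nonneg _ _) (Γ.avg_nonneg _ _ _))]
      exact (min_le_left _ _).trans (Γ.liminf_le_one _ _)
    · refine ae_of_all _ fun x => ?_
      rw [tendsto_order]
      constructor
      · intro a ha
        filter_upwards [eventually_lt_of_lt_liminf ha (Γ.bdd_ge σ (k, x))] with n hn
        exact lt_min ha hn
      · intro a ha
        exact Eventually.of_forall fun n => lt_of_le_of_lt (min_le_left _ _) ha
  have h2 : Tendsto (fun n => ∑ k, p1 k *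
      ∫ x, min (atTop.liminf (Γ.avg σ (k, x))) (Γ.avg σ (k, x) n) ∂U01) atTop
      (nhds (Γ.pay p1 σ)) := by
    rw [Γ.pay_eq p1 hp]
    exact tendsto_finsetSum _ fun k _ => (h1 k).const_mul _
  have h3 := (tendsto_add_atTop_iff_nat 1).2 h2
  refine le_of_tendsto_of_tendsto (h3.mono_left hL) hc (Eventually.of_forall fun n => ?_)
  simp only
  rw [int_occM p1 hp _ n gg continuous_gg.measurable]
  have hint : ∀ k m, Integrable (fun x => Γ.rew σ (k, x) m) U01 := by
    intro k m
    simp only [rew_red]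
    exact integrable_pthx (kr (red σ) k) (fun l => gg (pos (red σ) k l)) m
  have h4 : ∀ k, ∫ x, Γ.avg σ (k, x) (n + 1) ∂U01 = (1 / ((n : ℝ) + 1)) *
      ∑ m ∈ Finset.range (n + 1), (PP^[m] gg) (k, red σ) := by
    intro k
    unfold avg
    rw [integral_const_mul, integral_finsetSum _ fun m _ => hint k m]
    push_cast
    congr 1
    refine Finset.sum_congr rfl fun m _ => ?_
    rw [← int_pos]
    simp only [rew_red]
  have h5 : (1 / ((n : ℝ) + 1)) * ∑ m ∈ Finset.range (n + 1), occ p1 (red σ) m gg =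
      ∑ k, p1 k * ∫ x, Γ.avg σ (k, x) (n + 1) ∂U01 := by
    simp only [h4, occ]
    rw [Finset.sum_comm, Finset.mul_sum]
    refine Finset.sum_congr rfl fun k _ => ?_
    rw [← Finset.mul_sum]; ring
  rw [h5]
  refine Finset.sum_le_sum fun k _ => mul_le_mul_of_nonneg_left ?_ (hp.1 k)
  have b1 : Integrable (fun x => Γ.avg σ (k, x) (n + 1)) U01 :=
    Integrable.of_bound (Γ.measurable_avg σ k _).aestronglyMeasurable 1
      (ae_of_all _ fun x => by
        rw [Real.norm_eq_abs, abs_of_nonneg (Γ.avg_nonneg _ _ _)]; exact Γ.avg_le_one _ _ _)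
  exact integral_mono ((Γ.integrable_liminf σ k).inf b1) b1 fun x => min_le_right _ _

lemma iterate_bound (f : Γ.YY → ℝ) (C : ℝ) (hC : ∀ y, |f y| ≤ C) (m : ℕ) (y : Γ.YY) :
    |(PP^[m] f) y| ≤ C := by
  induction m generalizing f with
  | zero => exact hC y
  | succ m ih =>
    rw [Function.iterate_succ_apply]
    refine ih (PP f) fun y => ?_
    unfold PP
    calc _ ≤ ∑ z, |qq y z * f (sc y z)| := Finset.abs_sum_le_sum_abs _ _
      _ ≤ ∑ z, qq y z * C := Finset.sum_le_sum fun z _ => by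
          rw [abs_mul, abs_of_nonneg (qq_nonneg y z)]
          exact mul_le_mul_of_nonneg_left (hC _) (qq_nonneg y z)
      _ = C := by rw [← Finset.sum_mul, qq_sum, one_mul]

lemma exists_bound {f : Γ.YY → ℝ} (hf : Continuous f) : ∃ C, ∀ y, |f y| ≤ C := by
  obtain ⟨C, hC⟩ := isCompact_univ.exists_bound_of_continuousOn hf.continuousOn
  exact ⟨C, fun y => hC y trivial⟩

/-- Existence of the invariant occupation measure. -/
theorem exists_occ (p1 : Γ.K → ℝ) (hp : IsBelief p1) (σ : Γ.Strategy) :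
    ∃ lam : Measure Γ.YY, IsProbabilityMeasure lam ∧
      (∀ f : Γ.YY → ℝ, Continuous f → ∫ y, PP f y ∂lam = ∫ y, f y ∂lam) ∧
      Γ.pay p1 σ ≤ ∫ y, gg y ∂lam ∧
      (∀ f : Γ.YY → ℝ, Continuous f → ∀ δ > 0, ∃ m, ∫ y, f y ∂lam - δ ≤ occ p1 (red σ) m f) := by
  let lm : ℕ → ProbabilityMeasure Γ.YY := fun n => ⟨occM p1 (red σ) n, occM_prob p1 hp _ n⟩
  let F : Ultrafilter (ProbabilityMeasure Γ.YY) := (hyperfilter ℕ).map lm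
  have hF := F.le_nhds_lim
  have ht : Tendsto lm (hyperfilter ℕ) (nhds F.lim) := hF
  rw [ProbabilityMeasure.tendsto_iff_forall_integral_tendsto] at ht
  have ht2 : ∀ f : Γ.YY → ℝ, Continuous f → Tendsto (fun n => ∫ y, f y ∂(occM p1 (red σ) n))
      (hyperfilter ℕ) (nhds (∫ y, f y ∂(F.lim : Measure Γ.YY))) := fun f hf =>
    ht (BoundedContinuousFunction.mkOfCompact ⟨f, hf⟩)
  refine ⟨F.lim, inferInstance, ?_, ?_, ?_⟩
  · intro f hf
    obtain ⟨C, hC⟩ := exists_bound hf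
    have h1 := (ht2 _ (continuous_PP hf)).sub (ht2 f hf)
    have h2 : Tendsto (fun n => ∫ y, PP f y ∂(occM p1 (red σ) n) - ∫ y, f y ∂(occM p1 (red σ) n))
        atTop (nhds 0) := by
      have e : ∀ n, ∫ y, PP f y ∂(occM p1 (red σ) n) - ∫ y, f y ∂(occM p1 (red σ) n) =
          (1 / ((n:ℝ) + 1)) * (occ p1 (red σ) (n + 1) f - occ p1 (red σ) 0 f) := by
        intro n
        rw [int_occM p1 hp _ n f hf.measurable, int_occM p1 hp _ n _ (continuous_PP hf).measurable,
          ← mul_sub, ← Finset.sum_sub_distrib]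
        congr 1
        exact Finset.sum_range_sub (fun m => occ p1 (red σ) m f) (n + 1)
      simp only [e]
      refine bdd_le_mul_tendsto_zero' (2 * C) ?_ ?_ |>.congr fun n => mul_comm _ _
      · refine Eventually.of_forall fun n => ?_
        have hb : ∀ m, |occ p1 (red σ) m f| ≤ C := by
          intro m
          unfold occ
          calc _ ≤ ∑ k, |p1 k * (PP^[m] f) (k, red σ)| := Finset.abs_sum_le_sum_abs _ _
            _ ≤ ∑ k, p1 k * C := Finset.sum_le_sum fun k _ => by
                rw [abs_mul, abs_of_nonneg (hp.1 k)]
                exact mul_le_mul_of_nonneg_left (iterate_bound f C hC m _) (hp.1 k)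
            _ = C := by rw [← Finset.sum_mul, hp.2, one_mul]
        have a1 := abs_le.1 (hb (n + 1))
        have a2 := abs_le.1 (hb 0)
        rw [abs_le]; constructor <;> linarith
      · exact tendsto_one_div_add_atTop_nhds_zero_nat
    have := tendsto_nhds_unique h1 (h2.mono_left Nat.hyperfilter_le_atTop)
    linarith
  · exact pay_le_occ p1 hp σ _ Nat.hyperfilter_le_atTop _ (ht2 _ continuous_gg)
  · intro f hf δ hδ
    have h1 := (tendsto_order.1 (ht2 f hf)).1 (∫ y, f y ∂(F.lim : Measure Γ.YY) - δ) (by linarith)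
    obtain ⟨n, hn⟩ := h1.exists
    by_contra hcon
    push Not at hcon
    rw [int_occM p1 hp _ n f hf.measurable] at hn
    have : ∑ m ∈ Finset.range (n + 1), occ p1 (red σ) m f ≤
        ∑ m ∈ Finset.range (n + 1), (∫ y, f y ∂(F.lim : Measure Γ.YY) - δ) :=
      Finset.sum_le_sum fun m _ => (hcon m).le
    rw [Finset.sum_const, Finset.card_range, nsmul_eq_mul] at this
    push_cast at this
    rw [one_div, lt_inv_mul_iff₀ (by positivity)] at hn
    linarith

end POMDP

namespace POMDP
variable {Γ : POMDP}

lemma measurable_qq : Measurable (fun p : Γ.YY × Γ.ZZ => qq p.1 p.2) :=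
  measurable_from_prod_countable_left fun z => (continuous_qq z).measurable
lemma measurable_sc : Measurable (fun p : Γ.YY × Γ.ZZ => sc p.1 p.2) :=
  measurable_from_prod_countable_left fun z => (continuous_sc z).measurable

/-- Joint law of position and outcome. -/
noncomputable def lamh (lam : Measure Γ.YY) : Measure (Γ.YY × Γ.ZZ) :=
  (lam.prod Measure.count).withDensity fun p => ((qq p.1 p.2).toNNReal : ENNReal)

lemma measurable_dens : Measurable (fun p : Γ.YY × Γ.ZZ => (qq p.1 p.2).toNNReal) :=
  measurable_qq.real_toNNReal

lemma ae_lamh (lam : Measure Γ.YY) [IsProbabilityMeasure lam] {P : Γ.YY × Γ.ZZ → Prop}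
    (h : ∀ᵐ p ∂(lamh lam), P p) : ∀ᵐ y ∂lam, ∀ z, 0 < qq y z → P (y, z) := by
  unfold lamh at h
  rw [ae_withDensity_iff measurable_dens.coe_nnreal_ennreal] at h
  have h2 := Measure.ae_ae_of_ae_prod h
  filter_upwards [h2] with y hy z hz
  rw [Measure.ae_count_iff] at hy
  exact hy z (by simpa using hz)

lemma int_lamh (lam : Measure Γ.YY) [IsProbabilityMeasure lam] (F : Γ.YY × Γ.ZZ → ℝ)
    (hF : Integrable F (lamh lam)) :
    ∫ p, F p ∂(lamh lam) = ∫ y, ∑ z, qq y z * F (y, z) ∂lam := by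
  unfold lamh at hF ⊢
  rw [integral_withDensity_eq_integral_smul measurable_dens]
  rw [integrable_withDensity_iff_integrable_smul measurable_dens] at hF
  rw [integral_prod _ hF]
  refine integral_congr_ae (ae_of_all _ fun y => ?_)
  simp only
  rw [integral_count]
  refine Finset.sum_congr rfl fun z _ => ?_
  rw [NNReal.smul_def, smul_eq_mul, Real.coe_toNNReal _ (qq_nonneg y z)]

lemma lamh_fst (lam : Measure Γ.YY) [IsProbabilityMeasure lam] :
    MeasurePreserving Prod.fst (lamh lam) lam := by
  refine ⟨measurable_fst, ?_⟩
  ext s hs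
  rw [Measure.map_apply measurable_fst hs]
  unfold lamh
  rw [withDensity_apply _ (measurable_fst hs)]
  have e : (Prod.fst ⁻¹' s : Set (Γ.YY × Γ.ZZ)) = s ×ˢ Set.univ := by ext; simp
  rw [e, ← Measure.prod_restrict, Measure.restrict_univ,
    lintegral_prod _ measurable_dens.coe_nnreal_ennreal.aemeasurable]
  have : ∀ y : Γ.YY, ∫⁻ z, ((qq y z).toNNReal : ENNReal) ∂Measure.count = 1 := by
    intro y
    rw [lintegral_count, tsum_fintype]
    have := ENNReal.ofReal_sum_of_nonneg (s := Finset.univ) (fun z _ => qq_nonneg y z)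
    rw [qq_sum, ENNReal.ofReal_one] at this
    exact this.symm
  simp only [this, lintegral_const, one_mul, Measure.restrict_apply_univ]

lemma lamh_prob (lam : Measure Γ.YY) [IsProbabilityMeasure lam] :
    IsProbabilityMeasure (lamh lam) := by
  constructor
  rw [← Set.preimage_univ (f := Prod.fst), ← Measure.map_apply measurable_fst MeasurableSet.univ,
    (lamh_fst lam).map_eq, measure_univ]

lemma lamh_sc (lam : Measure Γ.YY) [IsProbabilityMeasure lam]
    (hinv : ∀ f : Γ.YY → ℝ, Continuous f → ∫ y, PP f y ∂lam = ∫ y, f y ∂lam) :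
    MeasurePreserving (fun p : Γ.YY × Γ.ZZ => sc p.1 p.2) (lamh lam) lam := by
  have := lamh_prob lam
  refine ⟨measurable_sc, ?_⟩
  have : IsProbabilityMeasure ((lamh lam).map (fun p : Γ.YY × Γ.ZZ => sc p.1 p.2)) :=
    Measure.isProbabilityMeasure_map measurable_sc.aemeasurable
  refine ext_of_forall_integral_eq_of_IsFiniteMeasure fun f => ?_
  rw [integral_map measurable_sc.aemeasurable f.continuous.aestronglyMeasurable, int_lamh,
    ← hinv f f.continuous]
  · rfl
  · refine Integrable.of_bound
      (f.continuous.measurable.comp measurable_sc).aestronglyMeasurable ‖f‖ (ae_of_all _ fun p => ?_)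
    exact f.norm_coe_le_norm _

lemma ae_succ (lam : Measure Γ.YY) [IsProbabilityMeasure lam]
    (hinv : ∀ f : Γ.YY → ℝ, Continuous f → ∫ y, PP f y ∂lam = ∫ y, f y ∂lam)
    {P : Γ.YY → Prop} (h : ∀ᵐ y ∂lam, P y) : ∀ᵐ y ∂lam, ∀ z, 0 < qq y z → P (sc y z) :=
  ae_lamh lam ((lamh_sc lam hinv).quasiMeasurePreserving.ae h)

lemma continuous_iter {f : Γ.YY → ℝ} (hf : Continuous f) (j : ℕ) : Continuous (PP^[j] f) := by
  induction j with
  | zero => exact hf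
  | succ j ih => rw [Function.iterate_succ_apply']; exact continuous_PP ih

lemma memLp_cont (lam : Measure Γ.YY) [IsProbabilityMeasure lam] {f : Γ.YY → ℝ}
    (hf : Continuous f) : MemLp f 2 lam := by
  obtain ⟨C, hC⟩ := exists_bound hf
  exact MemLp.of_bound hf.aestronglyMeasurable C (ae_of_all _ hC)

/-- Cesaro averages. -/
noncomputable def AA (n : ℕ) (y : Γ.YY) : ℝ := (n : ℝ)⁻¹ * ∑ j ∈ Finset.range n, (PP^[j] gg) y

lemma AA_mem (n : ℕ) (y : Γ.YY) : 0 ≤ AA n y ∧ AA n y ≤ 1 := by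
  have hgb : ∀ y : Γ.YY, |gg y| ≤ 1 := fun y => by
    unfold gg; rw [abs_of_nonneg (Γ.g_nonneg _ _)]; exact Γ.g_le_one _ _
  have hn : ∀ j (y : Γ.YY), 0 ≤ (PP^[j] gg) y := by
    intro j
    induction j with
    | zero => exact fun y => Γ.g_nonneg _ _
    | succ j ih =>
      intro y
      rw [Function.iterate_succ_apply']
      exact Finset.sum_nonneg fun z _ => mul_nonneg (qq_nonneg _ _) (ih _)
  unfold AA
  refine ⟨mul_nonneg (by positivity) (Finset.sum_nonneg fun j _ => hn j y), ?_⟩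
  have : ∑ j ∈ Finset.range n, (PP^[j] gg) y ≤ n := by
    refine (Finset.sum_le_sum fun j _ =>
      (le_abs_self _).trans (iterate_bound gg 1 hgb j y)).trans ?_
    simp
  calc (n : ℝ)⁻¹ * _ ≤ (n : ℝ)⁻¹ * n := mul_le_mul_of_nonneg_left this (by positivity)
    _ ≤ 1 := by rw [inv_mul_eq_div]; exact div_self_le_one _

theorem ergodic (lam : Measure Γ.YY) [IsProbabilityMeasure lam]
    (hinv : ∀ f : Γ.YY → ℝ, Continuous f → ∫ y, PP f y ∂lam = ∫ y, f y ∂lam) :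
    ∃ w : Γ.YY → ℝ, Measurable w ∧
      (∃ ns : ℕ → ℕ, StrictMono ns ∧
        ∀ᵐ y ∂lam, Tendsto (fun i => AA (ns i) y) atTop (nhds (w y))) ∧
      (∀ᵐ y ∂lam, ∀ z, 0 < qq y z → w (sc y z) = w y) ∧ ∫ y, w y ∂lam = ∫ y, gg y ∂lam := by
  have hp := lamh_prob lam
  let U0 := Lp.compMeasurePreservingₗᵢ (E := ℝ) (p := 2) ℝ _ (lamh_fst lam)
  let U1 := Lp.compMeasurePreservingₗᵢ (E := ℝ) (p := 2) ℝ _ (lamh_sc lam hinv)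
  let V0 := U0.toContinuousLinearMap
  let V1 := U1.toContinuousLinearMap
  let T : Lp ℝ 2 lam →L[ℝ] Lp ℝ 2 lam := (ContinuousLinearMap.adjoint V0).comp V1
  have hT : ‖T‖ ≤ 1 := by
    refine (ContinuousLinearMap.opNorm_comp_le _ _).trans ?_
    rw [LinearIsometryEquiv.norm_map]
    exact mul_le_one₀ (LinearIsometry.norm_toContinuousLinearMap_le _) (norm_nonneg _)
      (LinearIsometry.norm_toContinuousLinearMap_le _)
  have hinner : ∀ f u : Lp ℝ 2 lam, inner ℝ (T f) u = inner ℝ (U1 f) (U0 u) := fun f u =>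
    ContinuousLinearMap.adjoint_inner_left V0 u (V1 f)
  have hTP : ∀ (f : Γ.YY → ℝ) (hf : Continuous f),
      T ((memLp_cont lam hf).toLp f) = (memLp_cont lam (continuous_PP hf)).toLp (PP f) := by
    intro f hf
    refine ext_inner_right ℝ fun u => ?_
    have e1 : (U1 ((memLp_cont lam hf).toLp f) : Γ.YY × Γ.ZZ → ℝ) =ᵐ[lamh lam]
        fun p => f (sc p.1 p.2) := by
      refine (Lp.coeFn_compMeasurePreserving _ (lamh_sc lam hinv)).trans ?_
      exact (lamh_sc lam hinv).quasiMeasurePreserving.ae_eq_comp (memLp_cont lam hf).coeFn_toLp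
    have e0 : (U0 u : Γ.YY × Γ.ZZ → ℝ) =ᵐ[lamh lam] fun p => u p.1 :=
      Lp.coeFn_compMeasurePreserving _ (lamh_fst lam)
    have e2 : (fun p => inner ℝ (U1 ((memLp_cont lam hf).toLp f) p) (U0 u p)) =ᵐ[lamh lam]
        fun p : Γ.YY × Γ.ZZ => inner ℝ (f (sc p.1 p.2)) (u p.1) := by
      filter_upwards [e1, e0] with p h1 h0
      rw [h1, h0]
    rw [hinner, L2.inner_def, L2.inner_def, integral_congr_ae e2, int_lamh]
    · refine integral_congr_ae ?_
      filter_upwards [(memLp_cont lam (continuous_PP hf)).coeFn_toLp] with y hy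
      rw [hy]
      simp only [PP, RCLike.inner_apply, conj_trivial, Finset.mul_sum]
      exact Finset.sum_congr rfl fun z _ => by ring
    · exact (L2.integrable_inner (𝕜 := ℝ) (U1 ((memLp_cont lam hf).toLp f)) (U0 u)).congr e2
  let G : ℕ → Lp ℝ 2 lam := fun j => (memLp_cont lam (continuous_iter continuous_gg j)).toLp _
  have hG : ∀ j, T^[j] (G 0) = G j := by
    intro j
    induction j with
    | zero => rfl
    | succ j ih =>
      rw [Function.iterate_succ_apply', ih, hTP _ (continuous_iter continuous_gg j)]
      simp only [G, Function.iterate_succ_apply']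
  obtain ⟨w, hTw, hlim⟩ : ∃ w : Lp ℝ 2 lam, T w = w ∧
      Tendsto (fun n => birkhoffAverage ℝ (⇑T) id n (G 0)) atTop (nhds w) :=
    ⟨_, LinearMap.mem_eqLocus.1 (SetLike.coe_mem _),
      T.tendsto_birkhoffAverage_orthogonalProjection hT (G 0)⟩
  have hA : ∀ n, ((birkhoffAverage ℝ (⇑T) id n (G 0) : Lp ℝ 2 lam) : Γ.YY → ℝ) =ᵐ[lam] AA n := by
    intro n
    have hs : ∀ n : ℕ, ((∑ j ∈ Finset.range n, G j : Lp ℝ 2 lam) : Γ.YY → ℝ) =ᵐ[lam]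
        fun y => ∑ j ∈ Finset.range n, (PP^[j] gg) y := by
      intro n
      induction n with
      | zero => simp only [Finset.range_zero, Finset.sum_empty]; exact Lp.coeFn_zero _ _ _
      | succ n ih =>
        rw [Finset.sum_range_succ]
        filter_upwards [ih, Lp.coeFn_add (∑ j ∈ Finset.range n, G j) (G n),
          (memLp_cont lam (continuous_iter continuous_gg n)).coeFn_toLp] with y h1 h2 h3
        rw [h2, Pi.add_apply, h1, Finset.sum_range_succ]
        congr 1
    have : birkhoffAverage ℝ (⇑T) id n (G 0) = (n : ℝ)⁻¹ • ∑ j ∈ Finset.range n, G j := by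
      simp only [birkhoffAverage, birkhoffSum, id, hG]
    rw [this]
    filter_upwards [hs n, Lp.coeFn_smul (n : ℝ)⁻¹ (∑ j ∈ Finset.range n, G j)] with y h1 h2
    rw [h2, Pi.smul_apply, h1]; rfl
  have hU : U1 w = U0 w := by
    rw [← sub_eq_zero, ← norm_eq_zero, ← sq_eq_zero_iff, norm_sub_sq_real, U1.norm_map, U0.norm_map,
      ← hinner, hTw, real_inner_self_eq_norm_sq]
    ring
  obtain ⟨ns, hns, hae⟩ := (tendstoInMeasure_of_tendsto_Lp hlim).exists_seq_tendsto_ae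
  have hae2 : ∀ᵐ y ∂lam, Tendsto (fun i => AA (ns i) y) atTop (nhds (w y)) := by
    filter_upwards [hae, ae_all_iff.2 hA] with y h1 h2
    refine h1.congr fun i => h2 _
  have hcont : ∀ n, Continuous (AA (Γ := Γ) n) := fun n =>
    continuous_const.mul (continuous_finsetSum _ fun j _ => continuous_iter continuous_gg j)
  refine ⟨w, (Lp.stronglyMeasurable w).measurable, ⟨ns, hns, hae2⟩, ?_, ?_⟩
  · refine ae_lamh lam (P := fun p => w (sc p.1 p.2) = w p.1) ?_
    filter_upwards [Lp.coeFn_compMeasurePreserving w (lamh_sc lam hinv),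
      Lp.coeFn_compMeasurePreserving w (lamh_fst lam)] with p h1 h0
    have h3 : (Lp.compMeasurePreserving _ (lamh_sc lam hinv)) w =
      (Lp.compMeasurePreserving _ (lamh_fst lam)) w := hU
    rw [h3] at h1
    exact h1.symm.trans h0
  · have hb : ∀ n (y : Γ.YY), |AA n y| ≤ 1 := fun n y => by
      rw [abs_of_nonneg (AA_mem n y).1]; exact (AA_mem n y).2
    have h1 : Tendsto (fun i => ∫ y, AA (ns i) y ∂lam) atTop (nhds (∫ y, w y ∂lam)) := by
      refine tendsto_integral_of_dominated_convergence (fun _ => 1) ?_ (integrable_const _) ?_ hae2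
      · exact fun i => (hcont _).aestronglyMeasurable
      · exact fun i => ae_of_all _ fun y => hb _ y
    have hI : ∀ j, ∫ y, (PP^[j] gg) y ∂lam = ∫ y, gg y ∂lam := by
      intro j
      induction j with
      | zero => rfl
      | succ j ih =>
        rw [Function.iterate_succ_apply', hinv _ (continuous_iter continuous_gg j), ih]
    have h2 : ∀ᶠ i in atTop, ∫ y, AA (ns i) y ∂lam = ∫ y, gg y ∂lam := by
      filter_upwards [eventually_ge_atTop 1] with i hi
      have : 1 ≤ ns i := hi.trans (hns.id_le i)
      unfold AA
      rw [integral_const_mul, integral_finsetSum _ fun j _ =>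
        (memLp_cont lam (continuous_iter continuous_gg j)).integrable (by norm_num)]
      simp only [hI, Finset.sum_const, Finset.card_range, nsmul_eq_mul]
      rw [inv_mul_cancel_left₀]
      positivity
    exact tendsto_nhds_unique h1 (tendsto_const_nhds.congr' (h2.mono fun i h => h.symm))

end POMDP

namespace POMDP
variable {Γ : POMDP}

lemma exists_D (lam : Measure Γ.YY) [IsProbabilityMeasure lam] :
    ∃ D : Set Γ.YY, MeasurableSet D ∧ (∀ᵐ y ∂lam, y ∈ D) ∧
      ∀ P : Γ.YY → Prop, (∀ᵐ y ∂lam, P y) → ∀ᵐ y ∂lam, ∀ k, (k, y.2) ∈ D → P (k, y.2) := by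
  let ν : Measure Γ.Sg := lam.map Prod.snd
  let lk : Γ.K → Measure Γ.Sg := fun k => (lam.restrict (Prod.fst ⁻¹' {k})).map Prod.snd
  have hk : ∀ k : Γ.K, MeasurableSet (Prod.fst ⁻¹' {k} : Set Γ.YY) := fun k =>
    measurable_fst (MeasurableSet.singleton k)
  have hν : IsProbabilityMeasure ν := Measure.isProbabilityMeasure_map measurable_snd.aemeasurable
  have hB : ∀ k, ∃ B : Set Γ.Sg, MeasurableSet B ∧ lk k Bᶜ = 0 ∧
      ∀ N ⊆ B, lk k N = 0 → ν N = 0 := by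
    intro k
    have : IsFiniteMeasure (lk k) := by simp only [lk]; infer_instance
    obtain ⟨s, hs, h1, h2⟩ := Measure.mutuallySingular_singularPart ν (lk k)
    refine ⟨s, hs, h2, fun N hN hN0 => ?_⟩
    have hl : ν.HaveLebesgueDecomposition (lk k) := Measure.haveLebesgueDecomposition_of_sigmaFinite _ _
    rw [Measure.haveLebesgueDecomposition_add ν (lk k), Measure.add_apply,
      measure_mono_null hN h1, withDensity_absolutelyContinuous _ _ hN0, add_zero]
  choose B hBm hB1 hB2 using hB
  have hlk : ∀ k A, MeasurableSet A → lk k A = lam ({k} ×ˢ A) := by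
    intro k A hA
    simp only [lk]
    rw [Measure.map_apply measurable_snd hA, Measure.restrict_apply (measurable_snd hA)]
    congr 1
    ext y; simp [and_comm]
  refine ⟨{y | y.2 ∈ B y.1}, ?_, ?_, ?_⟩
  · have : {y : Γ.YY | y.2 ∈ B y.1} = ⋃ k, {k} ×ˢ B k := by
      ext ⟨a, b⟩; simp
    rw [this]
    exact MeasurableSet.iUnion fun k => (MeasurableSet.singleton k).prod (hBm k)
  · have : ∀ k, ∀ᵐ y ∂lam, ¬ (y ∈ ({k} ×ˢ (B k)ᶜ : Set Γ.YY)) := by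
      intro k
      rw [ae_iff]
      simp only [not_not, Set.ofPred_mem_eq]
      rw [← hlk k _ (hBm k).compl, hB1]
    filter_upwards [ae_all_iff.2 this] with y hy
    have := hy y.1
    simpa using this
  · intro P hP
    obtain ⟨N, hN, hNm, hN0⟩ := exists_measurable_superset_of_null (ae_iff.1 hP)
    have h : ∀ k, ∀ᵐ σ ∂ν, ¬ (σ ∈ B k ∩ {σ | (k, σ) ∈ N}) := by
      intro k
      rw [ae_iff]
      simp only [not_not, Set.ofPred_mem_eq]
      have hm : MeasurableSet (B k ∩ {σ | (k, σ) ∈ N}) :=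
        (hBm k).inter (measurable_prodMk_left hNm)
      refine hB2 k _ Set.inter_subset_left ?_
      rw [hlk k _ hm]
      refine measure_mono_null ?_ hN0
      rintro ⟨a, b⟩ h
      simp only [Set.mem_prod, Set.mem_singleton_iff] at h
      obtain ⟨rfl, h⟩ := h
      exact h.2
    filter_upwards [ae_of_ae_map measurable_snd.aemeasurable (ae_all_iff.2 h)] with y hy k hk
    by_contra hcon
    exact hy k ⟨hk, hN hcon⟩

/-- Regularity up to depth `j`. -/
def Rr (D : Set Γ.YY) (G : Γ.YY → Prop) : ℕ → Γ.Sg → Prop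
  | 0, σ => ∀ k, (k, σ) ∈ D → G (k, σ)
  | j + 1, σ => ∀ k, (k, σ) ∈ D → ∀ z, 0 < qq (k, σ) z → Rr D G j (sc (k, σ) z).2

theorem exists_good (lam : Measure Γ.YY) [IsProbabilityMeasure lam]
    (hinv : ∀ f : Γ.YY → ℝ, Continuous f → ∫ y, PP f y ∂lam = ∫ y, f y ∂lam) :
    ∃ (w : Γ.YY → ℝ) (ns : ℕ → ℕ) (D : Set Γ.YY) (Q : Set Γ.Sg),
      Measurable w ∧ StrictMono ns ∧ MeasurableSet D ∧ (∀ᵐ y ∂lam, y ∈ D) ∧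
      (∀ᵐ y ∂lam, y.2 ∈ Q) ∧ (∫ y, w y ∂lam = ∫ y, gg y ∂lam) ∧
      (∀ σ ∈ Q, ∀ k, (k, σ) ∈ D → Tendsto (fun i => AA (ns i) (k, σ)) atTop (nhds (w (k, σ)))) ∧
      (∀ σ ∈ Q, ∀ k, (k, σ) ∈ D → ∀ z, 0 < qq (k, σ) z →
        w (sc (k, σ) z) = w (k, σ) ∧ sc (k, σ) z ∈ D ∧ sh σ [z.2] ∈ Q) := by
  obtain ⟨w, hwm, ⟨ns, hns, hlim⟩, hw, hint⟩ := ergodic lam hinv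
  obtain ⟨D, hDm, hD, hAE⟩ := exists_D lam
  let G : Γ.YY → Prop := fun y => Tendsto (fun i => AA (ns i) y) atTop (nhds (w y)) ∧
    ∀ z, 0 < qq y z → w (sc y z) = w y ∧ sc y z ∈ D
  have hG : ∀ᵐ y ∂lam, G y := by
    filter_upwards [hlim, hw, ae_succ lam hinv hD] with y h1 h2 h3
    exact ⟨h1, fun z hz => ⟨h2 z hz, h3 z hz⟩⟩
  have hR : ∀ j, ∀ᵐ y ∂lam, Rr D G j y.2 := by
    intro j
    induction j with
    | zero => exact hAE G hG
    | succ j ih => exact hAE _ (ae_succ lam hinv ih)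
  refine ⟨w, ns, D, {σ | ∀ j, Rr D G j σ}, hwm, hns, hDm, hD, ae_all_iff.2 hR, hint, ?_, ?_⟩
  · exact fun σ hσ k hk => (hσ 0 k hk).1
  · intro σ hσ k hk z hz
    have := (hσ 0 k hk).2 z hz
    exact ⟨this.1, this.2, fun j => hσ (j + 1) k hk z hz⟩

end POMDP

namespace POMDP
variable {Γ : POMDP}

open Classical in
/-- Numeric label. -/
noncomputable def labN (w : Γ.YY → ℝ) (D : Set Γ.YY) (R : ℕ) (y : Γ.YY) : ℕ :=
  if y ∈ D then min R ⌊R * w y⌋₊ + 1 else 0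

lemma labN_lt (w : Γ.YY → ℝ) (D : Set Γ.YY) (R : ℕ) (y : Γ.YY) : labN w D R y < R + 2 := by
  unfold labN
  split_ifs
  · have := min_le_left R ⌊R * w y⌋₊; omega
  · omega

/-- Label. -/
noncomputable def lab (w : Γ.YY → ℝ) (D : Set Γ.YY) (R : ℕ) (σ : Γ.Sg) (k : Γ.K) : Fin (R + 2) :=
  ⟨labN w D R (k, σ), labN_lt w D R _⟩

/-- Value of a label. -/
noncomputable def lv {R : ℕ} (i : Fin (R + 2)) : ℝ := ((i.1 - 1 : ℕ) : ℝ) / R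

lemma lv_nonneg {R : ℕ} (i : Fin (R + 2)) : 0 ≤ lv i := by unfold lv; positivity
lemma lv_le_one {R : ℕ} (i : Fin (R + 2)) : lv i ≤ 1 := by
  unfold lv
  refine div_le_one_of_le₀ ?_ (by positivity)
  have := i.2
  exact_mod_cast (by omega : i.1 - 1 ≤ R)

lemma lab_not_mem {w : Γ.YY → ℝ} {D : Set Γ.YY} {R : ℕ} {σ : Γ.Sg} {k : Γ.K} (h : (k, σ) ∉ D) :
    lv (lab w D R σ k) = 0 := by
  simp [lv, lab, labN, h]

lemma lab_mem_iff {w : Γ.YY → ℝ} {D : Set Γ.YY} {R : ℕ} {σ τ : Γ.Sg} {k : Γ.K}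
    (h : lab w D R σ k = lab w D R τ k) (h1 : (k, σ) ∈ D) : (k, τ) ∈ D := by
  by_contra h2
  simp [lab, labN, h1, h2] at h

lemma lab_congr {w : Γ.YY → ℝ} {D : Set Γ.YY} {R : ℕ} {σ τ : Γ.Sg} {k l : Γ.K}
    (h1 : (k, σ) ∈ D) (h2 : (l, τ) ∈ D) (h : w (k, σ) = w (l, τ)) :
    lab w D R σ k = lab w D R τ l := by
  simp [lab, labN, h1, h2, h]

lemma lv_lab {w : Γ.YY → ℝ} {D : Set Γ.YY} {R : ℕ} {σ : Γ.Sg} {k : Γ.K} (hR : 0 < R)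
    (h : (k, σ) ∈ D) (h0 : 0 ≤ w (k, σ)) (h1 : w (k, σ) ≤ 1) :
    lv (lab w D R σ k) ≤ w (k, σ) ∧ w (k, σ) - 1 / R ≤ lv (lab w D R σ k) := by
  have hR' : (0 : ℝ) < R := by exact_mod_cast hR
  have hle : ⌊R * w (k, σ)⌋₊ ≤ R := by
    rw [← Nat.floor_natCast (R := ℝ) R]
    exact Nat.floor_le_floor (by rw [Nat.floor_natCast]; nlinarith)
  have e : lv (lab w D R σ k) = (⌊R * w (k, σ)⌋₊ : ℝ) / R := by
    simp [lv, lab, labN, h, hle]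
  rw [e, div_le_iff₀ hR', le_div_iff₀ hR']
  constructor
  · rw [mul_comm]; exact Nat.floor_le (by positivity)
  · have := Nat.lt_floor_add_one (R * w (k, σ))
    rw [sub_mul, one_div, inv_mul_cancel₀ hR'.ne']
    linarith

/-- Partial sums. -/
noncomputable def SS (r : ℕ) (y : Γ.YY) : ℝ := ∑ j ∈ Finset.range r, (PP^[j] gg) y

lemma SS_succ (r : ℕ) (y : Γ.YY) : SS (r + 1) y = gg y + ∑ z, qq y z * SS r (sc y z) := by
  unfold SS
  rw [Finset.sum_range_succ', add_comm]
  congr 1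
  simp only [Finset.mul_sum]
  rw [Finset.sum_comm]
  refine Finset.sum_congr rfl fun j _ => ?_
  rw [Function.iterate_succ_apply']
  rfl

lemma iter_nonneg {f : Γ.YY → ℝ} (hf : ∀ y, 0 ≤ f y) (j : ℕ) (y : Γ.YY) : 0 ≤ (PP^[j] f) y := by
  induction j generalizing y with
  | zero => exact hf y
  | succ j ih =>
    rw [Function.iterate_succ_apply']
    exact Finset.sum_nonneg fun z _ => mul_nonneg (qq_nonneg _ _) (ih _)

lemma SS_nonneg (r : ℕ) (y : Γ.YY) : 0 ≤ SS r y :=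
  Finset.sum_nonneg fun j _ => iter_nonneg (fun _ => Γ.g_nonneg _ _) j y

section core
variable (w : Γ.YY → ℝ) (D : Set Γ.YY) (R : ℕ) (Q : Set Γ.Sg)
  (rep : (Γ.K → Fin (R + 2)) → Γ.Sg) (n : ℕ)

/-- Core nodes. -/
abbrev N0 (Γ : POMDP) (R n : ℕ) := (Γ.K → Fin (R + 2)) × {hs : List Γ.S // hs.length < n}

/-- Strategy at a core node. -/
def sp (x : N0 Γ R n) : Γ.Sg := sh (rep x.1) x.2.1

/-- Next core node. -/
noncomputable def nx0 (hn : 0 < n) (x : N0 Γ R n) (s : Γ.S) : N0 Γ R n :=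
  if h : x.2.1.length + 1 < n then (x.1, ⟨x.2.1 ++ [s], by simpa using h⟩)
  else (lab w D R (sh (sp R rep n x) [s]), ⟨[], hn⟩)

open Classical in
/-- Value at a core node. -/
noncomputable def w0 (x : N0 Γ R n) (k : Γ.K) : ℝ :=
  if sp R rep n x ∈ Q then lv (lab w D R (sp R rep n x) k) else 0

open Classical in
/-- Potential at a core node. -/
noncomputable def h0 (η : ℝ) (x : N0 Γ R n) (k : Γ.K) : ℝ :=
  if sp R rep n x ∈ Q ∧ (k, sp R rep n x) ∈ D then
    SS (n - x.2.1.length) (k, sp R rep n x) -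
      ((n - x.2.1.length : ℕ) : ℝ) * (lv (lab w D R (sp R rep n x) k) - η)
  else - n

variable {w D R Q rep n}

lemma w0_nonneg (x : N0 Γ R n) (k : Γ.K) : 0 ≤ w0 w D R Q rep n x k := by
  unfold w0
  split_ifs
  · exact lv_nonneg _
  · exact le_rfl

lemma h0_ge {η : ℝ} (hη : 0 ≤ η) (x : N0 Γ R n) (k : Γ.K) : - (n : ℝ) ≤ h0 w D R Q rep n η x k := by
  unfold h0
  split_ifs
  · have h1 := SS_nonneg (n - x.2.1.length) (k, sp R rep n x)
    have h2 := lv_le_one (lab w D R (sp R rep n x) k)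
    have h3 : ((n - x.2.1.length : ℕ) : ℝ) ≤ n := by exact_mod_cast Nat.sub_le _ _
    have h4 : (0 : ℝ) ≤ ((n - x.2.1.length : ℕ) : ℝ) := by positivity
    nlinarith
  · exact le_rfl

/-- Core step. -/
lemma core_step (hn : 0 < n) (hrep : ∀ l, rep l ∈ Q)
    (hlab : ∀ σ ∈ Q, lab w D R (rep (lab w D R σ)) = lab w D R σ)
    (hQ : ∀ σ ∈ Q, ∀ k, (k, σ) ∈ D → ∀ z, 0 < qq (k, σ) z →
        w (sc (k, σ) z) = w (k, σ) ∧ sc (k, σ) z ∈ D ∧ sh σ [z.2] ∈ Q)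
    (x : N0 Γ R n) (k : Γ.K) (z : Γ.ZZ) (hz : 0 < qq (k, sp R rep n x) z)
    (h1 : sp R rep n x ∈ Q) (h2 : (k, sp R rep n x) ∈ D) :
    sp R rep n (nx0 w D R rep n hn x z.2) ∈ Q ∧
    (z.1, sp R rep n (nx0 w D R rep n hn x z.2)) ∈ D ∧
    lab w D R (sp R rep n (nx0 w D R rep n hn x z.2)) z.1 = lab w D R (sp R rep n x) k ∧
    (x.2.1.length + 1 < n → sp R rep n (nx0 w D R rep n hn x z.2) = sh (sp R rep n x) [z.2] ∧
      (nx0 w D R rep n hn x z.2).2.1.length = x.2.1.length + 1) ∧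
    (¬ x.2.1.length + 1 < n → (nx0 w D R rep n hn x z.2).2.1.length = 0) := by
  obtain ⟨a1, a2, a3⟩ := hQ _ h1 k h2 z hz
  have a4 : lab w D R (sh (sp R rep n x) [z.2]) z.1 = lab w D R (sp R rep n x) k :=
    lab_congr a2 h2 a1
  by_cases h : x.2.1.length + 1 < n
  · have e : sp R rep n (nx0 w D R rep n hn x z.2) = sh (sp R rep n x) [z.2] := by
      simp only [nx0, h, dite_true, sp, sh_sh]
    rw [e]
    refine ⟨a3, a2, a4, fun _ => ⟨rfl, by simp [nx0, h]⟩, fun h' => absurd h h'⟩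
  · have e : sp R rep n (nx0 w D R rep n hn x z.2) = rep (lab w D R (sh (sp R rep n x) [z.2])) := by
      simp only [nx0, h, dite_false, sp, sh_nil]
    rw [e]
    have b := hlab _ a3
    refine ⟨hrep _, lab_mem_iff (congrFun b z.1).symm a2, ?_, fun h' => absurd h' h,
      fun _ => by simp [nx0, h]⟩
    rw [b, a4]

lemma core_c1 (hn : 0 < n) (hrep : ∀ l, rep l ∈ Q)
    (hlab : ∀ σ ∈ Q, lab w D R (rep (lab w D R σ)) = lab w D R σ)
    (hQ : ∀ σ ∈ Q, ∀ k, (k, σ) ∈ D → ∀ z, 0 < qq (k, σ) z →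
        w (sc (k, σ) z) = w (k, σ) ∧ sc (k, σ) z ∈ D ∧ sh σ [z.2] ∈ Q)
    (x : N0 Γ R n) (k : Γ.K) (z : Γ.ZZ) (hz : 0 < qq (k, sp R rep n x) z) :
    w0 w D R Q rep n x k ≤ w0 w D R Q rep n (nx0 w D R rep n hn x z.2) z.1 := by
  by_cases h1 : sp R rep n x ∈ Q
  · by_cases h2 : (k, sp R rep n x) ∈ D
    · obtain ⟨a1, a2, a3, -⟩ := core_step hn hrep hlab hQ x k z hz h1 h2
      unfold w0
      rw [if_pos h1, if_pos a1, a3]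
    · refine le_trans (le_of_eq ?_) (w0_nonneg _ _)
      unfold w0
      rw [if_pos h1, lab_not_mem h2]
  · refine le_trans (le_of_eq ?_) (w0_nonneg _ _)
    unfold w0
    rw [if_neg h1]

lemma core_c2 (hR : 0 < R) (hn : 0 < n) (hrep : ∀ l, rep l ∈ Q)
    (hlab : ∀ σ ∈ Q, lab w D R (rep (lab w D R σ)) = lab w D R σ)
    (hQ : ∀ σ ∈ Q, ∀ k, (k, σ) ∈ D → ∀ z, 0 < qq (k, σ) z →
        w (sc (k, σ) z) = w (k, σ) ∧ sc (k, σ) z ∈ D ∧ sh σ [z.2] ∈ Q)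
    (hw01 : ∀ σ ∈ Q, ∀ k, (k, σ) ∈ D → 0 ≤ w (k, σ) ∧ w (k, σ) ≤ 1)
    {η : ℝ} (hη : 0 ≤ η)
    (hA : ∀ l k, (k, rep l) ∈ D → w (k, rep l) - η ≤ AA n (k, rep l))
    (x : N0 Γ R n) (k : Γ.K) :
    w0 w D R Q rep n x k + h0 w D R Q rep n η x k ≤ Γ.g k (sp R rep n x []) + η +
      ∑ z, Γ.q k (sp R rep n x []) z *
        h0 w D R Q rep n η (nx0 w D R rep n hn x z.2) z.1 := by
  have hsum : ∑ z, Γ.q k (sp R rep n x []) z * (-(n:ℝ)) = -n := by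
    rw [← Finset.sum_mul, Γ.q_sum, one_mul]
  have hg := Γ.g_nonneg k (sp R rep n x [])
  by_cases hd : sp R rep n x ∈ Q ∧ (k, sp R rep n x) ∈ D
  swap
  · have e1 : w0 w D R Q rep n x k = 0 := by
      unfold w0
      split_ifs with h
      · exact lab_not_mem fun h' => hd ⟨h, h'⟩
      · rfl
    have e2 : h0 w D R Q rep n η x k = -n := by
      unfold h0; rw [if_neg hd]
    have : ∑ z, Γ.q k (sp R rep n x []) z * (-(n:ℝ)) ≤ ∑ z, Γ.q k (sp R rep n x []) z *
        h0 w D R Q rep n η (nx0 w D R rep n hn x z.2) z.1 :=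
      Finset.sum_le_sum fun z _ => mul_le_mul_of_nonneg_left (h0_ge hη _ _) (Γ.q_nonneg _ _ _)
    rw [e1, e2]
    linarith
  obtain ⟨h1, h2⟩ := hd
  have hlt := x.2.2
  obtain ⟨r, hr⟩ : ∃ r, n - x.2.1.length = r + 1 := ⟨n - x.2.1.length - 1, by omega⟩
  set v := lv (lab w D R (sp R rep n x) k) with hv
  have e1 : w0 w D R Q rep n x k = v := by unfold w0; rw [if_pos h1]
  have e2 : h0 w D R Q rep n η x k = SS (r + 1) (k, sp R rep n x) - ((r:ℝ) + 1) * (v - η) := by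
    unfold h0; rw [if_pos ⟨h1, h2⟩, hr]; push_cast; rfl
  have key : ∀ z, Γ.q k (sp R rep n x []) z * (SS r (sc (k, sp R rep n x) z) - r * (v - η)) ≤
      Γ.q k (sp R rep n x []) z * h0 w D R Q rep n η (nx0 w D R rep n hn x z.2) z.1 := by
    intro z
    rcases (Γ.q_nonneg k (sp R rep n x []) z).eq_or_lt with h | hz
    · rw [← h, zero_mul, zero_mul]
    refine mul_le_mul_of_nonneg_left ?_ hz.le
    obtain ⟨a1, a2, a3, a4, a5⟩ := core_step hn hrep hlab hQ x k z hz h1 h2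
    unfold h0
    rw [if_pos ⟨a1, a2⟩, a3, ← hv]
    by_cases hc : x.2.1.length + 1 < n
    · obtain ⟨b1, b2⟩ := a4 hc
      rw [b2, b1, show n - (x.2.1.length + 1) = r by omega]
      exact le_rfl
    · rw [a5 hc, show r = 0 by omega, Nat.sub_zero]
      have hl : (nx0 w D R rep n hn x z.2).2.1 = [] := List.length_eq_zero_iff.1 (a5 hc)
      have hs : sp R rep n (nx0 w D R rep n hn x z.2) = rep (nx0 w D R rep n hn x z.2).1 := by
        rw [sp, hl, sh_nil]
      rw [hs] at a1 a2 a3 ⊢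
      have hAA := hA _ _ a2
      have hle := (lv_lab hR a2 (hw01 _ a1 _ a2).1 (hw01 _ a1 _ a2).2).1
      rw [a3, ← hv] at hle
      have hn' : (0 : ℝ) < n := by exact_mod_cast hn
      have : SS n (z.1, rep (nx0 w D R rep n hn x z.2).1) =
          n * AA n (z.1, rep (nx0 w D R rep n hn x z.2).1) := by
        unfold SS AA; rw [mul_inv_cancel_left₀ hn'.ne']
      rw [this]
      simp only [SS, Finset.range_zero, Finset.sum_empty, Nat.cast_zero, zero_mul, sub_zero]
      nlinarith
  have hk := Finset.sum_le_sum fun z (_ : z ∈ Finset.univ) => key z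
  have : ∑ z, Γ.q k (sp R rep n x []) z * (SS r (sc (k, sp R rep n x) z) - r * (v - η)) =
      ∑ z, Γ.q k (sp R rep n x []) z * SS r (sc (k, sp R rep n x) z) - r * (v - η) := by
    generalize (r : ℝ) * (v - η) = c
    simp only [mul_sub]
    rw [Finset.sum_sub_distrib, ← Finset.sum_mul, Γ.q_sum, one_mul]
  rw [this] at hk
  rw [e1, e2, SS_succ]
  have e3 : gg (k, sp R rep n x) = Γ.g k (sp R rep n x []) := rfl
  have e4 : ∑ z, qq (k, sp R rep n x) z * SS r (sc (k, sp R rep n x) z) =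
    ∑ z, Γ.q k (sp R rep n x []) z * SS r (sc (k, sp R rep n x) z) := rfl
  rw [e3, e4]
  nlinarith

end core

end POMDP

namespace POMDP
variable {Γ : POMDP}

lemma exists_cont_lab (ν : Measure Γ.Sg) [IsFiniteMeasure ν] {L : Type} [Fintype L] [Nonempty L]
    [TopologicalSpace L] [DiscreteTopology L] (f : Γ.Sg → L)
    (hf : ∀ l, MeasurableSet (f ⁻¹' {l})) (δ : ℝ) (hδ : 0 < δ) :
    ∃ i : Γ.Sg → L, Continuous i ∧ ∃ E : Set Γ.Sg, MeasurableSet E ∧ ν E ≤ ENNReal.ofReal δ ∧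
      ∀ σ, σ ∉ E → i σ = f σ := by
  classical
  have hd : ν.MeasureDense {s : Set Γ.Sg | IsClopen s} := by
    refine Measure.MeasureDense.of_generateFrom_isSetAlgebra_finite ν ?_ ?_
    · exact ⟨isClopen_empty, fun s hs => IsClopen.compl hs, fun s t hs ht => IsClopen.union hs ht⟩
    · rw [BorelSpace.measurable_eq (α := Γ.Sg)]
      exact isTopologicalBasis_isClopen.borel_eq_generateFrom
  have hc : (0 : ℝ) < Fintype.card L := by exact_mod_cast Fintype.card_pos
  have := fun l => hd.approx (f ⁻¹' {l}) (hf l) (measure_ne_top _ _) (δ / Fintype.card L)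
    (by positivity)
  choose C hC hCE using this
  let φ : (L → Bool) → L := fun s => if h : ∃ l, s l = true then h.choose else Classical.arbitrary L
  let b : Γ.Sg → L → Bool := fun σ l => (C l).boolIndicator σ
  have hb : Continuous b := continuous_pi fun l =>
    (continuous_boolIndicator_iff_isClopen (C l)).2 (hC l)
  have hφ : Continuous φ := continuous_of_discreteTopology
  refine ⟨φ ∘ b, hφ.comp hb, ⋃ l, symmDiff (f ⁻¹' {l}) (C l), ?_, ?_, ?_⟩
  · exact MeasurableSet.iUnion fun l => (hf l).symmDiff (hd.measurable _ (hC l))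
  · refine (measure_iUnion_fintype_le ν _).trans ?_
    refine (Finset.sum_le_sum fun l _ => (hCE l).le).trans ?_
    rw [Finset.sum_const, Finset.card_univ, nsmul_eq_mul, ← ENNReal.ofReal_natCast,
      ← ENNReal.ofReal_mul (by positivity), mul_div_cancel₀ _ hc.ne']
  · intro σ hσ
    have key : ∀ l, b σ l = true ↔ l = f σ := by
      intro l
      have h1 : σ ∉ symmDiff (f ⁻¹' {l}) (C l) := fun h => hσ (Set.mem_iUnion.2 ⟨l, h⟩)
      simp only [b, ← Set.mem_iff_boolIndicator]
      simp only [Set.mem_symmDiff, Set.mem_preimage, Set.mem_singleton_iff] at h1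
      constructor
      · intro h; by_contra h2; exact h1 (Or.inr ⟨h, fun h3 => h2 h3.symm⟩)
      · intro h; by_contra h2; exact h1 (Or.inl ⟨h.symm, h2⟩)
    have hex : ∃ l, b σ l = true := ⟨f σ, (key _).2 rfl⟩
    simp only [Function.comp, φ, hex, dite_true]
    exact (key _).1 hex.choose_spec

lemma measurable_labN {w : Γ.YY → ℝ} {D : Set Γ.YY} (R : ℕ) (hw : Measurable w)
    (hD : MeasurableSet D) : Measurable (labN w D R) := by
  unfold labN
  refine Measurable.ite hD ?_ measurable_const
  exact (measurable_const.min (Nat.measurable_floor.comp (measurable_const.mul hw))).add_const 1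

lemma measurable_lab {w : Γ.YY → ℝ} {D : Set Γ.YY} (R : ℕ) (hw : Measurable w)
    (hD : MeasurableSet D) (l : Γ.K → Fin (R + 2)) : MeasurableSet (lab w D R ⁻¹' {l}) := by
  have : lab w D R ⁻¹' {l} = ⋂ k, {σ | labN w D R (k, σ) = (l k).1} := by
    ext σ
    simp only [Set.mem_preimage, Set.mem_singleton_iff, Set.mem_iInter, Set.mem_ofPred_eq,
      funext_iff, lab, Fin.ext_iff]
  rw [this]
  exact MeasurableSet.iInter fun k =>
    ((measurable_labN R hw hD).comp measurable_prodMk_left) (MeasurableSet.singleton _)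

/-- Abstract certificates on finite types. -/
theorem complete (p1 : Γ.K → ℝ) (hp : IsBelief p1) (t : ℝ) (ht : t < Γ.val p1) :
    ∃ (X : Type) (_ : Fintype X) (ρ : X → ℕ) (x0 : X) (ac : X → Γ.A) (nx : X → Γ.S → X)
      (w h : X → Γ.K → ℝ) (η : ℝ), 0 ≤ η ∧ (∀ x s, ρ (nx x s) < max (ρ x) 1) ∧
      (∀ x k, 0 ≤ w x k) ∧
      (∀ x k, w x k ≤ ∑ y, Γ.q k (ac x) y * w (nx x y.2) y.1) ∧
      (∀ x, ρ x = 0 → ∀ k y, 0 < Γ.q k (ac x) y → w x k ≤ w (nx x y.2) y.1) ∧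
      (∀ x k, w x k + h x k ≤ Γ.g k (ac x) + η + ∑ y, Γ.q k (ac x) y * h (nx x y.2) y.1) ∧
      t < ∑ k, p1 k * w x0 k - η := by
  classical
  obtain ⟨σ', hσ'⟩ := exists_lt_of_lt_ciSup ht
  obtain ⟨lam, hlam, hinv, hpay, hocc⟩ := exists_occ p1 hp σ'
  obtain ⟨w, ns, D, Q, hwm, hns, hDm, hD, hQae, hint, hlim, hQ⟩ := exists_good lam hinv
  set ε := (Γ.pay p1 σ' - t) / 8 with hε
  have hε0 : 0 < ε := by rw [hε]; linarith
  have hw01 : ∀ σ ∈ Q, ∀ k, (k, σ) ∈ D → 0 ≤ w (k, σ) ∧ w (k, σ) ≤ 1 := fun σ hσ k hk =>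
    ⟨ge_of_tendsto (hlim σ hσ k hk) (Eventually.of_forall fun i => (AA_mem _ _).1),
      le_of_tendsto (hlim σ hσ k hk) (Eventually.of_forall fun i => (AA_mem _ _).2)⟩
  obtain ⟨R', hR'⟩ := exists_nat_one_div_lt hε0
  set R := R' + 1 with hRdef
  have hR : 0 < R := Nat.succ_pos _
  have hRε : 1 / (R : ℝ) < ε := by rw [hRdef]; push_cast; exact hR'
  obtain ⟨y0, hy0⟩ := hQae.exists
  -- representatives
  let rep : (Γ.K → Fin (R + 2)) → Γ.Sg := fun l =>
    if hl : ∃ σ ∈ Q, lab w D R σ = l then hl.choose else y0.2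
  have hrep : ∀ l, rep l ∈ Q := by
    intro l
    simp only [rep]
    split_ifs with hl
    · exact hl.choose_spec.1
    · exact hy0
  have hlab : ∀ σ ∈ Q, lab w D R (rep (lab w D R σ)) = lab w D R σ := by
    intro σ hσ
    have hl : ∃ τ ∈ Q, lab w D R τ = lab w D R σ := ⟨σ, hσ, rfl⟩
    simp only [rep, hl, dite_true]
    exact hl.choose_spec.2
  -- block length
  obtain ⟨n, hn, hA⟩ : ∃ n, 0 < n ∧ ∀ l k, (k, rep l) ∈ D → w (k, rep l) - ε ≤ AA n (k, rep l) := by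
    have : ∀ᶠ i in atTop, ∀ l k, (k, rep l) ∈ D → w (k, rep l) - ε ≤ AA (ns i) (k, rep l) := by
      rw [eventually_all]
      intro l
      rw [eventually_all]
      intro k
      by_cases hk : (k, rep l) ∈ D
      · filter_upwards [(tendsto_order.1 (hlim _ (hrep l) k hk)).1 (w (k, rep l) - ε)
          (by linarith)] with i hi _
        exact hi.le
      · exact Eventually.of_forall fun i h => absurd h hk
    obtain ⟨i, hi, hi2⟩ := (this.and (eventually_ge_atTop 1)).exists
    exact ⟨ns i, lt_of_lt_of_le (show 0 < i from hi2) (hns.id_le i), hi⟩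
  -- continuous approximation of the label
  have hν : IsProbabilityMeasure (lam.map Prod.snd) :=
    Measure.isProbabilityMeasure_map measurable_snd.aemeasurable
  obtain ⟨i, hic, E, hEm, hE, hiE⟩ := exists_cont_lab (lam.map Prod.snd) (lab w D R)
    (measurable_lab R hwm hDm) ε hε0
  rw [Measure.map_apply measurable_snd hEm] at hE
  let W : Γ.YY → ℝ := fun y => lv (lab w D R (rep (i y.2)) y.1)
  have hWc : Continuous W := by
    have : Continuous (fun p : Γ.K × (Γ.K → Fin (R + 2)) => lv (lab w D R (rep p.2) p.1)) :=
      continuous_of_discreteTopology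
    exact this.comp (continuous_fst.prodMk (hic.comp continuous_snd))
  have hW0 : ∀ y, 0 ≤ W y := fun y => lv_nonneg _
  have hW1 : ∀ y, |W y| ≤ 1 := fun y => by rw [abs_of_nonneg (hW0 y)]; exact lv_le_one _
  have hWi : Γ.pay p1 σ' - 2 * ε ≤ ∫ y, W y ∂lam := by
    have hEm' : MeasurableSet (Prod.snd ⁻¹' E : Set Γ.YY) := measurable_snd hEm
    have hae : ∀ᵐ y ∂lam, w y ≤ W y + ε + (Prod.snd ⁻¹' E : Set Γ.YY).indicator (fun _ => (1:ℝ)) y ∧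
        |w y| ≤ 1 := by
      filter_upwards [hD, hQae] with y h1 h2
      have h3 := hw01 _ h2 y.1 h1
      refine ⟨?_, by rw [abs_of_nonneg h3.1]; exact h3.2⟩
      by_cases hy : y.2 ∈ E
      · rw [Set.indicator_of_mem (show y ∈ Prod.snd ⁻¹' E from hy)]
        have := hW0 y
        have h4 : w y ≤ 1 := h3.2
        linarith
      · rw [Set.indicator_of_notMem (show y ∉ Prod.snd ⁻¹' E from hy)]
        have h5 := (lv_lab hR h1 h3.1 h3.2).2
        have h6 : W y = lv (lab w D R y.2 y.1) := by
          simp only [W]; rw [hiE _ hy, hlab _ h2]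
        rw [h6]
        have h7 : w (y.1, y.2) = w y := rfl
        rw [h7] at h5
        linarith
    have iw : Integrable w lam := Integrable.of_bound hwm.aestronglyMeasurable 1
      (hae.mono fun y h => h.2)
    have iW : Integrable W lam := Integrable.of_bound hWc.aestronglyMeasurable 1 (ae_of_all _ hW1)
    have iE : Integrable ((Prod.snd ⁻¹' E : Set Γ.YY).indicator fun _ => (1:ℝ)) lam :=
      (integrable_const _).indicator hEm'
    have hle := integral_mono_ae iw ((iW.add (integrable_const ε)).add iE) (hae.mono fun y h => h.1)
    simp only [Pi.add_apply] at hle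
    have iWε : Integrable (fun y => W y + ε) lam := iW.add (integrable_const ε)
    rw [integral_add iWε iE, integral_add iW (integrable_const ε),
      integral_indicator_const _ hEm'] at hle
    simp only [integral_const, probReal_univ, smul_eq_mul, mul_one] at hle
    have : lam.real (Prod.snd ⁻¹' E) ≤ ε := ENNReal.toReal_le_of_le_ofReal hε0.le hE
    linarith
  obtain ⟨m0, hm0⟩ := hocc W hWc ε hε0
  set σ0 := red σ' with hσ0
  have : Finite {hs : List Γ.S // hs.length < n} := List.finite_length_lt _ n
  have : Finite {hs : List Γ.S // hs.length < m0} := List.finite_length_lt _ m0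
  let X := N0 Γ R n ⊕ {hs : List Γ.S // hs.length < m0}
  let cn : Γ.Sg → X := fun σ => Sum.inl (i σ, ⟨[], hn⟩)
  let nd : List Γ.S → X := fun hs => if hl : hs.length < m0 then Sum.inr ⟨hs, hl⟩ else cn (sh σ0 hs)
  let wX : X → Γ.K → ℝ := fun x => match x with
    | Sum.inl a => w0 w D R Q rep n a
    | Sum.inr hs => fun k => (PP^[m0 - hs.1.length] W) (k, sh σ0 hs.1)
  have hwcn : ∀ σ k, wX (cn σ) k = W (k, σ) := by
    intro σ k
    simp only [wX, cn, w0, sp, sh_nil, hrep, if_true, W]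
  have hwnd : ∀ hs : List Γ.S, hs.length ≤ m0 → ∀ k, wX (nd hs) k =
      (PP^[m0 - hs.length] W) (k, sh σ0 hs) := by
    intro hs hl k
    simp only [nd]
    split_ifs with h
    · rfl
    · rw [hwcn, show m0 - hs.length = 0 by omega]; rfl
  let hX : X → Γ.K → ℝ := fun x => match x with
    | Sum.inl a => h0 w D R Q rep n ε a
    | Sum.inr hs => fun _ => - (n : ℝ) - ((m0 - hs.1.length : ℕ) : ℝ)
  have hhnd : ∀ hs : List Γ.S, hs.length ≤ m0 → ∀ k,
      - (n : ℝ) - ((m0 - hs.length : ℕ) : ℝ) ≤ hX (nd hs) k := by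
    intro hs hl k
    simp only [nd]
    split_ifs with h
    · exact le_rfl
    · rw [show m0 - hs.length = 0 by omega, Nat.cast_zero, sub_zero]
      exact h0_ge hε0.le _ _
  let aX : X → Γ.A := fun x => match x with
    | Sum.inl a => sp R rep n a []
    | Sum.inr hs => σ0 hs.1
  let nX : X → Γ.S → X := fun x => match x with
    | Sum.inl a => fun s => Sum.inl (nx0 w D R rep n hn a s)
    | Sum.inr hs => fun s => nd (hs.1 ++ [s])
  let ρ : X → ℕ := fun x => match x with
    | Sum.inl a => 0
    | Sum.inr hs => m0 - hs.1.length
  have c1' : ∀ x, ρ x = 0 → ∀ k y, 0 < Γ.q k (aX x) y → wX x k ≤ wX (nX x y.2) y.1 := by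
    rintro (a | hs) hx k y hy
    · exact core_c1 hn hrep hlab hQ a k y hy
    · have := hs.2
      simp only [ρ] at hx
      omega
  refine ⟨X, Fintype.ofFinite X, ρ, nd [], aX, nX, wX, hX, ε, hε0.le, ?_, ?_, ?_, c1', ?_, ?_⟩
  · rintro (a | hs) s
    · simp [nX, ρ]
    · have := hs.2
      simp only [nX, nd]
      split_ifs with h
      · simp only [ρ, List.length_append, List.length_singleton] at h ⊢; omega
      · simp only [cn, ρ]; omega
  · rintro (a | hs) k
    · exact w0_nonneg _ _
    · exact iter_nonneg hW0 _ _
  · rintro (a | hs) k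
    · calc wX (Sum.inl a) k = ∑ y, Γ.q k (aX (Sum.inl a)) y * wX (Sum.inl a) k := by
            rw [← Finset.sum_mul, Γ.q_sum, one_mul]
        _ ≤ _ := Finset.sum_le_sum fun y _ => by
            rcases (Γ.q_nonneg k (aX (Sum.inl a)) y).eq_or_lt with h | h
            · rw [← h, zero_mul, zero_mul]
            · exact mul_le_mul_of_nonneg_left (c1' (Sum.inl a) rfl k y h) h.le
    · have hl := hs.2
      obtain ⟨r, hr⟩ : ∃ r, m0 - hs.1.length = r + 1 := ⟨m0 - hs.1.length - 1, by omega⟩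
      have e : ∀ y : Γ.ZZ, wX (nX (Sum.inr hs) y.2) y.1 = (PP^[r] W) (sc (k, sh σ0 hs.1) y) := by
        intro y
        simp only [nX]
        rw [hwnd _ (by simp only [List.length_append, List.length_singleton]; omega), sc, sh_sh]
        simp only [List.length_append, List.length_singleton]
        rw [show m0 - (hs.1.length + 1) = r by omega]
      simp only [e]
      simp only [wX]
      rw [hr, Function.iterate_succ_apply']
      refine le_of_eq ?_
      unfold PP qq
      simp only [aX, sh, List.append_nil]
  · rintro (a | hs) k
    · exact core_c2 hR hn hrep hlab hQ hw01 hε0.le hA a k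
    · have hl := hs.2
      have e : - (n : ℝ) - ((m0 - (hs.1.length + 1) : ℕ) : ℝ) ≤
          ∑ y, Γ.q k (aX (Sum.inr hs)) y * hX (nX (Sum.inr hs) y.2) y.1 := by
        calc _ = ∑ y, Γ.q k (aX (Sum.inr hs)) y *
              (- (n : ℝ) - ((m0 - (hs.1.length + 1) : ℕ) : ℝ)) := by
              rw [← Finset.sum_mul, Γ.q_sum, one_mul]
          _ ≤ _ := Finset.sum_le_sum fun y _ => mul_le_mul_of_nonneg_left (by
              have := hhnd (hs.1 ++ [y.2])
                (by simp only [List.length_append, List.length_singleton]; omega) y.1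
              simp only [List.length_append, List.length_singleton] at this
              exact this) (Γ.q_nonneg _ _ _)
      have hwle : wX (Sum.inr hs) k ≤ 1 := (le_abs_self _).trans (iterate_bound W 1 hW1 _ _)
      have hg := Γ.g_nonneg k (aX (Sum.inr hs))
      have hh : hX (Sum.inr hs) k = - (n : ℝ) - ((m0 - (hs.1.length + 1) : ℕ) : ℝ) - 1 := by
        simp only [hX]
        rw [show m0 - hs.1.length = (m0 - (hs.1.length + 1)) + 1 by omega]
        push_cast; ring
      rw [hh]
      linarith
  · have e : ∑ k, p1 k * wX (nd []) k = occ p1 σ0 m0 W := by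
      unfold occ
      refine Finset.sum_congr rfl fun k _ => ?_
      rw [hwnd [] (Nat.zero_le _), List.length_nil, Nat.sub_zero, sh_nil]
    rw [e]
    have : t = Γ.pay p1 σ' - 8 * ε := by rw [hε]; ring
    linarith

end POMDP

namespace POMDP
variable {Γ : POMDP}

/-- Certificates indexed by natural numbers. -/
theorem complete_nat (p1 : Γ.K → ℝ) (hp : IsBelief p1) (t : ℝ) (ht : t < Γ.val p1) :
    ∃ (M0 M i0 : ℕ) (act : ℕ → Γ.A) (next : ℕ → Γ.S → ℕ) (w h : ℕ → Γ.K → ℝ) (η : ℝ),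
      M0 ≤ M ∧ i0 < M ∧ 0 ≤ η ∧ (∀ i < M, ∀ s, next i s < max i M0) ∧
      (∀ i k, 0 ≤ w i k) ∧
      (∀ i < M, ∀ k, w i k ≤ ∑ y, Γ.q k (act i) y * w (next i y.2) y.1) ∧
      (∀ i < M0, ∀ k y, 0 < Γ.q k (act i) y → w i k ≤ w (next i y.2) y.1) ∧
      (∀ i < M, ∀ k, w i k + h i k ≤ Γ.g k (act i) + η +
        ∑ y, Γ.q k (act i) y * h (next i y.2) y.1) ∧
      t < ∑ k, p1 k * w i0 k - η := by
  classical
  obtain ⟨X, _, ρ, x0, ac, nx, w, h, η, hη, hρ, hw, c1, c1', c2, hfin⟩ := complete p1 hp t ht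
  let M := Fintype.card X
  let e := Fintype.equivFin X
  let f : Fin M → ℕ := fun j => ρ (e.symm j)
  let S := Tuple.sort f
  have hS : Monotone (f ∘ S) := Tuple.monotone_sort f
  let M0 := (Finset.univ.filter fun j : Fin M => (f ∘ S) j ≤ 0).card
  let idx : X → ℕ := fun x => (S.symm (e x)).1
  let nd : ℕ → X := fun j => if hj : j < M then e.symm (S ⟨j, hj⟩) else x0
  have hidx : ∀ x, idx x < M := fun x => (S.symm (e x)).2
  have hnd : ∀ x, nd (idx x) = x := by
    intro x
    simp only [nd, hidx x, dite_true]
    simp [idx]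
  have hM0 : ∀ x, idx x < M0 ↔ ρ x = 0 := by
    intro x
    have := Tuple.lt_card_le_iff_apply_le_of_monotone (a := 0) (j := S.symm (e x)) hS
    rw [← Nat.le_zero]
    simpa [f, idx, M0] using this
  have hin : ∀ j < M, idx (nd j) = j := by
    intro j hj
    simp [nd, hj, idx]
  have hlt : ∀ x y, ρ x < ρ y → idx x < idx y := by
    intro x y hxy
    by_contra hcon
    push Not at hcon
    have := hS (show S.symm (e y) ≤ S.symm (e x) from hcon)
    simp [f] at this
    omega
  have hM0M : M0 ≤ M := by
    refine (Finset.card_filter_le _ _).trans ?_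
    simp
  refine ⟨M0, M, idx x0, fun i => ac (nd i), fun i s => idx (nx (nd i) s), fun i => w (nd i),
    fun i => h (nd i), η, hM0M, hidx _, hη, ?_, fun i k => hw _ _, ?_, ?_, ?_, ?_⟩
  · intro i hi s
    have h1 := hρ (nd i) s
    have h2 := hin i hi
    by_cases hz : ρ (nd i) = 0
    · refine lt_max_of_lt_right ((hM0 _).2 ?_)
      rw [hz] at h1; simpa using h1
    · refine lt_max_of_lt_left ?_
      rw [← h2]
      refine hlt _ _ ?_
      rw [h2]
      omega
  · intro i _ k
    simp only [hnd]
    exact c1 _ k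
  · intro i hi k y hy
    simp only [hnd]
    refine c1' _ ((hM0 _).1 ?_) k y hy
    rw [hin i (hi.trans_le hM0M)]; exact hi
  · intro i _ k
    simp only [hnd]
    exact c2 _ k
  · simp only [hnd]; exact hfin

end POMDP

/-- Integer certificates. -/
def CertOK (nK nA nS : ℕ) (Q : ℕ → ℕ → ℕ → ℕ → ℕ) (G : ℕ → ℕ → ℕ) (P : ℕ → ℕ) (X D : ℕ)
    (M M0 i0 e : ℕ) (act : ℕ → ℕ) (next W H : ℕ → ℕ → ℕ) : Prop :=
  M0 ≤ M ∧ i0 < M ∧ (∀ i < M, act i < nA) ∧ (∀ i < M, ∀ s < nS, next i s < max i M0) ∧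
  (∀ i < M, ∀ k < nK, D * W i k ≤ ∑ k' ∈ Finset.range nK, ∑ s ∈ Finset.range nS,
    Q k (act i) k' s * W (next i s) k') ∧
  (∀ i < M0, ∀ k < nK, ∀ k' < nK, ∀ s < nS, 0 < Q k (act i) k' s → W i k ≤ W (next i s) k') ∧
  (∀ i < M, ∀ k < nK, D * (W i k + H i k) ≤ D * (G k (act i) + e) +
    ∑ k' ∈ Finset.range nK, ∑ s ∈ Finset.range nS, Q k (act i) k' s * H (next i s) k') ∧
  D * (X + e) < ∑ k ∈ Finset.range nK, P k * W i0 k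

lemma sum_conv {nK nS : ℕ} (F : ℕ → ℕ → ℝ) :
    ∑ k' ∈ Finset.range nK, ∑ s ∈ Finset.range nS, F k' s =
      ∑ y : Fin nK × Fin nS, F y.1 y.2 := by
  rw [Fintype.sum_prod_type, Finset.sum_range]
  simp only [Finset.sum_range]

section cert
variable (Γ : POMDP) (p1 : Γ.K → ℝ) (Q : ℕ → ℕ → ℕ → ℕ → ℕ) (G : ℕ → ℕ → ℕ) (P : ℕ → ℕ)

theorem cert_sound (hp : IsBelief p1) (X D : ℕ) (hD : 0 < D)
    (hQ : ∀ (k : Γ.K) (a : Γ.A) (y : Γ.K × Γ.S), (Q k a y.1 y.2 : ℝ) = Γ.q k a y * D)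
    (hG : ∀ (k : Γ.K) (a : Γ.A), (G k a : ℝ) = Γ.g k a * D)
    (hP : ∀ k : Γ.K, (P k : ℝ) = p1 k * D)
    (M M0 i0 e : ℕ) (act : ℕ → ℕ) (next W H : ℕ → ℕ → ℕ)
    (h : CertOK Γ.nK Γ.nA Γ.nS Q G P X D M M0 i0 e act next W H) :
    (X : ℝ) / D < Γ.val p1 := by
  obtain ⟨hM, hi0, hact, hnext, c1, c1', c2, c3⟩ := h
  have hD' : (0 : ℝ) < D := by exact_mod_cast hD
  let act' : ℕ → Γ.A := fun i => if hi : act i < Γ.nA then ⟨act i, hi⟩ else ⟨0, Γ.hA⟩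
  have ha : ∀ i < M, ((act' i : Γ.A) : ℕ) = act i := by
    intro i hi
    simp [act', hact i hi]
  have hQ' : ∀ i < M, ∀ (k : Γ.K) (y : Γ.K × Γ.S), (Q k (act i) y.1 y.2 : ℝ) =
      Γ.q k (act' i) y * D := fun i hi k y => by rw [← ha i hi]; exact hQ k (act' i) y
  have key := Γ.sound p1 hp M0 M i0 hM hi0 act' (fun i s => next i s)
    (fun i hi s => hnext i hi s s.2) (fun i k => (W i k : ℝ) / D) (fun i k => (H i k : ℝ) / D)
    (e / D) ?_ ?_ ?_
  · refine lt_of_lt_of_le ?_ key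
    have c3' : (D : ℝ) * (X + e) < ∑ k ∈ Finset.range Γ.nK, (P k : ℝ) * W i0 k := by
      exact_mod_cast c3
    rw [Finset.sum_range] at c3'
    simp only [hP] at c3'
    have e1 : ∑ k : Γ.K, p1 k * (D : ℝ) * W i0 k = D * D * ∑ k : Γ.K, p1 k * ((W i0 k : ℝ) / D) := by
      rw [Finset.mul_sum]
      refine Finset.sum_congr rfl fun k _ => ?_
      field_simp
    rw [e1, mul_assoc] at c3'
    have c4 := lt_of_mul_lt_mul_left c3' hD'.le
    rw [lt_sub_iff_add_lt, ← add_div, div_lt_iff₀ hD']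
    linarith
  · intro i hi k
    have c : (D : ℝ) * W i k ≤ ∑ k' ∈ Finset.range Γ.nK, ∑ s ∈ Finset.range Γ.nS,
      (Q k (act i) k' s : ℝ) * W (next i s) k' := by exact_mod_cast c1 i hi k k.2
    rw [sum_conv (fun k' s => (Q k (act i) k' s : ℝ) * W (next i s) k')] at c
    simp only [hQ' i hi] at c
    have e1 : ∑ y : Γ.K × Γ.S, Γ.q k (act' i) y * (D : ℝ) * W (next i y.2) y.1 =
        D * D * ∑ y : Γ.K × Γ.S, Γ.q k (act' i) y * ((W (next i y.2) y.1 : ℝ) / D) := by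
      rw [Finset.mul_sum]
      refine Finset.sum_congr rfl fun y _ => ?_
      field_simp
    rw [e1, mul_assoc] at c
    have c4 := le_of_mul_le_mul_left c hD'
    rw [div_le_iff₀ hD']
    linarith
  · intro i hi k y hy
    have := c1' i hi k k.2 y.1 y.1.2 y.2 y.2.2 (by
      have h2 := hQ' i (hi.trans_le hM) k y
      have : (0 : ℝ) < Q k (act i) y.1 y.2 := by rw [h2]; positivity
      exact_mod_cast this)
    have h3 : (W i k : ℝ) ≤ W (next i y.2) y.1 := by exact_mod_cast this
    exact div_le_div_of_nonneg_right h3 hD'.le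
  · intro i hi k
    have c : (D : ℝ) * (W i k + H i k) ≤ D * (G k (act i) + e) +
      ∑ k' ∈ Finset.range Γ.nK, ∑ s ∈ Finset.range Γ.nS,
      (Q k (act i) k' s : ℝ) * H (next i s) k' := by exact_mod_cast c2 i hi k k.2
    rw [sum_conv (fun k' s => (Q k (act i) k' s : ℝ) * H (next i s) k')] at c
    simp only [hQ' i hi] at c
    have e1 : ∑ y : Γ.K × Γ.S, Γ.q k (act' i) y * (D : ℝ) * H (next i y.2) y.1 =
        D * D * ∑ y : Γ.K × Γ.S, Γ.q k (act' i) y * ((H (next i y.2) y.1 : ℝ) / D) := by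
      rw [Finset.mul_sum]
      refine Finset.sum_congr rfl fun y _ => ?_
      field_simp
    rw [e1, mul_assoc, ← mul_add] at c
    have c4 := le_of_mul_le_mul_left c hD'
    have hG' : (G k (act i) : ℝ) = Γ.g k (act' i) * D := by rw [← ha i hi]; exact hG k (act' i)
    rw [hG'] at c4
    rw [← add_div, div_le_iff₀ hD', add_mul, add_mul, div_mul_cancel₀ _ hD'.ne']
    linarith

theorem cert_complete (hp : IsBelief p1) (t : ℝ) (ht : t < Γ.val p1) :
    ∃ T : ℕ, ∀ (D X : ℕ) (Q : ℕ → ℕ → ℕ → ℕ → ℕ) (G : ℕ → ℕ → ℕ) (P : ℕ → ℕ),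
    T ≤ D → 0 < D → (X : ℝ) = t * D →
    (∀ (k : Γ.K) (a : Γ.A) (y : Γ.K × Γ.S), (Q k a y.1 y.2 : ℝ) = Γ.q k a y * D) →
    (∀ (k : Γ.K) (a : Γ.A), (G k a : ℝ) = Γ.g k a * D) →
    (∀ k : Γ.K, (P k : ℝ) = p1 k * D) →
    ∃ (M M0 i0 e : ℕ) (act : ℕ → ℕ) (next W H : ℕ → ℕ → ℕ),
    CertOK Γ.nK Γ.nA Γ.nS Q G P X D M M0 i0 e act next W H := by
  classical
  obtain ⟨M0, M, i0, act, next, w, h, η, hM, hi0, hη, hnext, hw, c1, c1', c2, c3⟩ :=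
    Γ.complete_nat p1 hp t ht
  obtain ⟨c, hc⟩ : ∃ c : ℝ, ∀ i < M, ∀ k, 0 ≤ h i k + c := by
    refine ⟨∑ i ∈ Finset.range M, ∑ k, |h i k|, fun i hi k => ?_⟩
    have h1 : |h i k| ≤ ∑ k, |h i k| :=
      Finset.single_le_sum (f := fun k => |h i k|) (fun _ _ => abs_nonneg _) (Finset.mem_univ k)
    have h2 : ∑ k, |h i k| ≤ ∑ i ∈ Finset.range M, ∑ k, |h i k| :=
      Finset.single_le_sum (f := fun i => ∑ k, |h i k|)
        (fun _ _ => Finset.sum_nonneg fun _ _ => abs_nonneg _) (Finset.mem_range.2 hi)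
    have := neg_abs_le (h i k)
    linarith
  obtain ⟨T, hT⟩ := exists_nat_gt (((M : ℝ) + 3) / (∑ k, p1 k * w i0 k - η - t))
  have hgap : 0 < ∑ k, p1 k * w i0 k - η - t := by linarith
  rw [div_lt_iff₀ hgap] at hT
  refine ⟨T, fun D X Q G P hTD hD hX hQ hG hP => ?_⟩
  have hD' : (0 : ℝ) < D := by exact_mod_cast hD
  let off : ℕ → ℕ := fun i => if i < M0 then 0 else i + 1
  let W' : ℕ → Γ.K → ℕ := fun i k => ⌊D * w i k - off i⌋₊
  let H' : ℕ → Γ.K → ℕ := fun i k => ⌊D * (h i k + c)⌋₊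
  let W : ℕ → ℕ → ℕ := fun i k => if hk : k < Γ.nK then W' i ⟨k, hk⟩ else 0
  let H : ℕ → ℕ → ℕ := fun i k => if hk : k < Γ.nK then H' i ⟨k, hk⟩ else 0
  let nx : ℕ → ℕ → ℕ := fun i s => if hs : s < Γ.nS then next i ⟨s, hs⟩ else 0
  have eW : ∀ i (k : Γ.K), W i k = W' i k := fun i k => by simp [W]
  have eH : ∀ i (k : Γ.K), H i k = H' i k := fun i k => by simp [H]
  have en : ∀ i (s : Γ.S), nx i s = next i s := fun i s => by simp [nx]
  have hWle : ∀ i k, (W' i k : ℝ) ≤ D * w i k := by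
    intro i k
    have h0 : 0 ≤ D * w i k := mul_nonneg hD'.le (hw i k)
    refine (Nat.cast_le.2 (Nat.floor_mono (sub_le_self _ (Nat.cast_nonneg _)))).trans
      (Nat.floor_le h0)
  have hWge : ∀ i k, D * w i k - off i - 1 < W' i k := by
    intro i k
    have := Nat.lt_floor_add_one (D * w i k - off i)
    simp only [W']
    linarith
  have hHge : ∀ i k, D * (h i k + c) - 1 < H' i k := by
    intro i k
    have := Nat.lt_floor_add_one (D * (h i k + c))
    simp only [H']
    linarith
  have hHle : ∀ i < M, ∀ k, (H' i k : ℝ) ≤ D * (h i k + c) := fun i hi k =>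
    Nat.floor_le (mul_nonneg hD'.le (hc i hi k))
  have hc1' : ∀ i < M0, ∀ k y, 0 < Γ.q k (act i) y → W' i k ≤ W' (next i y.2) y.1 := by
    intro i hi k y hy
    have h1 := c1' i hi k y hy
    have h2 := hnext i (hi.trans_le hM) y.2
    rw [max_eq_right hi.le] at h2
    refine Nat.floor_mono ?_
    simp only [off, hi, h2, if_true]
    have := mul_le_mul_of_nonneg_left h1 hD'.le
    linarith
  have hc1 : ∀ i < M, ∀ k, (W' i k : ℝ) ≤
      ∑ y, Γ.q k (act i) y * W' (next i y.2) y.1 := by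
    intro i hi k
    by_cases hiM : i < M0
    · calc (W' i k : ℝ) = ∑ y, Γ.q k (act i) y * W' i k := by
            rw [← Finset.sum_mul, Γ.q_sum, one_mul]
        _ ≤ _ := by
            refine Finset.sum_le_sum fun y _ => ?_
            rcases (Γ.q_nonneg k (act i) y).eq_or_lt with h0 | h0
            · rw [← h0]; simp
            · exact mul_le_mul_of_nonneg_left (by exact_mod_cast hc1' i hiM k y h0) h0.le
    · rcases lt_or_ge (D * w i k - off i) 0 with hn | hn
      · have : W' i k = 0 := Nat.floor_of_nonpos hn.le
        rw [this]
        simp only [Nat.cast_zero]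
        exact Finset.sum_nonneg fun y _ => mul_nonneg (Γ.q_nonneg _ _ _) (Nat.cast_nonneg _)
      · refine (Nat.floor_le hn).trans ?_
        have h1 : ∑ y, Γ.q k (act i) y * (D * w (next i y.2) y.1 - off i) ≤
            ∑ y, Γ.q k (act i) y * W' (next i y.2) y.1 := by
          refine Finset.sum_le_sum fun y _ =>
            mul_le_mul_of_nonneg_left ?_ (Γ.q_nonneg _ _ _)
          have h2 := hWge (next i y.2) y.1
          have h3 := hnext i hi y.2
          rw [max_eq_left (not_lt.1 hiM)] at h3
          have h4 : off (next i y.2) + 1 ≤ off i := by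
            simp only [off, hiM, if_false]
            split_ifs <;> omega
          have h5 : (off (next i y.2) : ℝ) + 1 ≤ off i := by exact_mod_cast h4
          linarith
        refine le_trans ?_ h1
        have h6 : ∑ y, Γ.q k (act i) y * (D * w (next i y.2) y.1 - off i) =
            D * ∑ y, Γ.q k (act i) y * w (next i y.2) y.1 - off i := by
          simp only [mul_sub, Finset.sum_sub_distrib]
          rw [← Finset.sum_mul, Γ.q_sum, one_mul, Finset.mul_sum]
          congr 1
          exact Finset.sum_congr rfl fun y _ => by ring
        rw [h6]
        have := mul_le_mul_of_nonneg_left (c1 i hi k) hD'.le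
        linarith
  have he : (D : ℝ) * η + 1 ≤ (⌈D * η⌉₊ + 1 : ℕ) := by
    push_cast
    have := Nat.le_ceil (D * η)
    linarith
  have he2 : ((⌈D * η⌉₊ + 1 : ℕ) : ℝ) < D * η + 2 := by
    push_cast
    have := Nat.ceil_lt_add_one (mul_nonneg hD'.le hη)
    linarith
  have hsum : ∀ (V : ℕ → ℕ → ℕ) (V' : ℕ → Γ.K → ℕ), (∀ i (k : Γ.K), V i k = V' i k) →
      ∀ i (k : Γ.K), ((∑ k' ∈ Finset.range Γ.nK, ∑ s ∈ Finset.range Γ.nS,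
        Q k (act i) k' s * V (nx i s) k' : ℕ) : ℝ) =
        D * ∑ y, Γ.q k (act i) y * V' (next i y.2) y.1 := by
    intro V V' hV i k
    push_cast
    rw [sum_conv (fun k' s => (Q k (act i) k' s : ℝ) * V (nx i s) k'), Finset.mul_sum]
    refine Finset.sum_congr rfl fun y _ => ?_
    simp only [hQ, hV, en]
    ring
  refine ⟨M, M0, i0, ⌈D * η⌉₊ + 1, fun i => act i, nx, W, H, hM, hi0, fun i _ => (act i).2,
    ?_, ?_, ?_, ?_, ?_⟩
  · intro i hi s hs
    simp only [nx, hs, dite_true]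
    exact hnext i hi ⟨s, hs⟩
  · intro i hi k hk
    have := hsum W W' eW i ⟨k, hk⟩
    simp only at this
    rw [← Nat.cast_le (α := ℝ), this]
    push_cast
    rw [eW i ⟨k, hk⟩]
    exact mul_le_mul_of_nonneg_left (hc1 i hi ⟨k, hk⟩) hD'.le
  · intro i hi k hk k' hk' s hs hpos
    have h1 := hQ ⟨k, hk⟩ (act i) (⟨k', hk'⟩, ⟨s, hs⟩)
    have h2 : 0 < Γ.q ⟨k, hk⟩ (act i) (⟨k', hk'⟩, ⟨s, hs⟩) := by
      have h3 : (0 : ℝ) < Q k (act i) k' s := by exact_mod_cast hpos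
      simp only at h1
      rw [h1] at h3
      exact pos_of_mul_pos_left h3 hD'.le
    have h4 := hc1' i hi _ _ h2
    have e1 := eW i ⟨k, hk⟩
    have e2 := eW (nx i s) ⟨k', hk'⟩
    have e3 := en i ⟨s, hs⟩
    simp only at e1 e2 e3 h4
    rw [e1, e2, e3]
    exact h4
  · intro i hi k hk
    have := hsum H H' eH i ⟨k, hk⟩
    simp only at this
    rw [← Nat.cast_le (α := ℝ), Nat.cast_add, this, Nat.cast_mul, Nat.cast_mul, ← mul_add]
    refine mul_le_mul_of_nonneg_left ?_ hD'.le
    rw [Nat.cast_add, Nat.cast_add, eW i ⟨k, hk⟩, eH i ⟨k, hk⟩]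
    have hg := hG ⟨k, hk⟩ (act i)
    simp only at hg
    rw [hg]
    have h1 := hWle i ⟨k, hk⟩
    have h2 := hHle i hi ⟨k, hk⟩
    have h3 := mul_le_mul_of_nonneg_left (c2 i hi ⟨k, hk⟩) hD'.le
    have h4 : ∑ y, Γ.q ⟨k, hk⟩ (act i) y * (D * (h (next i y.2) y.1 + c) - 1) ≤
        ∑ y, Γ.q ⟨k, hk⟩ (act i) y * H' (next i y.2) y.1 :=
      Finset.sum_le_sum fun y _ =>
        mul_le_mul_of_nonneg_left (hHge _ _).le (Γ.q_nonneg _ _ _)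
    have h5 : ∑ y, Γ.q ⟨k, hk⟩ (act i) y * (D * (h (next i y.2) y.1 + c) - 1) =
        D * ∑ y, Γ.q ⟨k, hk⟩ (act i) y * h (next i y.2) y.1 + (D * c - 1) := by
      have : ∀ y, Γ.q ⟨k, hk⟩ (act i) y * (D * (h (next i y.2) y.1 + c) - 1) =
        D * (Γ.q ⟨k, hk⟩ (act i) y * h (next i y.2) y.1) +
          Γ.q ⟨k, hk⟩ (act i) y * (D * c - 1) := fun y => by ring
      simp only [this, Finset.sum_add_distrib]
      rw [← Finset.sum_mul, Γ.q_sum, one_mul, Finset.mul_sum]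
    rw [h5] at h4
    linarith
  · rw [← Nat.cast_lt (α := ℝ), Nat.cast_mul, Nat.cast_add, hX, Nat.cast_sum, Finset.sum_range]
    simp only [Nat.cast_mul, hP, eW]
    have h1 : ∑ k, p1 k * (D * w i0 k - (M + 1)) ≤ ∑ k, p1 k * W' i0 k := by
      refine Finset.sum_le_sum fun k _ => mul_le_mul_of_nonneg_left ?_ (hp.1 k)
      have h2 := hWge i0 k
      have h3 : off i0 ≤ M := by
        simp only [off]
        split_ifs <;> omega
      have h4 : (off i0 : ℝ) ≤ M := by exact_mod_cast h3
      linarith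
    have h2 : ∑ k, p1 k * (D * w i0 k - (M + 1)) = D * ∑ k, p1 k * w i0 k - (M + 1) := by
      simp only [mul_sub, Finset.sum_sub_distrib]
      rw [← Finset.sum_mul, hp.2, one_mul, Finset.mul_sum]
      congr 1
      exact Finset.sum_congr rfl fun y _ => by ring
    rw [h2] at h1
    have h3 : ∑ k, p1 k * (D : ℝ) * W' i0 k = D * ∑ k, p1 k * (W' i0 k : ℝ) := by
      rw [Finset.mul_sum]
      exact Finset.sum_congr rfl fun y _ => by ring
    rw [h3]
    refine mul_lt_mul_of_pos_left ?_ hD'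
    have h4 : (T : ℝ) ≤ D := by exact_mod_cast hTD
    have h5 := mul_le_mul_of_nonneg_right h4 hgap.le
    have h6 : (D : ℝ) * (∑ k, p1 k * w i0 k - η - t) = D * ∑ k, p1 k * w i0 k - D * η - t * D := by
      ring
    linarith

end cert

section enc
open Encodable

/-- Code of a finite array. -/
def encFin (n : ℕ) (f : ℕ → ℕ) : ℕ := encode ((List.range n).map fun i => Nat.pair i (f i))

lemma encode_list_eq {α : Type*} [Encodable α] (l : List α) :
    encode l = encode (l.map encode) := by
  induction l with
  | nil => rfl
  | cons a l ih => simp [ih]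

lemma encode_finPi {β : Type*} [Encodable β] (n : ℕ) (f : Fin n → β) (F : ℕ → ℕ)
    (hF : ∀ i : Fin n, F i = encode (f i)) : encode f = encFin n F := by
  have h1 : encode f = encode (List.ofFn fun i : Fin n => (⟨i, f i⟩ : Σ _ : Fin n, β)) := by
    rw [← List.Vector.toList_ofFn]
    refine Eq.trans ?_ (Subtype.encode_eq _)
    rfl
  rw [h1, encode_list_eq, encFin]
  congr 1
  apply List.ext_getElem
  · simp
  · intro i h1 h2
    simp at h1
    have h3 := hF ⟨i, h1⟩
    simp only at h3
    simp only [List.getElem_map, List.getElem_ofFn, List.getElem_range, encode_sigma_val, h3]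
    rfl

lemma fintypeEquivFin_symm_lt {α : Type*} [Fintype α] [Encodable α]
    (i j : Fin (Fintype.card α)) (h : i < j) :
    encode ((fintypeEquivFin (α := α)).symm i) < encode (fintypeEquivFin.symm j) := by
  have key : ∀ i : Fin (Fintype.card α), (fintypeEquivFin (α := α)).symm i =
      (sortedUniv α)[(i : ℕ)]'(by rw [length_sortedUniv]; exact i.2) := by
    intro i
    have aux : ∀ (a b : ℕ) (h : a = b) (i : Fin b),
        (((Equiv.cast (congr_arg Fin h)).symm i : Fin a) : ℕ) = i := by
      intro a b h i
      subst h
      rfl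
    simp only [fintypeEquivFin, Equiv.symm_trans_apply, Equiv.symm_symm,
      List.Nodup.getEquivOfForallMemList_apply, List.get_eq_getElem]
    congr 1
    exact aux _ _ (length_sortedUniv α) _
  rw [key, key]
  have hs : List.Pairwise (Encodable.encode' α ⁻¹'o (· ≤ ·)) (sortedUniv α) :=
    Finset.pairwise_sort _ _
  have h1 := List.pairwise_iff_getElem.1 hs i j (by rw [length_sortedUniv]; exact i.2)
    (by rw [length_sortedUniv]; exact j.2) h
  refine lt_of_le_of_ne h1 fun heq => ?_
  have := (List.Nodup.getElem_inj_iff (sortedUniv_nodup α)).1 (encode_injective heq)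
  omega

lemma fintypeEquivFin_unique {α : Type*} [Fintype α] [Encodable α]
    (φ : Fin (Fintype.card α) → α) (h : ∀ i j, i < j → encode (φ i) < encode (φ j)) :
    φ = (fintypeEquivFin (α := α)).symm := by
  have h1 : StrictMono (fun i => encode (φ i)) := fun i j hij => h i j hij
  have h2 : StrictMono (fun i => encode ((fintypeEquivFin (α := α)).symm i)) :=
    fun i j hij => fintypeEquivFin_symm_lt i j hij
  have hinj : Function.Injective φ := fun i j hij => h1.injective (by simp [hij])
  have hsurj : Function.Surjective φ :=
    (Fintype.bijective_iff_injective_and_card φ).2 ⟨hinj, by simp⟩ |>.2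
  have := (StrictMono.range_inj h1 h2).1 (by
    ext n
    constructor
    · rintro ⟨i, rfl⟩
      exact ⟨fintypeEquivFin (φ i), by simp⟩
    · rintro ⟨i, rfl⟩
      obtain ⟨j, hj⟩ := hsurj (fintypeEquivFin.symm i)
      exact ⟨j, by simp [hj]⟩)
  funext i
  exact encode_injective (congrFun this i)

lemma encode_arrow {α β : Type*} [Fintype α] [Encodable α] [Encodable β] (f : α → β) (N : ℕ)
    (F : ℕ → ℕ) (hN : N = Fintype.card α)
    (hF : ∀ j (hj : j < Fintype.card α), F j = encode (f (fintypeEquivFin.symm ⟨j, hj⟩))) :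
    @encode _ fintypeArrowOfEncodable f = encFin N F := by
  subst hN
  have : @encode _ fintypeArrowOfEncodable f =
    encode (fun i => f ((fintypeEquivFin (α := α)).symm i)) := rfl
  rw [this]
  exact encode_finPi _ _ F fun i => hF i i.2

lemma encode_rat (r : ℚ) : encode r = Nat.pair (encode r.num) r.den := rfl

lemma encode_int_nat (m : ℕ) : encode (m : ℤ) = 2 * m := rfl
lemma encode_int_neg (m : ℕ) : encode (-((m + 1 : ℕ) : ℤ)) = 2 * m + 1 := rfl

/-- Computation of the gcd by bounded search. -/
def gcdP (m D : ℕ) : ℕ := Nat.findGreatest (fun j => m % j = 0 ∧ D % j = 0) D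

lemma gcdP_eq (m D : ℕ) (hD : 0 < D) : gcdP m D = Nat.gcd m D := by
  rw [gcdP, Nat.findGreatest_eq_iff]
  refine ⟨Nat.gcd_le_right _ hD, fun _ => ⟨Nat.mod_eq_zero_of_dvd (Nat.gcd_dvd_left _ _),
    Nat.mod_eq_zero_of_dvd (Nat.gcd_dvd_right _ _)⟩, ?_⟩
  rintro j hj _ ⟨h1, h2⟩
  have := Nat.le_of_dvd (Nat.gcd_pos_of_pos_right _ hD)
    (Nat.dvd_gcd (Nat.dvd_of_mod_eq_zero h1) (Nat.dvd_of_mod_eq_zero h2))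
  omega

/-- Code of `m / D`. -/
def ratEnc (m D : ℕ) : ℕ := Nat.pair (2 * (m / gcdP m D)) (D / gcdP m D)
/-- Code of `- m / D`. -/
def ratEncNeg (m D : ℕ) : ℕ := Nat.pair (2 * (m / gcdP m D - 1) + 1) (D / gcdP m D)

lemma num_den_div (m D : ℕ) (hD : 0 < D) : ((m : ℚ) / D).num = (m / Nat.gcd m D : ℕ) ∧
    ((m : ℚ) / D).den = D / Nat.gcd m D := by
  have hg : 0 < Nat.gcd m D := Nat.gcd_pos_of_pos_right _ hD
  have h0 : 0 < D / Nat.gcd m D := Nat.div_pos (Nat.gcd_le_right _ hD) hg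
  have hc : Nat.Coprime (m / Nat.gcd m D) (D / Nat.gcd m D) := Nat.coprime_div_gcd_div_gcd hg
  have h1 : ((m : ℚ) / D) = (((m / Nat.gcd m D : ℕ) : ℤ) : ℚ) / ((D / Nat.gcd m D : ℕ) : ℤ) := by
    have hg' : ((Nat.gcd m D : ℕ) : ℚ) ≠ 0 := by exact_mod_cast hg.ne'
    rw [Int.cast_natCast, Int.cast_natCast, Nat.cast_div (Nat.gcd_dvd_left m D) hg',
      Nat.cast_div (Nat.gcd_dvd_right m D) hg', div_div_div_cancel_right₀ hg']
  rw [h1]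
  refine ⟨Rat.num_div_eq_of_coprime (by exact_mod_cast h0) (by rw [Int.natAbs_natCast, Int.natAbs_natCast]; exact hc), ?_⟩
  have := Rat.den_div_eq_of_coprime (a := ((m / Nat.gcd m D : ℕ) : ℤ))
    (b := ((D / Nat.gcd m D : ℕ) : ℤ)) (by exact_mod_cast h0) (by rw [Int.natAbs_natCast, Int.natAbs_natCast]; exact hc)
  exact_mod_cast this

lemma encode_ratEnc (m D : ℕ) (hD : 0 < D) : encode ((m : ℚ) / D) = ratEnc m D := by
  obtain ⟨h1, h2⟩ := num_den_div m D hD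
  rw [encode_rat, h1, h2, encode_int_nat, ratEnc, gcdP_eq m D hD]

lemma encode_ratEncNeg (m D : ℕ) (hm : 0 < m) (hD : 0 < D) :
    encode (-((m : ℚ) / D)) = ratEncNeg m D := by
  obtain ⟨h1, h2⟩ := num_den_div m D hD
  have h3 : 0 < m / Nat.gcd m D := Nat.div_pos (Nat.gcd_le_left _ hm) (Nat.gcd_pos_of_pos_left _ hm)
  obtain ⟨l, hl⟩ := Nat.exists_eq_succ_of_ne_zero h3.ne'
  rw [encode_rat, Rat.neg_num, Rat.neg_den, h1, h2, ratEncNeg, gcdP_eq m D hD, hl, Nat.succ_eq_add_one,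
    encode_int_neg]
  simp

/-- Code of a rational instance. -/
def encData (nK nA nS : ℕ) (u v : ℕ → ℕ) (Q : ℕ → ℕ → ℕ → ℕ → ℕ) (G : ℕ → ℕ → ℕ) (P : ℕ → ℕ)
    (D xc : ℕ) : ℕ :=
  Nat.pair (Nat.pair nK (Nat.pair nA nS)) (Nat.pair
    (encFin nK fun k => encFin nA fun a => encFin (nK * nS) fun j => ratEnc (Q k a (u j) (v j)) D)
    (Nat.pair (encFin nK fun k => encFin nA fun a => ratEnc (G k a) D)
      (Nat.pair (encFin nK fun k => ratEnc (P k) D) xc)))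

/-- `u, v` enumerate the pairs in increasing order of code. -/
def EnumOK (nK nS : ℕ) (u v : ℕ → ℕ) : Prop :=
  (∀ j < nK * nS, u j < nK) ∧ (∀ j < nK * nS, v j < nS) ∧
  (∀ j < nK * nS, ∀ i < j, Nat.pair (u i) (v i) < Nat.pair (u j) (v j))

lemma exists_enum (nK nS : ℕ) : ∃ u v : ℕ → ℕ, EnumOK nK nS u v := by
  have hc : Fintype.card (Fin nK × Fin nS) = nK * nS := by simp
  let φ : ∀ j, j < nK * nS → Fin nK × Fin nS :=
    fun j hj => (fintypeEquivFin (α := Fin nK × Fin nS)).symm ⟨j, by rw [hc]; exact hj⟩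
  refine ⟨fun j => if hj : j < nK * nS then (φ j hj).1 else 0,
    fun j => if hj : j < nK * nS then (φ j hj).2 else 0, ?_, ?_, ?_⟩
  · intro j hj
    simp only [hj, dite_true]
    exact (φ j hj).1.2
  · intro j hj
    simp only [hj, dite_true]
    exact (φ j hj).2.2
  · intro j hj i hij
    have hi := hij.trans hj
    simp only [hj, hi, dite_true]
    exact fintypeEquivFin_symm_lt (α := Fin nK × Fin nS) ⟨i, by rw [hc]; exact hi⟩
      ⟨j, by rw [hc]; exact hj⟩ hij

lemma encode_data (d : RatData) (u v : ℕ → ℕ) (Q : ℕ → ℕ → ℕ → ℕ → ℕ) (G : ℕ → ℕ → ℕ)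
    (P : ℕ → ℕ) (D xc : ℕ) (hD : 0 < D) (huv : EnumOK d.nK d.nS u v)
    (hQ : ∀ k a y, d.q k a y = (Q k a y.1 y.2 : ℚ) / D)
    (hG : ∀ k a, d.g k a = (G k a : ℚ) / D) (hP : ∀ k, d.p1 k = (P k : ℚ) / D)
    (hx : encode d.x = xc) :
    encode d = encData d.nK d.nA d.nS u v Q G P D xc := by
  have hc : Fintype.card (Fin d.nK × Fin d.nS) = d.nK * d.nS := by simp
  have h0 : encode d = Nat.pair (Nat.pair d.nK (Nat.pair d.nA d.nS))
      (Nat.pair (encode d.q) (Nat.pair (encode d.g) (Nat.pair (encode d.p1) (encode d.x)))) := rfl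
  have huv2 := fintypeEquivFin_unique (α := Fin d.nK × Fin d.nS)
    (fun j => (⟨u j, huv.1 j (by rw [← hc]; exact j.2)⟩, ⟨v j, huv.2.1 j (by rw [← hc]; exact j.2)⟩))
    (fun i j hij => huv.2.2 j (by rw [← hc]; exact j.2) i hij)
  have e1 : encode d.q = encFin d.nK fun k => encFin d.nA fun a =>
      encFin (d.nK * d.nS) fun j => ratEnc (Q k a (u j) (v j)) D := by
    refine encode_finPi _ _ _ fun k => Eq.symm ?_
    refine encode_finPi _ _ _ fun a => Eq.symm ?_
    refine encode_arrow _ _ _ hc.symm fun j hj => ?_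
    rw [← huv2, hQ, encode_ratEnc _ _ hD]
  have e2 : encode d.g = encFin d.nK fun k => encFin d.nA fun a => ratEnc (G k a) D := by
    refine encode_finPi _ _ _ fun k => Eq.symm ?_
    refine encode_finPi _ _ _ fun a => ?_
    rw [hG, encode_ratEnc _ _ hD]
  have e3 : encode d.p1 = encFin d.nK fun k => ratEnc (P k) D := by
    refine encode_finPi _ _ _ fun k => ?_
    rw [hP, encode_ratEnc _ _ hD]
  rw [h0, hx, encData, e1, e2, e3]

end enc

section prim
open Encodable

/-- Array access. -/
def lget (c i : ℕ) : ℕ := (Denumerable.ofNat (List ℕ) c).getD i 0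

lemma exists_lget (f : ℕ → ℕ) (N : ℕ) : ∃ c, ∀ i < N, lget c i = f i := by
  refine ⟨encode ((List.range N).map f), fun i hi => ?_⟩
  simp [lget, hi]

lemma exists_lget2 (f : ℕ → ℕ → ℕ) (N : ℕ) :
    ∃ c, ∀ i < N, ∀ j < N, lget c (Nat.pair i j) = f i j := by
  obtain ⟨c, hc⟩ := exists_lget (fun m => f m.unpair.1 m.unpair.2) ((N + 1) ^ 2)
  refine ⟨c, fun i hi j hj => ?_⟩
  rw [hc _ ((Nat.pair_lt_max_add_one_sq i j).trans_le ?_)]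
  · simp
  · exact Nat.pow_le_pow_left (by have := max_lt hi hj; omega) 2

lemma exists_lget4 (f : ℕ → ℕ → ℕ → ℕ → ℕ) (N : ℕ) :
    ∃ c, ∀ i < N, ∀ j < N, ∀ k < N, ∀ l < N,
      lget c (Nat.pair (Nat.pair i j) (Nat.pair k l)) = f i j k l := by
  obtain ⟨c, hc⟩ := exists_lget2 (fun m m' => f m.unpair.1 m.unpair.2 m'.unpair.1 m'.unpair.2)
    ((N + 1) ^ 2)
  have hb : ∀ i < N, ∀ j < N, Nat.pair i j < (N + 1) ^ 2 := fun i hi j hj =>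
    (Nat.pair_lt_max_add_one_sq i j).trans_le
      (Nat.pow_le_pow_left (by have := max_lt hi hj; omega) 2)
  refine ⟨c, fun i hi j hj k hk l hl => ?_⟩
  rw [hc _ (hb i hi j hj) _ (hb k hk l hl)]
  simp

variable {α : Type*} [Primcodable α]

lemma pr_lget {f g : α → ℕ} (hf : Primrec f) (hg : Primrec g) :
    Primrec fun a => lget (f a) (g a) :=
  (Primrec.list_getD 0).comp ((Primrec.ofNat (List ℕ)).comp hf) hg

lemma pr_pair {f g : α → ℕ} (hf : Primrec f) (hg : Primrec g) :
    Primrec fun a => Nat.pair (f a) (g a) := Primrec₂.natPair.comp hf hg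
lemma pr_add {f g : α → ℕ} (hf : Primrec f) (hg : Primrec g) :
    Primrec fun a => f a + g a := Primrec.nat_add.comp hf hg
lemma pr_mul {f g : α → ℕ} (hf : Primrec f) (hg : Primrec g) :
    Primrec fun a => f a * g a := Primrec.nat_mul.comp hf hg
lemma pr_sub {f g : α → ℕ} (hf : Primrec f) (hg : Primrec g) :
    Primrec fun a => f a - g a := Primrec.nat_sub.comp hf hg
lemma pr_div {f g : α → ℕ} (hf : Primrec f) (hg : Primrec g) :
    Primrec fun a => f a / g a := Primrec.nat_div.comp hf hg
lemma pr_mod {f g : α → ℕ} (hf : Primrec f) (hg : Primrec g) :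
    Primrec fun a => f a % g a := Primrec.nat_mod.comp hf hg
lemma pr_max {f g : α → ℕ} (hf : Primrec f) (hg : Primrec g) :
    Primrec fun a => max (f a) (g a) := Primrec.nat_max.comp hf hg
lemma pr_fst {β γ : Type*} [Primcodable β] [Primcodable γ] {f : α → β × γ} (hf : Primrec f) :
    Primrec fun a => (f a).1 := Primrec.fst.comp hf
lemma pr_snd {β γ : Type*} [Primcodable β] [Primcodable γ] {f : α → β × γ} (hf : Primrec f) :
    Primrec fun a => (f a).2 := Primrec.snd.comp hf

lemma pp_le {f g : α → ℕ} (hf : Primrec f) (hg : Primrec g) :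
    PrimrecPred fun a => f a ≤ g a := Primrec.nat_le.comp hf hg
lemma pp_lt {f g : α → ℕ} (hf : Primrec f) (hg : Primrec g) :
    PrimrecPred fun a => f a < g a := Primrec.nat_lt.comp hf hg
lemma pp_eq {f g : α → ℕ} (hf : Primrec f) (hg : Primrec g) :
    PrimrecPred fun a => f a = g a := Primrec.eq.comp hf hg
lemma pp_and {p q : α → Prop} (hp : PrimrecPred p) (hq : PrimrecPred q) :
    PrimrecPred fun a => p a ∧ q a := hp.and hq
lemma pp_or {p q : α → Prop} (hp : PrimrecPred p) (hq : PrimrecPred q) :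
    PrimrecPred fun a => p a ∨ q a := hp.or hq
lemma pp_imp {p q : α → Prop} (hp : PrimrecPred p) (hq : PrimrecPred q) :
    PrimrecPred fun a => p a → q a :=
  (hp.not.or hq).of_eq fun a => by tauto
lemma pp_all {b : α → ℕ} {p : α → ℕ → Prop} (hb : Primrec b)
    (hp : PrimrecPred fun x : α × ℕ => p x.1 x.2) :
    PrimrecPred fun a => ∀ i < b a, p a i := by
  have h1 : PrimrecRel fun (i : ℕ) (a : α) => p a i :=
    hp.comp (Primrec.pair Primrec.snd Primrec.fst)
  exact (h1.forall_mem_list.comp (Primrec.list_range.comp hb) Primrec.id).of_eq fun a => by simp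

lemma pr_gcdP {f g : α → ℕ} (hf : Primrec f) (hg : Primrec g) :
    Primrec fun a => gcdP (f a) (g a) := by
  unfold gcdP
  refine Primrec.nat_findGreatest hg ?_
  refine pp_and (pp_eq (pr_mod (hf.comp Primrec.fst) Primrec.snd) (Primrec.const 0))
    (pp_eq (pr_mod (hg.comp Primrec.fst) Primrec.snd) (Primrec.const 0))

lemma pr_ratEnc {f g : α → ℕ} (hf : Primrec f) (hg : Primrec g) :
    Primrec fun a => ratEnc (f a) (g a) :=
  pr_pair (pr_mul (Primrec.const 2) (pr_div hf (pr_gcdP hf hg))) (pr_div hg (pr_gcdP hf hg))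

lemma pr_ratEncNeg {f g : α → ℕ} (hf : Primrec f) (hg : Primrec g) :
    Primrec fun a => ratEncNeg (f a) (g a) :=
  pr_pair (pr_add (pr_mul (Primrec.const 2)
    (pr_sub (pr_div hf (pr_gcdP hf hg)) (Primrec.const 1))) (Primrec.const 1))
    (pr_div hg (pr_gcdP hf hg))

lemma pr_encFin {b : α → ℕ} {f : α → ℕ → ℕ} (hb : Primrec b)
    (hf : Primrec fun x : α × ℕ => f x.1 x.2) : Primrec fun a => encFin (b a) (f a) :=
  Primrec.encode.comp (Primrec.list_map (Primrec.list_range.comp hb)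
    (Primrec₂.mk (pr_pair Primrec.snd hf)))

lemma pr_sum {b : α → ℕ} {f : α → ℕ → ℕ} (hb : Primrec b)
    (hf : Primrec fun x : α × ℕ => f x.1 x.2) :
    Primrec fun a => ∑ i ∈ Finset.range (b a), f a i := by
  have h : Primrec fun a => (Nat.rec 0 (fun i r => r + f a i) (b a) : ℕ) :=
    Primrec.nat_rec' hb (Primrec.const 0) (h := fun a x => x.2 + f a x.1)
      (pr_add (pr_snd Primrec.snd)
        (hf.comp (Primrec.pair Primrec.fst (Primrec.fst.comp Primrec.snd))))
  refine h.of_eq fun a => ?_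
  induction b a with
  | zero => rfl
  | succ n ih => rw [Finset.sum_range_succ, ← ih]

/-- The certificate relation. -/
def RP (n c : ℕ) : Prop :=
  let nK := lget c 0
  let nA := lget c 1
  let nS := lget c 2
  let D := lget c 3
  let X := lget c 4
  let Q := fun k a k' s => lget (lget c 5) (Nat.pair (Nat.pair k a) (Nat.pair k' s))
  let G := fun k a => lget (lget c 6) (Nat.pair k a)
  let P := fun k => lget (lget c 7) k
  let u := fun k => lget (lget c 8) k
  let v := fun k => lget (lget c 9) k
  0 < nK ∧ 0 < nA ∧ 0 < nS ∧ 0 < D ∧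
  (∀ k < nK, ∀ a < nA, ∑ k' ∈ Finset.range nK, ∑ s ∈ Finset.range nS, Q k a k' s = D) ∧
  (∀ k < nK, ∀ a < nA, G k a ≤ D) ∧ (∑ k ∈ Finset.range nK, P k = D) ∧
  EnumOK nK nS u v ∧
  ((n = encData nK nA nS u v Q G P D (ratEncNeg X D) ∧ 0 < X) ∨
   (n = encData nK nA nS u v Q G P D (ratEnc X D) ∧
    CertOK nK nA nS Q G P X D (lget c 10) (lget c 11) (lget c 12) (lget c 13)
      (fun i => lget (lget c 14) i) (fun i s => lget (lget c 15) (Nat.pair i s))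
      (fun i s => lget (lget c 16) (Nat.pair i s)) (fun i s => lget (lget c 17) (Nat.pair i s))))

theorem RP_prim : PrimrecPred fun x : ℕ × ℕ => RP x.1 x.2 := by
  unfold RP EnumOK CertOK encData
  dsimp only
  repeat' first
    | with_reducible exact Primrec.const _
    | with_reducible exact Primrec.id
    | with_reducible exact Primrec.fst
    | with_reducible exact Primrec.snd
    | with_reducible apply pp_and
    | with_reducible apply pp_or
    | with_reducible apply pp_all
    | with_reducible apply pp_imp
    | with_reducible apply pp_le
    | with_reducible apply pp_lt
    | with_reducible apply pp_eq
    | with_reducible apply pr_sum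
    | with_reducible apply pr_encFin
    | with_reducible apply pr_ratEnc
    | with_reducible apply pr_ratEncNeg
    | with_reducible apply pr_lget
    | with_reducible apply pr_pair
    | with_reducible apply pr_add
    | with_reducible apply pr_mul
    | with_reducible apply pr_max
    | with_reducible apply pr_fst
    | with_reducible apply pr_snd

theorem re_exists {R : ℕ → ℕ → Prop} (hR : PrimrecPred fun x : ℕ × ℕ => R x.1 x.2) :
    REPred fun n => ∃ c, R n c := by
  classical
  have h : Partrec (fun n : ℕ ↦ Nat.rfind fun c => Part.some (decide (R n c))) :=
    Partrec.rfind (hR.computablePred.decide.partrec)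
  refine h.dom_re.of_eq fun n => ?_
  refine Nat.rfind_dom.trans ?_
  simp

end prim

section fin
open Encodable

lemma CertOK.congr {nK nA nS : ℕ} {Q : ℕ → ℕ → ℕ → ℕ → ℕ} {G : ℕ → ℕ → ℕ} {P : ℕ → ℕ} {X D : ℕ}
    {M M0 i0 e : ℕ} {act : ℕ → ℕ} {next W H : ℕ → ℕ → ℕ} {act' : ℕ → ℕ} {next' W' H' : ℕ → ℕ → ℕ}
    (h : CertOK nK nA nS Q G P X D M M0 i0 e act next W H)
    (ha : ∀ i < M, act' i = act i) (hn : ∀ i < M, ∀ s < nS, next' i s = next i s)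
    (hW : ∀ i < M, ∀ k < nK, W' i k = W i k) (hH : ∀ i < M, ∀ k < nK, H' i k = H i k) :
    CertOK nK nA nS Q G P X D M M0 i0 e act' next' W' H' := by
  obtain ⟨h1, h2, h3, h4, h5, h6, h7, h8⟩ := h
  have hlt : ∀ i < M, ∀ s < nS, next i s < M := fun i hi s hs =>
    (h4 i hi s hs).trans_le (max_le hi.le h1)
  refine ⟨h1, h2, fun i hi => by rw [ha i hi]; exact h3 i hi,
    fun i hi s hs => by rw [hn i hi s hs]; exact h4 i hi s hs, ?_, ?_, ?_, ?_⟩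
  · intro i hi k hk
    rw [hW i hi k hk, ha i hi]
    refine (h5 i hi k hk).trans (le_of_eq ?_)
    refine Finset.sum_congr rfl fun k' hk' => Finset.sum_congr rfl fun s hs => ?_
    rw [Finset.mem_range] at hk' hs
    rw [hn i hi s hs, hW _ (hlt i hi s hs) k' hk']
  · intro i hi k hk k' hk' s hs hq
    have hi' := hi.trans_le h1
    rw [ha i hi'] at hq
    rw [hW i hi' k hk, hn i hi' s hs, hW _ (hlt i hi' s hs) k' hk']
    exact h6 i hi k hk k' hk' s hs hq
  · intro i hi k hk
    rw [hW i hi k hk, hH i hi k hk, ha i hi]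
    refine (h7 i hi k hk).trans (le_of_eq ?_)
    congr 1
    refine Finset.sum_congr rfl fun k' hk' => Finset.sum_congr rfl fun s hs => ?_
    rw [Finset.mem_range] at hk' hs
    rw [hn i hi s hs, hH _ (hlt i hi s hs) k' hk']
  · refine h8.trans_le (le_of_eq ?_)
    refine Finset.sum_congr rfl fun k hk => ?_
    rw [Finset.mem_range] at hk
    rw [hW _ h2 k hk]

lemma lget_encode (l : List ℕ) (i : ℕ) : lget (encode l) i = l.getD i 0 := by
  simp [lget]

lemma cast_sum_one {n : ℕ} (f : Fin n → ℚ) (h : ∑ k, f k = 1) : ∑ k, (f k : ℝ) = 1 := by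
  exact_mod_cast h

lemma rat_scale (r : ℚ) (hr : 0 ≤ r) (D : ℕ) (hD : r.den ∣ D) : ∃ m : ℕ, (m : ℚ) = r * D := by
  obtain ⟨l, rfl⟩ := hD
  refine ⟨r.num.toNat * l, ?_⟩
  have h1 : ((r.num.toNat : ℤ) : ℚ) = r.num := by
    rw [Int.toNat_of_nonneg (Rat.num_nonneg.2 hr)]
  rw [Int.cast_natCast] at h1
  push_cast
  rw [h1, ← mul_assoc, Rat.mul_den_eq_num]

lemma exists_scaled (d : RatData) (hd : d.Valid) (T : ℕ) :
    ∃ D X cQ cG cP : ℕ, T ≤ D ∧ 0 < D ∧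
      (∀ (k : Fin d.nK) (a : Fin d.nA) (y : Fin d.nK × Fin d.nS), (lget cQ (Nat.pair (Nat.pair k a) (Nat.pair y.1 y.2)) : ℚ) = d.q k a y * D) ∧
      (∀ (k : Fin d.nK) (a : Fin d.nA), (lget cG (Nat.pair k a) : ℚ) = d.g k a * D) ∧
      (∀ k : Fin d.nK, (lget cP k : ℚ) = d.p1 k * D) ∧ (X : ℚ) = |d.x| * D := by
  classical
  obtain ⟨-, -, -, hq, -, hg, -, hp, -⟩ := hd
  let s : Finset ℚ := (Finset.univ.image fun z : Fin d.nK × Fin d.nA × (Fin d.nK × Fin d.nS) =>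
      d.q z.1 z.2.1 z.2.2) ∪ (Finset.univ.image fun z : Fin d.nK × Fin d.nA => d.g z.1 z.2) ∪
      (Finset.univ.image d.p1) ∪ {|d.x|}
  let B := ∏ r ∈ s, r.den
  have hB : 0 < B := Finset.prod_pos fun r _ => r.den_pos
  have hdv : ∀ r ∈ s, 0 ≤ r → ∃ m : ℕ, (m : ℚ) = r * (B * (T + 1) : ℕ) := fun r hr h0 =>
    rat_scale r h0 _ ((Finset.dvd_prod_of_mem _ hr).mul_right _)
  have h1 : ∀ k a y, ∃ m : ℕ, (m : ℚ) = d.q k a y * (B * (T + 1) : ℕ) := fun k a y =>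
    hdv _ (by
      refine Finset.mem_union_left _ (Finset.mem_union_left _ (Finset.mem_union_left _ ?_))
      exact Finset.mem_image.2 ⟨(k, a, y), Finset.mem_univ _, rfl⟩) (hq k a y)
  have h2 : ∀ k a, ∃ m : ℕ, (m : ℚ) = d.g k a * (B * (T + 1) : ℕ) := fun k a =>
    hdv _ (by
      refine Finset.mem_union_left _ (Finset.mem_union_left _ (Finset.mem_union_right _ ?_))
      exact Finset.mem_image.2 ⟨(k, a), Finset.mem_univ _, rfl⟩) (hg k a)
  have h3 : ∀ k, ∃ m : ℕ, (m : ℚ) = d.p1 k * (B * (T + 1) : ℕ) := fun k =>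
    hdv _ (by
      refine Finset.mem_union_left _ (Finset.mem_union_right _ ?_)
      exact Finset.mem_image.2 ⟨k, Finset.mem_univ _, rfl⟩) (hp k)
  obtain ⟨X, hX⟩ := hdv |d.x| (Finset.mem_union_right _ (Finset.mem_singleton_self _)) (abs_nonneg _)
  choose mQ hmQ using h1
  choose mG hmG using h2
  choose mP hmP using h3
  obtain ⟨cQ, hcQ⟩ := exists_lget4 (fun k a k' s => if h : k < d.nK ∧ a < d.nA ∧ k' < d.nK ∧ s < d.nS
    then mQ ⟨k, h.1⟩ ⟨a, h.2.1⟩ (⟨k', h.2.2.1⟩, ⟨s, h.2.2.2⟩) else 0) (d.nK + d.nA + d.nS)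
  obtain ⟨cG, hcG⟩ := exists_lget2 (fun k a => if h : k < d.nK ∧ a < d.nA
    then mG ⟨k, h.1⟩ ⟨a, h.2⟩ else 0) (d.nK + d.nA)
  obtain ⟨cP, hcP⟩ := exists_lget (fun k => if h : k < d.nK then mP ⟨k, h⟩ else 0) d.nK
  refine ⟨B * (T + 1), X, cQ, cG, cP, ?_, by positivity, ?_, ?_, ?_, hX⟩
  · nlinarith
  · intro k a y
    rw [hcQ k (by omega) a (by omega) y.1 (by omega) y.2 (by omega), ← hmQ]
    simp
  · intro k a
    rw [hcG k (by omega) a (by omega), ← hmG]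
    simp
  · intro k
    rw [hcP k k.2, ← hmP]
    simp

lemma RP_sound (n c : ℕ) (h : RP n c) : ∃ (d : RatData) (hd : d.Valid), encode d = n ∧
    (d.x : ℝ) < (d.toPOMDP hd).val (fun k => (d.p1 k : ℝ)) := by
  unfold RP at h
  generalize lget c 0 = nK at h
  generalize lget c 1 = nA at h
  generalize lget c 2 = nS at h
  generalize lget c 3 = D at h
  generalize lget c 4 = X at h
  simp only at h
  generalize hQ : (fun k a k' s => lget (lget c 5) (Nat.pair (Nat.pair k a) (Nat.pair k' s))) = Q at h
  generalize hG : (fun k a => lget (lget c 6) (Nat.pair k a)) = G at h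
  generalize hP : (fun k => lget (lget c 7) k) = P at h
  obtain ⟨hK, hA, hS, hD, q1, g1, p1, huv, hor⟩ := h
  have q1' : ∀ k < nK, ∀ a < nA, ∑ k' ∈ Finset.range nK, ∑ s ∈ Finset.range nS, Q k a k' s = D := by
    subst hQ; exact q1
  have g1' : ∀ k < nK, ∀ a < nA, G k a ≤ D := by subst hG; exact g1
  have p1' : ∑ k ∈ Finset.range nK, P k = D := by subst hP; exact p1
  have hDq : (0 : ℚ) < D := by exact_mod_cast hD
  have hDr : (0 : ℝ) < D := by exact_mod_cast hD
  let mk : ℚ → RatData := fun x => ⟨nK, nA, nS, fun k a y => (Q k a y.1 y.2 : ℚ) / D,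
    fun k a => (G k a : ℚ) / D, fun k => (P k : ℚ) / D, x⟩
  have hv : ∀ x, (mk x).Valid := by
    intro x
    refine ⟨hK, hA, hS, fun k a y => by positivity, fun k a => ?_, fun k a => by positivity,
      fun k a => ?_, fun k => by positivity, ?_⟩
    · have h1 := q1' k k.2 a a.2
      simp only [mk]
      rw [← Finset.sum_div, div_eq_one_iff_eq hDq.ne', Fintype.sum_prod_type, ← h1]
      push_cast
      simp only [Finset.sum_range]
    · rw [div_le_one hDq]
      exact_mod_cast g1' k k.2 a a.2
    · simp only [mk]
      rw [← Finset.sum_div, div_eq_one_iff_eq hDq.ne', ← p1']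
      push_cast
      simp only [Finset.sum_range]
  have hbel : ∀ x, IsBelief (fun k : ((mk x).toPOMDP (hv x)).K => ((mk x).p1 k : ℝ)) := by
    intro x
    obtain ⟨-, -, -, -, -, -, -, hb, hb'⟩ := hv x
    exact ⟨fun k => Rat.cast_nonneg.2 (hb k), cast_sum_one _ hb'⟩
  have henc : ∀ x xc, encode x = xc → encode (mk x) = encData nK nA nS _ _ Q G P D xc :=
    fun x xc hx => encode_data (mk x) _ _ Q G P D xc hD huv (fun _ _ _ => rfl) (fun _ _ => rfl)
      (fun _ => rfl) hx
  rcases hor with ⟨hn, hX⟩ | ⟨hn, hc⟩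
  · refine ⟨mk (-((X : ℚ) / D)), hv _, ?_, ?_⟩
    · rw [hn]
      exact henc _ _ (encode_ratEncNeg X D hX hD)
    · have h0 : (0 : ℝ) ≤ ((mk (-((X : ℚ) / D))).toPOMDP (hv _)).val
          (fun k => ((mk (-((X : ℚ) / D))).p1 k : ℝ)) :=
        (POMDP.pay_nonneg _ _ (hbel _) (fun _ => ⟨0, hA⟩)).trans (POMDP.pay_le_val _ _ (hbel _) _)
      refine lt_of_lt_of_le ?_ h0
      have : (0 : ℝ) < (X : ℝ) / D := div_pos (by exact_mod_cast hX) hDr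
      simp only [mk]
      push_cast
      linarith
  · refine ⟨mk ((X : ℚ) / D), hv _, ?_, ?_⟩
    · rw [hn]
      exact henc _ _ (encode_ratEnc X D hD)
    · have := cert_sound ((mk ((X : ℚ) / D)).toPOMDP (hv _)) (fun k => ((mk ((X : ℚ) / D)).p1 k : ℝ))
        Q G P (hbel _) X D hD ?_ ?_ ?_ _ _ _ _ _ _ _ _ hc
      · refine lt_of_eq_of_lt ?_ this
        simp [mk]
      · intro k a y
        simp only [mk, RatData.toPOMDP]
        push_cast
        field_simp
      · intro k a
        simp only [mk, RatData.toPOMDP]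
        push_cast
        field_simp
      · intro k
        simp only [mk]
        push_cast
        field_simp

lemma RP_complete (d : RatData) (hd : d.Valid)
    (h : (d.x : ℝ) < (d.toPOMDP hd).val (fun k => (d.p1 k : ℝ))) : ∃ c, RP (encode d) c := by
  have hbel : IsBelief (fun k : (d.toPOMDP hd).K => (d.p1 k : ℝ)) := by
    obtain ⟨-, -, -, -, -, -, -, hb, hb'⟩ := hd
    exact ⟨fun k => Rat.cast_nonneg.2 (hb k), cast_sum_one _ hb'⟩
  obtain ⟨T, hT⟩ := cert_complete (d.toPOMDP hd) (fun k => (d.p1 k : ℝ)) hbel d.x h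
  obtain ⟨D, X, cQ, cG, cP, hTD, hD, hQ, hG, hP, hX⟩ := exists_scaled d hd T
  have hDq : (0 : ℚ) < D := by exact_mod_cast hD
  obtain ⟨u, v, huv⟩ := exists_enum d.nK d.nS
  obtain ⟨cu, hcu⟩ := exists_lget u (d.nK * d.nS)
  obtain ⟨cv, hcv⟩ := exists_lget v (d.nK * d.nS)
  have huv' : EnumOK d.nK d.nS (fun k => lget cu k) (fun k => lget cv k) := by
    refine ⟨fun j hj => ?_, fun j hj => ?_, fun j hj i hi => ?_⟩
    · simp only [hcu j hj]; exact huv.1 j hj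
    · simp only [hcv j hj]; exact huv.2.1 j hj
    · simp only [hcu j hj, hcv j hj, hcu i (hi.trans hj), hcv i (hi.trans hj)]
      exact huv.2.2 j hj i hi
  have henc : ∀ xc, encode d.x = xc → encode d = encData d.nK d.nA d.nS _ _
      (fun k a k' s => lget cQ (Nat.pair (Nat.pair k a) (Nat.pair k' s)))
      (fun k a => lget cG (Nat.pair k a)) (fun k => lget cP k) D xc :=
    fun xc hx => encode_data d _ _ _ _ _ D xc hD huv'
      (fun k a y => by rw [hQ, mul_div_cancel_right₀ _ hDq.ne'])
      (fun k a => by rw [hG, mul_div_cancel_right₀ _ hDq.ne'])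
      (fun k => by rw [hP, mul_div_cancel_right₀ _ hDq.ne']) hx
  have q1 : ∀ k < d.nK, ∀ a < d.nA, ∑ k' ∈ Finset.range d.nK, ∑ s ∈ Finset.range d.nS,
      lget cQ (Nat.pair (Nat.pair k a) (Nat.pair k' s)) = D := by
    intro k hk a ha
    have h1 := hd.2.2.2.2.1 ⟨k, hk⟩ ⟨a, ha⟩
    have h2 : ∑ y, d.q ⟨k, hk⟩ ⟨a, ha⟩ y * D = D := by rw [← Finset.sum_mul, h1, one_mul]
    simp only [← hQ, Fintype.sum_prod_type] at h2
    simp only [Finset.sum_range]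
    exact_mod_cast h2
  have g1 : ∀ k < d.nK, ∀ a < d.nA, lget cG (Nat.pair k a) ≤ D := by
    intro k hk a ha
    have h1 := hd.2.2.2.2.2.2.1 ⟨k, hk⟩ ⟨a, ha⟩
    have h2 := hG ⟨k, hk⟩ ⟨a, ha⟩
    have h3 : (lget cG (Nat.pair k a) : ℚ) ≤ D := by
      simp only at h2
      rw [h2]
      nlinarith
    exact_mod_cast h3
  have p1 : ∑ k ∈ Finset.range d.nK, lget cP k = D := by
    have h2 : ∑ y, d.p1 y * D = D := by
      rw [← Finset.sum_mul, hd.2.2.2.2.2.2.2.2, one_mul]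
    simp only [← hP] at h2
    simp only [Finset.sum_range]
    exact_mod_cast h2
  rcases lt_or_ge d.x 0 with hx | hx
  · refine ⟨encode [d.nK, d.nA, d.nS, D, X, cQ, cG, cP, cu, cv], ?_⟩
    have hX2 : d.x = -((X : ℚ) / D) := by
      rw [hX, abs_of_neg hx, mul_div_cancel_right₀ _ hDq.ne', neg_neg]
    have hX0 : 0 < X := by
      have : (0 : ℚ) < X := by rw [hX]; exact mul_pos (abs_pos.2 hx.ne) hDq
      exact_mod_cast this
    unfold RP
    simp only [lget_encode, List.getD_cons_zero, List.getD_cons_succ]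
    refine ⟨hd.1, hd.2.1, hd.2.2.1, hD, q1, g1, p1, huv', Or.inl ⟨?_, hX0⟩⟩
    exact henc _ (by rw [hX2, encode_ratEncNeg X D hX0 hD])
  · have hX2 : d.x = (X : ℚ) / D := by
      rw [hX, abs_of_nonneg hx, mul_div_cancel_right₀ _ hDq.ne']
    obtain ⟨M, M0, i0, e, act, next, W, H, hc⟩ := hT D X
      (fun k a k' s => lget cQ (Nat.pair (Nat.pair k a) (Nat.pair k' s)))
      (fun k a => lget cG (Nat.pair k a)) (fun k => lget cP k) hTD hD
      (by rw [abs_of_nonneg hx] at hX; exact_mod_cast hX)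
      (fun k a y => by
        have := hQ k a y
        have h2 : ((lget cQ (Nat.pair (Nat.pair k a) (Nat.pair y.1 y.2)) : ℚ) : ℝ) =
          ((d.q k a y * D : ℚ) : ℝ) := by rw [this]
        push_cast at h2
        exact h2)
      (fun k a => by
        have h2 : ((lget cG (Nat.pair k a) : ℚ) : ℝ) = ((d.g k a * D : ℚ) : ℝ) := congrArg _ (hG k a)
        push_cast at h2
        exact h2)
      (fun k => by
        have h2 : ((lget cP k : ℚ) : ℝ) = ((d.p1 k * D : ℚ) : ℝ) := congrArg _ (hP k)
        push_cast at h2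
        exact h2)
    obtain ⟨ca, hca⟩ := exists_lget act M
    obtain ⟨cn, hcn⟩ := exists_lget2 next (M + d.nK + d.nS)
    obtain ⟨cW, hcW⟩ := exists_lget2 W (M + d.nK + d.nS)
    obtain ⟨cH, hcH⟩ := exists_lget2 H (M + d.nK + d.nS)
    refine ⟨encode [d.nK, d.nA, d.nS, D, X, cQ, cG, cP, cu, cv, M, M0, i0, e, ca, cn, cW, cH], ?_⟩
    have hc' := hc.congr (act' := fun i => lget ca i) (next' := fun i s => lget cn (Nat.pair i s))
      (W' := fun i s => lget cW (Nat.pair i s)) (H' := fun i s => lget cH (Nat.pair i s))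
      hca (fun i hi s hs => hcn i (by omega) s (by have : s < d.nS := hs; omega))
      (fun i hi s hs => hcW i (by omega) s (by have : s < d.nK := hs; omega))
      (fun i hi s hs => hcH i (by omega) s (by have : s < d.nK := hs; omega))
    unfold RP
    simp only [lget_encode, List.getD_cons_zero, List.getD_cons_succ]
    refine ⟨hd.1, hd.2.1, hd.2.2.1, hD, q1, g1, p1, huv', Or.inr ⟨?_, hc'⟩⟩
    exact henc _ (by rw [hX2, encode_ratEnc X D hD])

end fin

/-- The set of (codes of) rational POMDP instances whose value exceeds the rational
threshold `x` is recursively enumerable. -/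
theorem value_gt_is_re :
    REPred (fun n : ℕ => ∃ (d : RatData) (hd : d.Valid),
      Encodable.encode d = n ∧
        (d.x : ℝ) < (d.toPOMDP hd).val (fun k => (d.p1 k : ℝ))) := by
  refine (re_exists RP_prim).of_eq fun n => ⟨?_, ?_⟩
  · rintro ⟨c, hc⟩
    exact RP_sound n c hc
  · rintro ⟨d, hd, rfl, h⟩
    exact RP_complete d hd h

end PomdpPaper
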